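/- **Data and queries.** A *data schema* $D=\langle \mathit{Cat},\mathsf{CType},\mathit{Repo},X\rangle$ consists of a read-only catalog $\mathit{Cat}$ of finitely many relation schemas, each with a primary key $R.\mathrm{id}$ of its own identifier type and further attributes, where attributes of identifier type are foreign keys; a repository $\mathit{Repo}$ of finitely many updatable relation schemas; a type $\mathsf{CType}$ of case identifiers; and a finite set $X$ of typed case variables, containing $\mathit{self}$ of type $\mathsf{CType}$. Each type has a set of constant objects, among them $\mathtt{undef}$. The *characteristic graph* of the catalog has the attributes as nodes, with edges from $R.\mathrm{id}$ to every other attribute of $R$ and from every foreign key to the key it references. A *conjunctive query with filters* is a conjunction of (possibly negated) equalities and (possibly negated) relational atoms over $\mathit{Cat}\cup\mathit{Repo}$, with arguments that are data variables, case variables or constants. A *guard* is an expression $q(\vec x)\leftarrow\bigvee_{i=1}^n Q_i$ with conjunctive queries with filters $Q_i$, where all answer variables $\vec x$ are data variables occurring in every $Q_i$; it is *boolean* if $\vec x$ is empty, and *repo-free* if no atom is over $\mathit{Repo}$. It is *separated* if distinct disjuncts have no data variable in common and each $Q_i$ is of the form $\chi\wedge R(\vec y)\wedge\xi$ (each part optional),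 where $\chi,\xi$ are conjunctive queries with filters over $\mathit{Cat}$ only, $R\in\mathit{Repo}$, $\vec y$ consists of data variables and constants, $\xi$ mentions no case variable, and $\chi$ has no data variable in common with $\vec y$ or $\xi$. **Processes.** An *update specification* $u=\langle \mathrm{pre}(u),\mathrm{eff}(u)\rangle$ consists of a guard and an effect, which uses only constants and answer variables of the guard and never sets $\mathit{self}$. The effect is one of: *insert&set* (insert a tuple into a repository relation, and set some case variables), *set* (only set some case variables), *delete&set* (delete a tuple from a repository relation, and set some case variables), *conditional update* (apply a nested IF-THEN-ELSE with repo-free filters to all tuples $R(\vec v)$ of a repository relation, $\vec v$ new variables). A *DAB* $M=\langle D,P\rangle$ consists of a data schema and a block-structured BPMN process $P$ over $D$: a process block whose nested blocks are empty blocks, atomic and (for set effects) nonatomic tasks, catch events, subprocesses, sequence, possible completion, deferred choice, parallel, exclusive choice, inclusive choice, loop, event-driven choice, and backward, forward and non-interrupting exception handling; tasks and events carry update specifications, and choice points carry conditions, that is, Boolean combinations of equalities between case variables and constants. $M$ is *acyclic* if the characteristic graph of its catalog is, and *case-identifier-agnostic* if neither its update specifications nor its conditions mention $\mathit{self}$.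 A *property* is a conjunction $\bigwedge_{i} G_i[i]$ of guards about finitely many, pairwise different cases $i$, which may also mention the lifecycle variables of the blocks, and all data variables of which occur in repository atoms; it is *separated* if all $G_i$ are. **BackReach.** $M$ is translated into an array-based relational artifact system over the DB theory $T$ given by unary functions from the key to the other attributes of each catalog relation, by constants denoting pairwise distinct objects, and by the axioms $\forall x\,(x=\mathtt{undef}\leftrightarrow f(x)=\mathtt{undef})$. Its arrays are one for each case variable and each lifecycle variable of a block, indexed by an unbounded sort of cases, and one for each attribute of each repository relation, indexed by an unbounded sort of entries. Initially all lifecycle variables are $\mathtt{idle}$ and all other arrays $\mathtt{undef}$, except that of $\mathit{self}$, which is injective and never modified. The transition formulas are the execution rules of the blocks; under the *multiset* insertion semantics, an insertion writes the tuple into an undefined entry and changes no other entry. BackReach applied to $M$ and a property, translated into an existential formula $\upsilon$, starts with $\varphi:=\upsilon$, $B:=\bot$; while $\varphi\wedge\neg B$ is $T$-satisfiable it returns `unsafe` if $\iota\wedge\varphi$ is $T$-satisfiable ($\iota$ the initial formula) and otherwise sets $B:=\varphi\vee B$ and then $\varphi:=\mathsf{QE}(T^*,\mathrm{Pre}(\tau,\varphi))$,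 with $\tau$ the disjunction of the transition formulas and $\mathsf{QE}(T^*,\cdot)$ the elimination of quantified data variables in the model completion $T^*$ of $T$; when the loop ends it returns `safe`. **Theorem.** Let $M$ be a case-identifier-agnostic, acyclic DAB using the multiset insertion semantics such that every update specification $u$ of $M$ satisfies: 1. if $\mathrm{eff}(u)$ is an insert&set rule (with an explicit INSERT part), then $\mathrm{pre}(u)$ is repo-free; 2. if $\mathrm{eff}(u)$ is a set rule, then either $\mathrm{pre}(u)$ is repo-free, or $\mathrm{pre}(u)$ is separated, all case variables other than $\mathit{self}$ appear in the SET part, and $u$ is join-free; 3. if $\mathrm{eff}(u)$ is a delete&set rule, then $\mathrm{pre}(u)$ is separated, all case variables other than $\mathit{self}$ appear in the SET part, and $u$ is join-free; 4. if $\mathrm{eff}(u)$ is a conditional update rule, then $\mathrm{pre}(u)$ is repo-free and boolean, and $\mathrm{eff}(u)$ only uses the new variables introduced in its UPDATE part and constants. Here $u$ is *join-free* if the disjuncts of $\mathrm{pre}(u)$ have decompositions $\chi\wedge R(\vec y)\wedge\xi$ as above such that $\mathrm{eff}(u)$ uses no variable of $\chi$ and such that, if $\mathrm{eff}(u)$ deletes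 a tuple that does not consist of constants only, this is the tuple $R(\vec y)$ whenever the disjunct has a repository atom. Then, for every separated property, BackReach terminates on $M$ and the property, with unboundedly many concurrent cases. -/

import Mathlib

/-! # Relational artifact systems and backward reachability -/

namespace Dab

/-- A DB signature (sorts, constants, unary functions) together with an artifact extension
(artifact sorts, i.e. index sorts) and an artifact setting (artifact components, i.e. arrays
from an artifact sort to a basic sort). -/
structure Sig where
  /-- basic sorts -/
  S : Type
  /-- constants -/
  K : S → Type
  undef : (s : S) → K s
  /-- unary function symbols -/
  F : Type
  src : F → S
  tgt : F → S
  /-- artifact sorts -/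
  E : Type
  /-- artifact components -/
  A : Type
  asrc : A → E
  atgt : A → S

/-- Terms over index variables `J` and data variables `X`. -/
inductive Tm (sg : Sig) (J : sg.E → Type) (X : sg.S → Type) : sg.S → Type
  | const {s : sg.S} (k : sg.K s) : Tm sg J X s
  | dvar {s : sg.S} (x : X s) : Tm sg J X s
  | app (f : sg.F) (t : Tm sg J X (sg.src f)) : Tm sg J X (sg.tgt f)
  | read (a : sg.A) (j : J (sg.asrc a)) : Tm sg J X (sg.atgt a)

/-- Quantifier-free formulae. -/
inductive QF (sg : Sig) (J : sg.E → Type) (X : sg.S → Type) : Type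
  | tru : QF sg J X
  | eq {s : sg.S} (t u : Tm sg J X s) : QF sg J X
  | idxEq {e : sg.E} (i j : J e) : QF sg J X
  | not (φ : QF sg J X) : QF sg J X
  | and (φ ψ : QF sg J X) : QF sg J X

/-- Case-defined functions, as nested if-then-else. -/
inductive CaseTm (sg : Sig) (J : sg.E → Type) (X : sg.S → Type) (s : sg.S) : Type
  | leaf (t : Tm sg J X s) : CaseTm sg J X s
  | ite (κ : QF sg J X) (t u : CaseTm sg J X s) : CaseTm sg J X s

/-- The index variables `I` together with one more variable, the `y` of `λ y. G(y, …)`,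
of sort `y₀`. -/
inductive ITm {E : Type} (I : E → Type) (y₀ : E) : E → Type
  | var {e : E} (v : I e) : ITm I y₀ e
  | lam : ITm I y₀ y₀

def QF.conj {sg : Sig} {J : sg.E → Type} {X : sg.S → Type} : List (QF sg J X) → QF sg J X
  | [] => .tru
  | φ :: l => .and φ (QF.conj l)

def QF.disj {sg : Sig} {J : sg.E → Type} {X : sg.S → Type} : List (QF sg J X) → QF sg J X
  | [] => .not .tru
  | φ :: l => .not (.and (.not φ) (.not (QF.disj l)))

/-- The literal with atom `φ` and the given sign. -/
def QF.signed {sg : Sig} {J : sg.E → Type} {X : sg.S → Type} :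
    Bool → QF sg J X → QF sg J X
  | true, φ => φ
  | false, φ => .not φ

/-- A transition formula `∃ e d, guard(e, d, a) ∧ ⋀_a a' = λ y. update_a(y, e, d, a)`, where
`e` are index variables and `d` data variables (only finitely many of them occur). -/
structure Transition (sg : Sig) where
  I : sg.E → Type
  X : sg.S → Type
  guard : QF sg I X
  update : (a : sg.A) → CaseTm sg (ITm I (sg.asrc a)) X (sg.atgt a)

/-- An existential formula `∃ e d, matrix(e, d, a)` over the artifact setting. -/
structure ExFormula (sg : Sig) where
  I : sg.E → Type
  X : sg.S → Type
  matrix : QF sg I X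

/-- Structures for the DB signature. -/
structure DBModel (sg : Sig) where
  carrier : sg.S → Type
  const : (s : sg.S) → sg.K s → carrier s
  fn : (f : sg.F) → carrier (sg.src f) → carrier (sg.tgt f)

/-- The DB theory `T`: the axioms `∀ x, x = undef ↔ f x = undef`; the constants are names of
objects, so different constants denote different elements. -/
structure DBModel.IsModelOfT {sg : Sig} (M : DBModel sg) : Prop where
  undef_iff : ∀ (f : sg.F) (x : M.carrier (sg.src f)),
    x = M.const _ (sg.undef _) ↔ M.fn f x = M.const _ (sg.undef _)
  const_injective : ∀ s, Function.Injective (M.const s)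

/-- Embeddings of structures of the DB signature. -/
structure DBModel.Embedding {sg : Sig} (M N : DBModel sg) where
  toFun : (s : sg.S) → M.carrier s → N.carrier s
  injective : ∀ s, Function.Injective (toFun s)
  map_const : ∀ s k, toFun s (M.const s k) = N.const s k
  map_fn : ∀ f x, toFun _ (M.fn f x) = N.fn f (toFun _ x)

section Eval

variable {sg : Sig} (M : DBModel sg) {idx : sg.E → Type}
  (arr : (a : sg.A) → idx (sg.asrc a) → M.carrier (sg.atgt a))
  {J : sg.E → Type} {X : sg.S → Type}
  (μ : (e : sg.E) → J e → idx e) (ρ : (s : sg.S) → X s → M.carrier s)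

def Tm.eval : {s : sg.S} → Tm sg J X s → M.carrier s
  | _, .const k => M.const _ k
  | _, .dvar x => ρ _ x
  | _, .app f t => M.fn f t.eval
  | _, .read a j => arr a (μ _ j)

def QF.Holds : QF sg J X → Prop
  | .tru => True
  | .eq t u => t.eval M arr μ ρ = u.eval M arr μ ρ
  | .idxEq i j => μ _ i = μ _ j
  | .not φ => ¬ φ.Holds
  | .and φ ψ => φ.Holds ∧ ψ.Holds

open Classical in
noncomputable def CaseTm.eval {s : sg.S} : CaseTm sg J X s → M.carrier s
  | .leaf t => t.eval M arr μ ρ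
  | .ite κ t u => if κ.Holds M arr μ ρ then t.eval else u.eval

end Eval

/-- The valuation of `ITm I y₀` given by a valuation of `I` and the value `j` of `y`. -/
def ITm.eval {E : Type} {I : E → Type} {y₀ : E} {idx : E → Type}
    (μ : (e : E) → I e → idx e) (j : idx y₀) : (e : E) → ITm I y₀ e → idx e
  | _, .var v => μ _ v
  | _, .lam => j

/-- Array-based relational artifact systems. The initial formula is `⋀ a = λ y. init a` for all
arrays that are not rigid. A rigid array is never modified and its elements are pairwise
distinct. (No individual artifact variables occur when the number of cases is unbounded.) -/
structure RAS where
  sg : Sig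
  rigid : Set sg.A
  init : (a : sg.A) → sg.K (sg.atgt a)
  trans : List (Transition sg)

/-- A model of `T` over the extended signature together with an assignment to the arrays. -/
structure RAS.Config (S : RAS) where
  M : DBModel S.sg
  isModel : M.IsModelOfT
  idx : S.sg.E → Type
  idx_nonempty : ∀ e, Nonempty (idx e)
  arr : (a : S.sg.A) → idx (S.sg.asrc a) → M.carrier (S.sg.atgt a)
  rigid_injective : ∀ a ∈ S.rigid, Function.Injective (arr a)

/-- A formula over the artifact setting, up to `T`-equivalence. -/
abbrev RAS.StateSet (S : RAS) := S.Config → Prop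

/-- The states in which an existential formula is true. -/
def ExFormula.denote {S : RAS} (φ : ExFormula S.sg) : S.StateSet := fun c =>
  ∃ (μ : (e : S.sg.E) → φ.I e → c.idx e) (ρ : (s : S.sg.S) → φ.X s → c.M.carrier s),
    φ.matrix.Holds c.M c.arr μ ρ

/-- The initial formula. -/
def RAS.initial (S : RAS) : S.StateSet := fun c =>
  ∀ a ∉ S.rigid, ∀ j, c.arr a j = c.M.const _ (S.init a)

/-- `T`-satisfiability. -/
def RAS.Sat (S : RAS) (φ : S.StateSet) : Prop := ∃ c, φ c

/-- The values of the arrays after a transition. -/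
noncomputable def Transition.result {S : RAS} (t : Transition S.sg) (c : S.Config)
    (μ : (e : S.sg.E) → t.I e → c.idx e) (ρ : (s : S.sg.S) → t.X s → c.M.carrier s)
    (a : S.sg.A) (j : c.idx (S.sg.asrc a)) : c.M.carrier (S.sg.atgt a) :=
  (t.update a).eval c.M c.arr (ITm.eval μ j) ρ

/-- The preimage `Pre(τ, φ)`, for `τ` the disjunction of the transition formulae. -/
def RAS.Pre (S : RAS) (φ : S.StateSet) : S.StateSet := fun c =>
  ∃ t ∈ S.trans,
    ∃ (μ : (e : S.sg.E) → t.I e → c.idx e) (ρ : (s : S.sg.S) → t.X s → c.M.carrier s),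
      t.guard.Holds c.M c.arr μ ρ ∧
      ∃ h : ∀ a ∈ S.rigid, Function.Injective (t.result c μ ρ a),
        φ { c with arr := t.result c μ ρ, rigid_injective := h }

/-- The same arrays, seen in an extension of the DB model. -/
def RAS.Config.extend {S : RAS} (c : S.Config) (N : DBModel S.sg) (hN : N.IsModelOfT)
    (h : c.M.Embedding N) : S.Config where
  M := N
  isModel := hN
  idx := c.idx
  idx_nonempty := c.idx_nonempty
  arr := fun a j => h.toFun _ (c.arr a j)
  rigid_injective := fun a ha => (h.injective _).comp (c.rigid_injective a ha)

/-- Elimination `QE(T*, φ)` of the existentially quantified data variables of `φ`, where `T*` is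
the model completion of `T`. The result is the formula without data quantifiers, unique up to
`T`-equivalence, that is equivalent to `φ` in the models of `T*`. As it has no data quantifiers,
it holds in a model of `T` iff it holds, equivalently iff `φ` holds, in an extension that is a
model of `T*`; as every model of `T` embeds into a model of `T*` and `φ` is existential, this
says that `φ` holds in some extension that is a model of `T`. -/
def RAS.QE (S : RAS) (φ : S.StateSet) : S.StateSet := fun c =>
  ∃ (N : DBModel S.sg) (hN : N.IsModelOfT) (h : c.M.Embedding N), φ (c.extend N hN h)

inductive RAS.Result (S : RAS)
  | isUnsafe
  | isSafe (B : S.StateSet)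

/-- The terminating executions of the loop of the backward reachability algorithm, from given
values of the program variables `φ` and `B`. -/
inductive RAS.Loop (S : RAS) : S.StateSet → S.StateSet → S.Result → Prop
  | exit {φ B} (h : ¬ S.Sat (fun c => φ c ∧ ¬ B c)) : RAS.Loop S φ B (.isSafe B)
  | hit {φ B} (h : S.Sat (fun c => φ c ∧ ¬ B c)) (hι : S.Sat (fun c => S.initial c ∧ φ c)) :
      RAS.Loop S φ B .isUnsafe
  | step {φ B r} (h : S.Sat (fun c => φ c ∧ ¬ B c))
      (hι : ¬ S.Sat (fun c => S.initial c ∧ φ c))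
      (hr : RAS.Loop S (S.QE (S.Pre φ)) (fun c => φ c ∨ B c) r) : RAS.Loop S φ B r

/-- Backward reachability terminates on the safety formula `υ`. -/
def RAS.BReachTerminates (S : RAS) (υ : ExFormula S.sg) : Prop :=
  ∃ r, S.Loop υ.denote (fun _ => False) r

/-! # Data schemas, queries and updates -/

/-- Data schemas. A catalog relation `R` has its primary key `R.id`, of type `catId R`, and
`catArity R` further attributes. -/
structure DataSchema where
  Ty : Type
  IsId : Ty → Prop
  Dom : Ty → Type
  undef : (s : Ty) → Dom s
  Cat : Type
  cat_finite : Finite Cat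
  catId : Cat → Ty
  catArity : Cat → ℕ
  catAttr : (R : Cat) → Fin (catArity R) → Ty
  catId_isId : ∀ R, IsId (catId R)
  catId_injective : Function.Injective catId
  cat_fk : ∀ R k, IsId (catAttr R k) → ∃ R', catId R' = catAttr R k
  CType : Ty
  cType_isId : IsId CType
  cType_fresh : ∀ R, catId R ≠ CType
  Repo : Type
  repo_finite : Finite Repo
  repoArity : Repo → ℕ
  repoArity_pos : ∀ R, 0 < repoArity R
  repoAttr : (R : Repo) → Fin (repoArity R) → Ty
  repo_fk : ∀ R k, IsId (repoAttr R k) →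
    repoAttr R k = CType ∨ ∃ R', catId R' = repoAttr R k
  CVar : Type
  cvar_finite : Finite CVar
  cvarTy : CVar → Ty
  cvar_fk : ∀ x, IsId (cvarTy x) → cvarTy x = CType ∨ ∃ R', catId R' = cvarTy x
  self : CVar
  self_ty : cvarTy self = CType

/-- The characteristic graph of the catalog; `⟨R, none⟩` is the node of `R.id`. -/
inductive DataSchema.Edge (D : DataSchema) :
    ((R : D.Cat) × Option (Fin (D.catArity R))) →
    ((R : D.Cat) × Option (Fin (D.catArity R))) → Prop
  | key (R : D.Cat) (k : Fin (D.catArity R)) : DataSchema.Edge D ⟨R, none⟩ ⟨R, some k⟩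
  | foreign (R₁ R₂ : D.Cat) (k : Fin (D.catArity R₁)) (h : D.catAttr R₁ k = D.catId R₂) :
      DataSchema.Edge D ⟨R₁, some k⟩ ⟨R₂, none⟩

def DataSchema.Acyclic (D : DataSchema) : Prop := ∀ x, ¬ Relation.TransGen D.Edge x x

/-- States of the lifecycle of a block. -/
inductive Lifecycle
  | undef | idle | enabled | active | waiting | waiting1 | waiting2 | completed | error

/-- Terms of the query language, over data variables `V`, case variables and case control
variables `C`. The type `some s` is a type of the data schema, `none` is the type of lifecycle
states. -/
inductive Term (D : DataSchema) (C : Type) (V : D.Ty → Type) : Option D.Ty → Type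
  | const {s : D.Ty} (d : D.Dom s) : Term D C V (some s)
  | var {s : D.Ty} (v : V s) : Term D C V (some s)
  | cvar (x : D.CVar) : Term D C V (some (D.cvarTy x))
  | life (l : Lifecycle) : Term D C V none
  | ctrl (c : C) : Term D C V none

/-- The literals of conjunctive queries with filters; the Boolean is the sign. -/
inductive Literal (D : DataSchema) (C : Type) (V : D.Ty → Type) : Type
  | eq (pos : Bool) {s : Option D.Ty} (t u : Term D C V s)
  | cat (pos : Bool) (R : D.Cat) (t : Term D C V (some (D.catId R)))
      (u : (k : Fin (D.catArity R)) → Term D C V (some (D.catAttr R k)))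
  | repo (pos : Bool) (R : D.Repo)
      (u : (k : Fin (D.repoArity R)) → Term D C V (some (D.repoAttr R k)))

/-- Conjunctive queries with filters (the empty list is `true`). -/
abbrev CQ (D : DataSchema) (C : Type) (V : D.Ty → Type) := List (Literal D C V)

section QuerySyn

variable {D : DataSchema} {C : Type} {V : D.Ty → Type}

def Term.vars : {s : Option D.Ty} → Term D C V s → Set ((s : D.Ty) × V s)
  | _, .var v => {⟨_, v⟩}
  | _, _ => ∅

/-- The case variables and case control variables in a term. -/
def Term.caseVars : {s : Option D.Ty} → Term D C V s → Set (D.CVar ⊕ C)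
  | _, .cvar x => {.inl x}
  | _, .ctrl c => {.inr c}
  | _, _ => ∅

def Literal.terms : Literal D C V → Set ((s : Option D.Ty) × Term D C V s)
  | .eq _ t u => {⟨_, t⟩, ⟨_, u⟩}
  | .cat _ _ t u => insert ⟨_, t⟩ (Set.range fun k => ⟨_, u k⟩)
  | .repo _ _ u => Set.range fun k => ⟨_, u k⟩

def Literal.vars (l : Literal D C V) : Set ((s : D.Ty) × V s) :=
  {v | ∃ t ∈ l.terms, v ∈ t.2.vars}

def Literal.caseVars (l : Literal D C V) : Set (D.CVar ⊕ C) :=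
  {x | ∃ t ∈ l.terms, x ∈ t.2.caseVars}

/-- The atom of the literal queries the repository. -/
def Literal.IsRepo : Literal D C V → Prop
  | .repo _ _ _ => True
  | _ => False

def CQ.vars (Q : CQ D C V) : Set ((s : D.Ty) × V s) := {v | ∃ l ∈ Q, v ∈ l.vars}

def CQ.caseVars (Q : CQ D C V) : Set (D.CVar ⊕ C) := {x | ∃ l ∈ Q, x ∈ l.caseVars}

def CQ.RepoFree (Q : CQ D C V) : Prop := ∀ l ∈ Q, ¬ l.IsRepo

/-- `Q` is `χ ∧ R(y) ∧ ξ`, with `r` the optional atom `R(y)`, as in a separated guard. -/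
structure SepSplit (Q χ : CQ D C V)
    (r : Option ((R : D.Repo) × ((k : Fin (D.repoArity R)) → Term D C V (some (D.repoAttr R k)))))
    (ξ : CQ D C V) : Prop where
  perm : Q.Perm (χ ++ (r.toList.map fun p => Literal.repo true p.1 p.2) ++ ξ)
  chi_catalog : χ.RepoFree
  xi_catalog : ξ.RepoFree
  tuple_noCase : ∀ p ∈ r, ∀ k, (p.2 k).caseVars = ∅
  chi_tuple : ∀ p ∈ r, ∀ k, Disjoint χ.vars (p.2 k).vars
  xi_noCase : ξ.caseVars = ∅
  chi_xi : Disjoint χ.vars ξ.vars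

end QuerySyn

/-- Countably many data variables of each type. -/
abbrev GVar (D : DataSchema) : D.Ty → Type := fun _ => ℕ

/-- Guards `q(answer) ← ⋁ body`. Control variables `C` are only used in properties. -/
structure Guard (D : DataSchema) (C : Type) where
  answer : List ((_ : D.Ty) × ℕ)
  body : List (CQ D C (GVar D))
  answer_subset : ∀ Q ∈ body, ∀ v ∈ answer, v ∈ CQ.vars Q

section GuardSyntax

variable {D : DataSchema} {C : Type}

def Guard.vars (G : Guard D C) : Set ((_ : D.Ty) × ℕ) := {v | ∃ Q ∈ G.body, v ∈ CQ.vars Q}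

def Guard.caseVars (G : Guard D C) : Set (D.CVar ⊕ C) := {x | ∃ Q ∈ G.body, x ∈ CQ.caseVars Q}

def Guard.RepoFree (G : Guard D C) : Prop := ∀ Q ∈ G.body, CQ.RepoFree Q

/-- Guards without answer variables. -/
def Guard.Boolean (G : Guard D C) : Prop := G.answer = []

def Guard.Separated (G : Guard D C) : Prop :=
  G.body.Pairwise (fun Q Q' => Disjoint (CQ.vars Q) (CQ.vars Q')) ∧
  ∀ Q ∈ G.body, ∃ χ r ξ, SepSplit Q χ r ξ

end GuardSyntax

/-- Conditions attached to choice points: Boolean combinations of equalities between case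
variables and constants. -/
inductive Cond (D : DataSchema)
  | eq {s : Option D.Ty} (t u : Term D Empty (fun _ => Empty) s)
  | not (φ : Cond D)
  | and (φ ψ : Cond D)

def Cond.caseVars {D : DataSchema} : Cond D → Set (D.CVar ⊕ Empty)
  | .eq t u => t.caseVars ∪ u.caseVars
  | .not φ => φ.caseVars
  | .and φ ψ => φ.caseVars ∪ ψ.caseVars

/-- Values used by an effect: constants and answer variables of the precondition. -/
inductive Val (D : DataSchema) (s : D.Ty)
  | const (d : D.Dom s)
  | var (n : ℕ)

def Val.vars {D : DataSchema} {s : D.Ty} : Val D s → Set ((_ : D.Ty) × ℕ)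
  | .const _ => ∅
  | .var n => {⟨s, n⟩}

def Val.toTerm {D : DataSchema} {s : D.Ty} (C : Type) : Val D s → Term D C (GVar D) (some s)
  | .const d => .const d
  | .var n => .var (V := GVar D) n

/-- SET parts: `none` for a case variable that does not appear. -/
abbrev SetPart (D : DataSchema) := (x : D.CVar) → Option (Val D (D.cvarTy x))

/-- Variables of a conditional update of `R`: answer variables of the precondition, and the new
variables of `UPDATE R(v)`, one for each attribute of `R`. -/
inductive FVar (D : DataSchema) (R : D.Repo) : D.Ty → Type
  | ans {s : D.Ty} (n : ℕ) : FVar D R s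
  | new (k : Fin (D.repoArity R)) : FVar D R (D.repoAttr R k)

/-- Filters of a conditional update: unions of conjunctive queries. -/
abbrev Filt (D : DataSchema) (R : D.Repo) := List (CQ D Empty (FVar D R))

/-- What follows THEN and ELSE: a tuple, or a nested IF THEN ELSE. -/
inductive Branch (D : DataSchema) (R : D.Repo) : Type
  | tuple (u : (k : Fin (D.repoArity R)) → D.Dom (D.repoAttr R k) ⊕ FVar D R (D.repoAttr R k))
  | ite (ψ : Filt D R) (η₁ η₂ : Branch D R)

/-- Effect rules. An insert&set rule without INSERT part is a `set` rule. -/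
inductive Effect (D : DataSchema)
  | insertSet (R : D.Repo) (u : (k : Fin (D.repoArity R)) → Val D (D.repoAttr R k))
      (set : SetPart D)
  | set (set : SetPart D)
  | deleteSet (R : D.Repo) (u : (k : Fin (D.repoArity R)) → Val D (D.repoAttr R k))
      (set : SetPart D)
  | condUpdate (R : D.Repo) (ψ : Filt D R) (η₁ η₂ : Branch D R)

section EffectSyntax

variable {D : DataSchema}

def FVar.ansVars {R : D.Repo} : {s : D.Ty} → FVar D R s → Set ((_ : D.Ty) × ℕ)
  | s, .ans n => {⟨s, n⟩}
  | _, .new _ => ∅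

def Filt.ansVars {R : D.Repo} (ψ : Filt D R) : Set ((_ : D.Ty) × ℕ) :=
  {v | ∃ Q ∈ ψ, ∃ w ∈ CQ.vars Q, v ∈ w.2.ansVars}

def Filt.caseVars {R : D.Repo} (ψ : Filt D R) : Set (D.CVar ⊕ Empty) :=
  {x | ∃ Q ∈ ψ, x ∈ CQ.caseVars Q}

def Filt.RepoFree {R : D.Repo} (ψ : Filt D R) : Prop := ∀ Q ∈ ψ, CQ.RepoFree Q

def Branch.ansVars {R : D.Repo} : Branch D R → Set ((_ : D.Ty) × ℕ)
  | .tuple u => {v | ∃ k w, u k = .inr w ∧ v ∈ w.ansVars}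
  | .ite ψ η₁ η₂ => Filt.ansVars ψ ∪ η₁.ansVars ∪ η₂.ansVars

def Branch.caseVars {R : D.Repo} : Branch D R → Set (D.CVar ⊕ Empty)
  | .tuple _ => ∅
  | .ite ψ η₁ η₂ => Filt.caseVars ψ ∪ η₁.caseVars ∪ η₂.caseVars

def Branch.RepoFree {R : D.Repo} : Branch D R → Prop
  | .tuple _ => True
  | .ite ψ η₁ η₂ => Filt.RepoFree ψ ∧ η₁.RepoFree ∧ η₂.RepoFree

def Effect.setPart : Effect D → SetPart D
  | .insertSet _ _ sp => sp
  | .set sp => sp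
  | .deleteSet _ _ sp => sp
  | .condUpdate _ _ _ _ => fun _ => none

/-- The answer variables of the precondition that are used by the effect. -/
def Effect.vars (E : Effect D) : Set ((_ : D.Ty) × ℕ) :=
  {v | ∃ x w, E.setPart x = some w ∧ v ∈ w.vars} ∪
  match E with
  | .insertSet _ u _ => {v | ∃ k, v ∈ (u k).vars}
  | .set _ => ∅
  | .deleteSet _ u _ => {v | ∃ k, v ∈ (u k).vars}
  | .condUpdate _ ψ η₁ η₂ => (Branch.ite ψ η₁ η₂).ansVars

/-- The case variables mentioned by the effect: those that are set, and those in filters. -/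
def Effect.caseVars (E : Effect D) : Set (D.CVar ⊕ Empty) :=
  {x | ∃ y, x = .inl y ∧ (E.setPart y).isSome} ∪
  match E with
  | .condUpdate _ ψ η₁ η₂ => (Branch.ite ψ η₁ η₂).caseVars
  | _ => ∅

def Effect.IsInsert : Effect D → Prop
  | .insertSet _ _ _ => True
  | _ => False

def Effect.IsSet : Effect D → Prop
  | .set _ => True
  | _ => False

def Effect.IsDelete : Effect D → Prop
  | .deleteSet _ _ _ => True
  | _ => False

def Effect.IsCondUpdate : Effect D → Prop
  | .condUpdate _ _ _ _ => True
  | _ => False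

/-- The filters of a conditional update are repo-free. -/
def Effect.FiltersRepoFree : Effect D → Prop
  | .condUpdate _ ψ η₁ η₂ => (Branch.ite ψ η₁ η₂).RepoFree
  | _ => True

end EffectSyntax

structure UpdateSpec (D : DataSchema) where
  pre : Guard D Empty
  eff : Effect D
  eff_vars : ∀ v ∈ eff.vars, v ∈ pre.answer
  self_not_set : eff.setPart D.self = none
  filters : eff.FiltersRepoFree

section SpecConditions

variable {D : DataSchema}

def UpdateSpec.MentionsSelf (u : UpdateSpec D) : Prop :=
  .inl D.self ∈ u.pre.caseVars ∪ u.eff.caseVars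

/-- All case variables other than `self` appear in the SET part. -/
def UpdateSpec.SetsAll (u : UpdateSpec D) : Prop :=
  ∀ x, x ≠ D.self → (u.eff.setPart x).isSome

/-- The effect uses only the new variables of its UPDATE part and constants. -/
def UpdateSpec.OnlyNewVars (u : UpdateSpec D) : Prop :=
  u.eff.vars = ∅ ∧ u.eff.caseVars = ∅

/-- The effect does not join the retrieved repository tuple with anything else: it uses no
variable of the case part `χ` of the precondition, and if a tuple (not consisting of constants
only) is deleted, then it is the tuple `R(y)` that the precondition retrieves, if any. -/
def UpdateSpec.JoinFree (u : UpdateSpec D) : Prop :=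
  ∀ Q ∈ u.pre.body, ∃ χ r ξ, SepSplit Q χ r ξ ∧ Disjoint u.eff.vars (CQ.vars χ) ∧
    match u.eff with
    | .deleteSet R w _ =>
        (∀ k, (w k).vars = ∅) ∨ r = none ∨ r = some ⟨R, fun k => (w k).toTerm Empty⟩
    | _ => True

end SpecConditions

/-! # Processes -/

/-- Types of start events and of catch events. -/
inductive CatchType
  | msg | timer | none

/-- Types of end events of process blocks. -/
inductive EndType
  | msg | none

/-- Types of end events of possible completions; errors carry a label. -/
inductive ThrowType
  | error (label : ℕ) | msg | none

/-- Types of interrupting boundary events; errors carry the label of their handler. -/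
inductive BoundaryType
  | error (label : ℕ) | msg | timer

/-- Types of non-interrupting boundary events. -/
inductive NonIntType
  | msg | timer

inductive Block (D : DataSchema) : Type
  | empty
  | task (atomic : Bool) (u : UpdateSpec D)
  | catchEvent (e : CatchType) (u : UpdateSpec D)
  | process (es : CatchType) (us : UpdateSpec D) (et : EndType) (ut : UpdateSpec D) (b : Block D)
  | subprocess (p : Block D)
  | seq (b₁ b₂ : Block D)
  | possibleCompletion (φ₁ φ₂ : Cond D) (e : ThrowType) (b : Block D)
  | deferredChoice (b₁ b₂ : Block D)
  | parallel (b₁ b₂ : Block D)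
  | exclusiveChoice (φ₁ φ₂ : Cond D) (b₁ b₂ : Block D)
  | inclusiveChoice (φ₁ φ₂ : Cond D) (b₁ b₂ : Block D)
  | loop (φ₁ φ₂ : Cond D) (b₁ b₂ : Block D)
  | eventChoice (e₁ : CatchType) (u₁ : UpdateSpec D) (e₂ : CatchType) (u₂ : UpdateSpec D)
      (b₁ b₂ : Block D)
  | backwardException (e : BoundaryType) (a b : Block D)
  | forwardException (e : BoundaryType) (a b₁ b₂ : Block D)
  | nonInterrupting (e : NonIntType) (a b₁ b₂ : Block D)

section Processes

variable {D : DataSchema}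

/-- The control variables of the proper sub-blocks of a block; those of the block itself and its
sub-blocks are `Option b.Sub`, with `none` the lifecycle variable of the block itself.
In `eventChoice` the two units are the nested catch events, and in `nonInterrupting` the unit is
the variable that tells whether the boundary event has occurred. -/
def Block.Sub : Block D → Type
  | .empty => Empty
  | .task _ _ => Empty
  | .catchEvent _ _ => Empty
  | .process _ _ _ _ b => Option b.Sub
  | .subprocess p => Option p.Sub
  | .seq b₁ b₂ => Option b₁.Sub ⊕ Option b₂.Sub
  | .possibleCompletion _ _ _ b => Option b.Sub
  | .deferredChoice b₁ b₂ => Option b₁.Sub ⊕ Option b₂.Sub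
  | .parallel b₁ b₂ => Option b₁.Sub ⊕ Option b₂.Sub
  | .exclusiveChoice _ _ b₁ b₂ => Option b₁.Sub ⊕ Option b₂.Sub
  | .inclusiveChoice _ _ b₁ b₂ => Option b₁.Sub ⊕ Option b₂.Sub
  | .loop _ _ b₁ b₂ => Option b₁.Sub ⊕ Option b₂.Sub
  | .eventChoice _ _ _ _ b₁ b₂ => (Unit ⊕ Unit) ⊕ (Option b₁.Sub ⊕ Option b₂.Sub)
  | .backwardException _ a b => Option a.Sub ⊕ Option b.Sub
  | .forwardException _ a b₁ b₂ => Option a.Sub ⊕ (Option b₁.Sub ⊕ Option b₂.Sub)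
  | .nonInterrupting _ a b₁ b₂ => Unit ⊕ (Option a.Sub ⊕ (Option b₁.Sub ⊕ Option b₂.Sub))

def Block.IsProcBlock : Block D → Prop
  | .process _ _ _ _ _ => True
  | _ => False

def Block.IsSubprocess : Block D → Prop
  | .subprocess _ => True
  | _ => False

/-- Nonatomic tasks only operate on case variables; subprocesses have an inner process block;
exception handlers are attached to subprocesses. -/
def Block.WellFormed : Block D → Prop
  | .empty => True
  | .task atomic u => atomic = false → u.eff.IsSet
  | .catchEvent _ _ => True
  | .process _ _ _ _ b => b.WellFormed
  | .subprocess p => p.IsProcBlock ∧ p.WellFormed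
  | .seq b₁ b₂ => b₁.WellFormed ∧ b₂.WellFormed
  | .possibleCompletion _ _ _ b => b.WellFormed
  | .deferredChoice b₁ b₂ => b₁.WellFormed ∧ b₂.WellFormed
  | .parallel b₁ b₂ => b₁.WellFormed ∧ b₂.WellFormed
  | .exclusiveChoice _ _ b₁ b₂ => b₁.WellFormed ∧ b₂.WellFormed
  | .inclusiveChoice _ _ b₁ b₂ => b₁.WellFormed ∧ b₂.WellFormed
  | .loop _ _ b₁ b₂ => b₁.WellFormed ∧ b₂.WellFormed
  | .eventChoice _ _ _ _ b₁ b₂ => b₁.WellFormed ∧ b₂.WellFormed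
  | .backwardException _ a b => a.IsSubprocess ∧ a.WellFormed ∧ b.WellFormed
  | .forwardException _ a b₁ b₂ =>
      a.IsSubprocess ∧ a.WellFormed ∧ b₁.WellFormed ∧ b₂.WellFormed
  | .nonInterrupting _ a b₁ b₂ =>
      a.IsSubprocess ∧ a.WellFormed ∧ b₁.WellFormed ∧ b₂.WellFormed

/-- The update specifications in a block and its sub-blocks. -/
def Block.specs : Block D → List (UpdateSpec D)
  | .empty => []
  | .task _ u => [u]
  | .catchEvent _ u => [u]
  | .process _ us _ ut b => us :: ut :: b.specs
  | .subprocess p => p.specs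
  | .seq b₁ b₂ => b₁.specs ++ b₂.specs
  | .possibleCompletion _ _ _ b => b.specs
  | .deferredChoice b₁ b₂ => b₁.specs ++ b₂.specs
  | .parallel b₁ b₂ => b₁.specs ++ b₂.specs
  | .exclusiveChoice _ _ b₁ b₂ => b₁.specs ++ b₂.specs
  | .inclusiveChoice _ _ b₁ b₂ => b₁.specs ++ b₂.specs
  | .loop _ _ b₁ b₂ => b₁.specs ++ b₂.specs
  | .eventChoice _ u₁ _ u₂ b₁ b₂ => u₁ :: u₂ :: (b₁.specs ++ b₂.specs)
  | .backwardException _ a b => a.specs ++ b.specs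
  | .forwardException _ a b₁ b₂ => a.specs ++ b₁.specs ++ b₂.specs
  | .nonInterrupting _ a b₁ b₂ => a.specs ++ b₁.specs ++ b₂.specs

/-- The conditions in a block and its sub-blocks. -/
def Block.conds : Block D → List (Cond D)
  | .empty => []
  | .task _ _ => []
  | .catchEvent _ _ => []
  | .process _ _ _ _ b => b.conds
  | .subprocess p => p.conds
  | .seq b₁ b₂ => b₁.conds ++ b₂.conds
  | .possibleCompletion φ₁ φ₂ _ b => φ₁ :: φ₂ :: b.conds
  | .deferredChoice b₁ b₂ => b₁.conds ++ b₂.conds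
  | .parallel b₁ b₂ => b₁.conds ++ b₂.conds
  | .exclusiveChoice φ₁ φ₂ b₁ b₂ => φ₁ :: φ₂ :: (b₁.conds ++ b₂.conds)
  | .inclusiveChoice φ₁ φ₂ b₁ b₂ => φ₁ :: φ₂ :: (b₁.conds ++ b₂.conds)
  | .loop φ₁ φ₂ b₁ b₂ => φ₁ :: φ₂ :: (b₁.conds ++ b₂.conds)
  | .eventChoice _ _ _ _ b₁ b₂ => b₁.conds ++ b₂.conds
  | .backwardException _ a b => a.conds ++ b.conds
  | .forwardException _ a b₁ b₂ => a.conds ++ b₁.conds ++ b₂.conds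
  | .nonInterrupting _ a b₁ b₂ => a.conds ++ b₁.conds ++ b₂.conds

end Processes

/-! # Rule-based transitions of the blocks -/

/-- A rule `if Guard then Update` for one case `I`: the lifecycle variables in `life` have the
given values, the conditions `cond` and the query `pre` hold; then the effect `eff` (if any) is
applied and the control variables are updated by `upd`. -/
structure Rule (D : DataSchema) (C : Type) where
  life : List (C × Lifecycle)
  cond : List (Cond D) := []
  pre : CQ D Empty (GVar D) := []
  eff : Effect D := .set fun _ => none
  upd : C → Option Lifecycle

open Classical in
/-- Assign the listed values; all other control variables in `H` become `idle`. -/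
noncomputable def assign {C : Type} (l : List (C × Lifecycle)) (H : Set C := ∅) :
    C → Option Lifecycle := fun c =>
  match l.find? (fun p => decide (p.1 = c)) with
  | some p => some p.2
  | none => if c ∈ H then some .idle else none

/-- What surrounds a block: the enclosing process block (its lifecycle variable and those of its
proper sub-blocks), and the enclosing subprocesses with an error boundary event (label, lifecycle
variable, control variables of the proper sub-blocks), innermost first. -/
structure Env (C : Type) where
  proc : Option (C × Set C)
  handlers : List (ℕ × C × Set C)

/-- Enter a subprocess with a boundary event. -/
def Env.enter {C : Type} (env : Env C) : BoundaryType → C → Set C → Env C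
  | .error l, a, H => { env with handlers := (l, a, H) :: env.handlers }
  | _, _, _ => env

/-- One rule for each disjunct of the precondition of `u`, applying the effect of `u`. -/
noncomputable def specRules {D : DataSchema} {C : Type} (u : UpdateSpec D)
    (life : List (C × Lifecycle)) (new : List (C × Lifecycle)) : List (Rule D C) :=
  u.pre.body.map fun Q => { life := life, pre := Q, eff := u.eff, upd := assign new }

/-- The rule `if life then new`. -/
noncomputable def ctrlRule {D : DataSchema} {C : Type} (life : List (C × Lifecycle))
    (new : List (C × Lifecycle)) (cond : List (Cond D) := []) (H : Set C := ∅) : Rule D C :=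
  { life := life, cond := cond, upd := assign new H }

/-- The boundary event of a subprocess `a` interrupts it. -/
noncomputable def interruptRules {D : DataSchema} {C : Type} (a : C) (H : Set C) :
    List (Rule D C) :=
  [.enabled, .waiting, .active].map fun l => ctrlRule [(a, l)] [(a, .error)] [] H

open Lifecycle in
/-- The rules of a block and its sub-blocks, where `κ` gives the control variables. -/
noncomputable def Block.rules {D : DataSchema} {C : Type} :
    (b : Block D) → (κ : Option b.Sub → C) → Env C → List (Rule D C)
  | .empty, κ, _ => [ctrlRule [(κ none, enabled)] [(κ none, completed)]]
  | .task true u, κ, _ => specRules u [(κ none, enabled)] [(κ none, completed)]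
  | .task false u, κ, _ =>
      (u.pre.body.map fun Q =>
        { life := [(κ none, enabled)], pre := Q, upd := assign [(κ none, active)] }) ++
      [{ life := [(κ none, active)], eff := u.eff, upd := assign [(κ none, completed)] }]
  | .catchEvent _ u, κ, _ => specRules u [(κ none, enabled)] [(κ none, completed)]
  | .process _ us _ ut b, κ, env =>
      let κ₁ : Option b.Sub → C := fun p => κ (some p)
      specRules us [(κ none, enabled)] [(κ₁ none, enabled), (κ none, waiting)] ++
      specRules ut [(κ₁ none, completed)] [(κ₁ none, idle), (κ none, completed)] ++
      b.rules κ₁ { env with proc := some (κ none, Set.range κ₁) }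
  | .subprocess p, κ, env =>
      let κ₁ : Option p.Sub → C := fun q => κ (some q)
      [ctrlRule [(κ none, enabled)] [(κ₁ none, enabled), (κ none, waiting)],
       ctrlRule [(κ₁ none, completed)] [(κ₁ none, idle), (κ none, completed)]] ++
      p.rules κ₁ env
  | .seq b₁ b₂, κ, env =>
      let κ₁ : Option b₁.Sub → C := fun p => κ (some (.inl p))
      let κ₂ : Option b₂.Sub → C := fun p => κ (some (.inr p))
      [ctrlRule [(κ none, enabled)] [(κ₁ none, enabled), (κ none, waiting)],
       ctrlRule [(κ₁ none, completed)] [(κ₁ none, idle), (κ₂ none, enabled)],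
       ctrlRule [(κ₂ none, completed)] [(κ₂ none, idle), (κ none, completed)]] ++
      b₁.rules κ₁ env ++ b₂.rules κ₂ env
  | .possibleCompletion φ₁ φ₂ e b, κ, env =>
      let κ₁ : Option b.Sub → C := fun p => κ (some p)
      [ctrlRule [(κ none, enabled)] [(κ₁ none, enabled), (κ none, waiting)],
       ctrlRule [(κ₁ none, completed)] [(κ₁ none, idle), (κ none, completed)] [φ₁]] ++
      (match e with
        | .error l =>
            -- the innermost enclosing handler of the error catches it
            (env.handlers.find? (fun h => h.1 == l)).toList.map fun h =>
              ctrlRule [(κ₁ none, completed)] [(h.2.1, error)] [φ₂] h.2.2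
        | _ =>
            -- the end event completes the enclosing process block
            env.proc.toList.map fun h =>
              ctrlRule [(κ₁ none, completed)] [(h.1, completed)] [φ₂] h.2) ++
      b.rules κ₁ env
  | .deferredChoice b₁ b₂, κ, env =>
      let κ₁ : Option b₁.Sub → C := fun p => κ (some (.inl p))
      let κ₂ : Option b₂.Sub → C := fun p => κ (some (.inr p))
      [ctrlRule [(κ none, enabled)] [(κ₁ none, enabled), (κ none, waiting)],
       ctrlRule [(κ none, enabled)] [(κ₂ none, enabled), (κ none, waiting)],
       ctrlRule [(κ₁ none, completed)] [(κ₁ none, idle), (κ none, completed)],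
       ctrlRule [(κ₂ none, completed)] [(κ₂ none, idle), (κ none, completed)]] ++
      b₁.rules κ₁ env ++ b₂.rules κ₂ env
  | .parallel b₁ b₂, κ, env =>
      let κ₁ : Option b₁.Sub → C := fun p => κ (some (.inl p))
      let κ₂ : Option b₂.Sub → C := fun p => κ (some (.inr p))
      [ctrlRule [(κ none, enabled)]
        [(κ₁ none, enabled), (κ₂ none, enabled), (κ none, waiting)],
       ctrlRule [(κ₁ none, completed), (κ₂ none, completed)]
        [(κ₁ none, idle), (κ₂ none, idle), (κ none, completed)]] ++
      b₁.rules κ₁ env ++ b₂.rules κ₂ env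
  | .exclusiveChoice φ₁ φ₂ b₁ b₂, κ, env =>
      let κ₁ : Option b₁.Sub → C := fun p => κ (some (.inl p))
      let κ₂ : Option b₂.Sub → C := fun p => κ (some (.inr p))
      [ctrlRule [(κ none, enabled)] [(κ₁ none, enabled), (κ none, waiting)] [φ₁],
       ctrlRule [(κ none, enabled)] [(κ₂ none, enabled), (κ none, waiting)] [φ₂],
       ctrlRule [(κ₁ none, completed)] [(κ₁ none, idle), (κ none, completed)],
       ctrlRule [(κ₂ none, completed)] [(κ₂ none, idle), (κ none, completed)]] ++
      b₁.rules κ₁ env ++ b₂.rules κ₂ env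
  | .inclusiveChoice φ₁ φ₂ b₁ b₂, κ, env =>
      let κ₁ : Option b₁.Sub → C := fun p => κ (some (.inl p))
      let κ₂ : Option b₂.Sub → C := fun p => κ (some (.inr p))
      [ctrlRule [(κ none, enabled)] [(κ₁ none, enabled), (κ none, waiting1)] [φ₁, .not φ₂],
       ctrlRule [(κ none, enabled)] [(κ₂ none, enabled), (κ none, waiting1)] [φ₂, .not φ₁],
       ctrlRule [(κ none, enabled)]
        [(κ₁ none, enabled), (κ₂ none, enabled), (κ none, waiting2)] [φ₁, φ₂],
       ctrlRule [(κ₁ none, completed), (κ none, waiting1)]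
        [(κ₁ none, idle), (κ none, completed)],
       ctrlRule [(κ₂ none, completed), (κ none, waiting1)]
        [(κ₂ none, idle), (κ none, completed)],
       ctrlRule [(κ₁ none, completed), (κ₂ none, completed)]
        [(κ₁ none, idle), (κ₂ none, idle), (κ none, completed)]] ++
      b₁.rules κ₁ env ++ b₂.rules κ₂ env
  | .loop φ₁ φ₂ b₁ b₂, κ, env =>
      let κ₁ : Option b₁.Sub → C := fun p => κ (some (.inl p))
      let κ₂ : Option b₂.Sub → C := fun p => κ (some (.inr p))
      [ctrlRule [(κ none, enabled)] [(κ₁ none, enabled), (κ none, waiting)],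
       ctrlRule [(κ₁ none, completed)] [(κ₁ none, idle), (κ₂ none, enabled)] [φ₂],
       ctrlRule [(κ₂ none, completed)] [(κ₁ none, enabled), (κ₂ none, idle)],
       ctrlRule [(κ₁ none, completed)] [(κ₁ none, idle), (κ none, completed)] [φ₁]] ++
      b₁.rules κ₁ env ++ b₂.rules κ₂ env
  | .eventChoice _ u₁ _ u₂ b₁ b₂, κ, env =>
      let e₁ : C := κ (some (.inl (.inl ())))
      let e₂ : C := κ (some (.inl (.inr ())))
      let κ₁ : Option b₁.Sub → C := fun p => κ (some (.inr (.inl p)))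
      let κ₂ : Option b₂.Sub → C := fun p => κ (some (.inr (.inr p)))
      [ctrlRule [(κ none, enabled)] [(e₁, enabled), (e₂, enabled), (κ none, waiting)]] ++
      specRules u₁ [(e₁, enabled)] [(e₁, completed), (e₂, idle)] ++
      specRules u₂ [(e₂, enabled)] [(e₂, completed), (e₁, idle)] ++
      [ctrlRule [(e₁, completed)] [(e₁, idle), (κ₁ none, enabled)],
       ctrlRule [(e₂, completed)] [(e₂, idle), (κ₂ none, enabled)],
       ctrlRule [(κ₁ none, completed)] [(κ₁ none, idle), (κ none, completed)],
       ctrlRule [(κ₂ none, completed)] [(κ₂ none, idle), (κ none, completed)]] ++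
      b₁.rules κ₁ env ++ b₂.rules κ₂ env
  | .backwardException e a b, κ, env =>
      let α : Option a.Sub → C := fun p => κ (some (.inl p))
      let β : Option b.Sub → C := fun p => κ (some (.inr p))
      let H : Set C := Set.range fun p => α (some p)
      [ctrlRule [(κ none, enabled)] [(α none, enabled), (κ none, waiting)],
       ctrlRule [(α none, completed)] [(α none, idle), (κ none, completed)],
       ctrlRule [(α none, error)] [(α none, idle), (β none, enabled)],
       ctrlRule [(β none, completed)] [(β none, idle), (α none, enabled)]] ++
      interruptRules (α none) H ++
      a.rules α (env.enter e (α none) H) ++ b.rules β env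
  | .forwardException e a b₁ b₂, κ, env =>
      let α : Option a.Sub → C := fun p => κ (some (.inl p))
      let κ₁ : Option b₁.Sub → C := fun p => κ (some (.inr (.inl p)))
      let κ₂ : Option b₂.Sub → C := fun p => κ (some (.inr (.inr p)))
      let H : Set C := Set.range fun p => α (some p)
      [ctrlRule [(κ none, enabled)] [(α none, enabled), (κ none, waiting)],
       ctrlRule [(α none, completed)] [(α none, idle), (κ₁ none, enabled)],
       ctrlRule [(κ₁ none, completed)] [(κ₁ none, idle), (κ none, completed)],
       ctrlRule [(α none, error)] [(α none, idle), (κ₂ none, enabled)],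
       ctrlRule [(κ₂ none, completed)] [(κ₂ none, idle), (κ none, completed)]] ++
      interruptRules (α none) H ++
      a.rules α (env.enter e (α none) H) ++ b₁.rules κ₁ env ++ b₂.rules κ₂ env
  | .nonInterrupting _ a b₁ b₂, κ, env =>
      -- `flag` is the Boolean `errorA`, with `error` for true and `idle` for false
      let flag : C := κ (some (.inl ()))
      let α : Option a.Sub → C := fun p => κ (some (.inr (.inl p)))
      let κ₁ : Option b₁.Sub → C := fun p => κ (some (.inr (.inr (.inl p))))
      let κ₂ : Option b₂.Sub → C := fun p => κ (some (.inr (.inr (.inr p))))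
      [ctrlRule [(κ none, enabled)] [(α none, enabled), (κ none, waiting)],
       ctrlRule [(α none, completed)] [(α none, idle), (κ₁ none, enabled)],
       ctrlRule [(κ₁ none, completed), (flag, idle)] [(κ₁ none, idle), (κ none, completed)],
       ctrlRule [(flag, error), (κ₂ none, idle)] [(κ₂ none, enabled)],
       ctrlRule [(κ₁ none, completed), (κ₂ none, completed)]
        [(κ₁ none, idle), (κ₂ none, idle), (flag, idle), (κ none, completed)]] ++
      ([enabled, waiting, active].map fun l => ctrlRule [(α none, l)] [(flag, error)]) ++
      a.rules α env ++ b₁.rules κ₁ env ++ b₂.rules κ₂ env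

/-! # Data-aware BPMN processes, properties, and their translation -/

/-- Data-aware BPMN processes. -/
structure DABModel where
  D : DataSchema
  P : Block D
  root : P.IsProcBlock
  wellFormed : P.WellFormed

/-- The case control variables of the process. -/
abbrev DABModel.Ctrl (M : DABModel) : Type := Option M.P.Sub

/-- No explicit use of `self`: neither in update specifications nor in conditions. -/
def DABModel.CaseIdentifierAgnostic (M : DABModel) : Prop :=
  (∀ u ∈ M.P.specs, ¬ u.MentionsSelf) ∧ ∀ φ ∈ M.P.conds, .inl M.D.self ∉ φ.caseVars

/-- The catalog of the process is acyclic. -/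
def DABModel.Acyclic (M : DABModel) : Prop := M.D.Acyclic

/-- Properties `⋀_i G_i[i]` over `n` different cases; every data variable also appears in an atom
over the repository. -/
structure Property (M : DABModel) where
  n : ℕ
  guards : Fin n → Guard M.D M.Ctrl
  inRepo : ∀ i, ∀ v ∈ (guards i).vars, ∃ Q ∈ (guards i).body, ∃ l ∈ Q, l.IsRepo ∧ v ∈ l.vars

def Property.Separated {M : DABModel} (υ : Property M) : Prop := ∀ i, (υ.guards i).Separated

/-- The arrays: one for each case variable and each control variable, indexed by cases, and one
for each attribute of each repository relation, indexed by the entries of the relation. -/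
inductive Comp (D : DataSchema) (C : Type)
  | case (x : D.CVar)
  | ctrl (c : C)
  | repo (R : D.Repo) (k : Fin (D.repoArity R))

/-- The translated signature. The artifact sort `none` is that of cases, `some R` that of
entries of `R`; the catalog relation `R` is given by the functions from `R.id` to its other
attributes. -/
@[reducible]
def sig (D : DataSchema) (C : Type) : Sig where
  S := Option D.Ty
  K := fun
    | none => Lifecycle
    | some s => D.Dom s
  undef := fun
    | none => Lifecycle.undef
    | some s => D.undef s
  F := (R : D.Cat) × Fin (D.catArity R)
  src := fun f => some (D.catId f.1)
  tgt := fun f => some (D.catAttr f.1 f.2)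
  E := Option D.Repo
  A := Comp D C
  asrc := fun
    | .case _ => none
    | .ctrl _ => none
    | .repo R _ => some R
  atgt := fun
    | .case x => some (D.cvarTy x)
    | .ctrl _ => none
    | .repo R k => some (D.repoAttr R k)

section Translation

variable {D : DataSchema} {C C' : Type} {V : D.Ty → Type}
  {J : Option D.Repo → Type} {X : Option D.Ty → Type}

/-- Translation of terms for the case with index `i`, where `σ` interprets the data variables and
`ι` the control variables. -/
def Term.tr (ι : C' → C) (i : J none) (σ : (s : D.Ty) → V s → Tm (sig D C) J X (some s)) :
    {s : Option D.Ty} → Term D C' V s → Tm (sig D C) J X s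
  | _, .const (s := s) d => .const (sg := sig D C) (s := some s) d
  | _, .var v => σ _ v
  | _, .cvar x => .read (sg := sig D C) (.case x) i
  | _, .life l => .const (sg := sig D C) (s := none) l
  | _, .ctrl c => .read (sg := sig D C) (.ctrl (ι c)) i

/-- Translation of literals; `e` is the fresh index variable for a repository atom. -/
def Literal.tr (ι : C' → C) (i : J none) (e : (R : D.Repo) → J (some R))
    (σ : (s : D.Ty) → V s → Tm (sig D C) J X (some s)) : Literal D C' V → QF (sig D C) J X
  | .eq pos t u => QF.signed pos (.eq (t.tr ι i σ) (u.tr ι i σ))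
  | .cat pos R t u => QF.signed pos <|
      .and (.not (.eq (t.tr ι i σ)
        (.const (sg := sig D C) (s := some (D.catId R)) (D.undef (D.catId R)))))
      (QF.conj <| List.ofFn fun k => .eq ((u k).tr ι i σ)
        (.app (sg := sig D C) ⟨R, k⟩ (t.tr ι i σ)))
  | .repo pos R u => QF.signed pos <|
      QF.conj <| List.ofFn fun k =>
        .eq (.read (sg := sig D C) (.repo R k) (e R)) ((u k).tr ι i σ)

/-- Translation of queries; `e m R` is the index variable for the literal at position `m`. -/
def CQ.tr (ι : C' → C) (i : J none) (e : ℕ → (R : D.Repo) → J (some R))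
    (σ : (s : D.Ty) → V s → Tm (sig D C) J X (some s)) (Q : CQ D C' V) : QF (sig D C) J X :=
  QF.conj (Q.zipIdx.map fun p => p.1.tr ι i (e p.2) σ)

def Cond.tr (i : J none) : Cond D → QF (sig D C) J X
  | .eq t u => .eq (t.tr Empty.elim i (fun _ v => v.elim)) (u.tr Empty.elim i (fun _ v => v.elim))
  | .not φ => .not (φ.tr i)
  | .and φ ψ => .and (φ.tr i) (ψ.tr i)

end Translation

/-- The index variables of a translated rule: the case `i`, the entry `e_ins` or `e_del`, and the
entry for the repository literal at position `m` of the precondition. -/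
inductive RIdx
  | case
  | main
  | lit (m : ℕ)

/-- The two semantics of insertion. -/
inductive InsertionSemantics
  | multiset
  | set

section RuleTranslation

variable {D : DataSchema} {C : Type}

abbrev RI (D : DataSchema) : Option D.Repo → Type := fun _ => RIdx

abbrev RX (D : DataSchema) : Option D.Ty → Type := fun _ => ℕ

def Val.tr {J : Option D.Repo → Type} {s : D.Ty} : Val D s → Tm (sig D C) J (RX D) (some s)
  | .const d => .const (sg := sig D C) (s := some s) d
  | .var n => .dvar (sg := sig D C) (s := some s) n

/-- Variables of a conditional update, for the entry `j` of `R`. -/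
def FVar.tr {J : Option D.Repo → Type} {R : D.Repo} (j : J (some R)) :
    {s : D.Ty} → FVar D R s → Tm (sig D C) J (RX D) (some s)
  | s, .ans n => .dvar (sg := sig D C) (s := some s) n
  | _, .new k => .read (sg := sig D C) (.repo R k) j

/-- Filters, for the case `i` and the entry `j` of `R` (filters are repo-free, so the index
variables for repository literals are irrelevant). -/
def Filt.tr {R : D.Repo} (ψ : Filt D R) :
    QF (sig D C) (ITm (RI D) (some R)) (RX D) :=
  QF.disj (ψ.map fun Q => CQ.tr (J := ITm (RI D) (some R)) Empty.elim (.var RIdx.case)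
    (fun m _ => .var (RIdx.lit m)) (fun _ v => v.tr .lam) Q)

def Branch.tr {R : D.Repo} (k : Fin (D.repoArity R)) :
    Branch D R → CaseTm (sig D C) (ITm (RI D) (some R)) (RX D) (some (D.repoAttr R k))
  | .tuple u => .leaf <| match u k with
      | .inl d => .const (sg := sig D C) (s := some (D.repoAttr R k)) d
      | .inr v => v.tr .lam
  | .ite ψ η₁ η₂ => .ite (Filt.tr ψ) (η₁.tr k) (η₂.tr k)

/-- The conjunct that an effect adds to the guard. -/
def Effect.guardPart : Effect D → QF (sig D C) (RI D) (RX D)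
  | .insertSet R _ _ => QF.conj <| List.ofFn fun k =>
      .eq (.read (sg := sig D C) (.repo R k) RIdx.main)
        (.const (sg := sig D C) (s := some (D.repoAttr R k)) (D.undef (D.repoAttr R k)))
  | .deleteSet R u _ => QF.conj <| List.ofFn fun k =>
      .eq (.read (sg := sig D C) (.repo R k) RIdx.main) (u k).tr
  | _ => .tru

open Classical in
/-- The new value of attribute `k` of the entry `j` of `R`. -/
noncomputable def Effect.repoUpdate (sem : InsertionSemantics) (E : Effect D) (R : D.Repo)
    (k : Fin (D.repoArity R)) :
    CaseTm (sig D C) (ITm (RI D) (some R)) (RX D) (some (D.repoAttr R k)) :=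
  let keep : CaseTm (sig D C) (ITm (RI D) (some R)) (RX D) (some (D.repoAttr R k)) :=
    .leaf (.read (sg := sig D C) (.repo R k) .lam)
  let undef : CaseTm (sig D C) (ITm (RI D) (some R)) (RX D) (some (D.repoAttr R k)) :=
    .leaf (.const (sg := sig D C) (s := some (D.repoAttr R k)) (D.undef (D.repoAttr R k)))
  let isMain : QF (sig D C) (ITm (RI D) (some R)) (RX D) :=
    .idxEq (sg := sig D C) (e := some R) .lam (.var RIdx.main)
  match E with
  | .set _ => keep
  | .insertSet R₀ u₀ _ =>
      if h : R₀ = R then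
        let u : (k : Fin (D.repoArity R)) → Val D (D.repoAttr R k) := h ▸ u₀
        .ite isMain (.leaf (u k).tr) <| match sem with
          | .multiset => keep
          | .set => .ite (QF.conj <| List.ofFn fun k' =>
              .eq (.read (sg := sig D C) (.repo R k') .lam) (u k').tr) undef keep
      else keep
  | .deleteSet R₀ _ _ => if R₀ = R then .ite isMain undef keep else keep
  | .condUpdate R₀ ψ₀ η₁ η₂ =>
      if h : R₀ = R then
        let η : Branch D R := h ▸ Branch.ite ψ₀ η₁ η₂
        η.tr k
      else keep

/-- The transition formula of a rule. -/
noncomputable def Rule.toTransition (sem : InsertionSemantics) (r : Rule D C) :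
    Transition (sig D C) where
  I := RI D
  X := RX D
  guard := QF.conj
    [QF.conj (r.life.map fun p =>
        .eq (.read (sg := sig D C) (.ctrl p.1) RIdx.case)
          (.const (sg := sig D C) (s := none) p.2)),
     QF.conj (r.cond.map fun φ => φ.tr (J := RI D) RIdx.case),
     CQ.tr (J := RI D) Empty.elim RIdx.case (fun m _ => RIdx.lit m)
      (fun s n => .dvar (sg := sig D C) (s := some s) n) r.pre,
     r.eff.guardPart]
  update := fun
    | .case x => match r.eff.setPart x with
        | none => .leaf (.read (sg := sig D C) (.case x) .lam)
        | some v => .ite (.idxEq (sg := sig D C) (e := none) .lam (.var RIdx.case))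
            (.leaf v.tr) (.leaf (.read (sg := sig D C) (.case x) .lam))
    | .ctrl c => match r.upd c with
        | none => .leaf (.read (sg := sig D C) (.ctrl c) .lam)
        | some l => .ite (.idxEq (sg := sig D C) (e := none) .lam (.var RIdx.case))
            (.leaf (.const (sg := sig D C) (s := none) l))
            (.leaf (.read (sg := sig D C) (.ctrl c) .lam))
    | .repo R k => r.eff.repoUpdate sem R k

end RuleTranslation

/-- All rules of the process. The first one starts a case: the indexes of the artifact sort of
cases are the potential cases, with all lifecycles `idle` and all case variables undefined. -/
noncomputable def DABModel.rules (M : DABModel) : List (Rule M.D M.Ctrl) :=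
  ctrlRule [(none, .idle)] [(none, .enabled)] ::
    M.P.rules id { proc := none, handlers := [] }

/-- The relational artifact system of the process, without bounds on the number of cases and on
the size of the repository. The array of `self` is rigid. -/
noncomputable def DABModel.toRAS (sem : InsertionSemantics) (M : DABModel) : RAS where
  sg := sig M.D M.Ctrl
  rigid := {.case M.D.self}
  init := fun
    | .case x => M.D.undef (M.D.cvarTy x)
    | .ctrl _ => Lifecycle.idle
    | .repo R k => M.D.undef (M.D.repoAttr R k)
  trans := M.rules.map (Rule.toTransition sem)

/-- The index variables of a translated property: one for each of the `n` cases, and one for each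
repository literal (position `m`) of each disjunct (position `k`) of each guard. -/
inductive PIdx (n : ℕ)
  | case (i : Fin n)
  | lit (i : Fin n) (k m : ℕ)

/-- The existential formula of a property. Different indexes denote different cases; the data
variables of different guards are different. -/
def Property.toFormula {M : DABModel} (υ : Property M) : ExFormula (sig M.D M.Ctrl) where
  I := fun _ => PIdx υ.n
  X := fun _ => Fin υ.n × ℕ
  matrix := .and
    (QF.conj <| List.ofFn fun i => QF.conj <| List.ofFn fun j =>
      if i = j then .tru
      else .not (.idxEq (sg := sig M.D M.Ctrl) (e := none) (PIdx.case i) (PIdx.case j)))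
    (QF.conj <| List.ofFn fun i => QF.disj <| (υ.guards i).body.zipIdx.map fun p =>
      CQ.tr (J := fun _ => PIdx υ.n) id (PIdx.case i) (fun m _ => PIdx.lit i p.2 m)
        (fun s v => .dvar (sg := sig M.D M.Ctrl) (s := some s) (i, v)) p.1)

/-- `BackReach`, for the given semantics of insertion and without bounds on the number of cases
and on the size of the repository, terminates on the process and the property. -/
def BackReachTerminates (sem : InsertionSemantics) (M : DABModel) (υ : Property M) : Prop :=
  (M.toRAS sem).BReachTerminates υ.toFormula

end Dab

namespace Dab

/-! # Types of tuples and amalgamation -/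

/-- Injective maps between structures that commute with the functions, but need not preserve the
constants. -/
structure DBModel.FnEmbedding {sg : Sig} (M N : DBModel sg) where
  toFun : (s : sg.S) → M.carrier s → N.carrier s
  injective : ∀ s, Function.Injective (toFun s)
  map_fn : ∀ f x, toFun _ (M.fn f x) = N.fn f (toFun _ x)

def DBModel.Embedding.toFn {sg : Sig} {M N : DBModel sg} (h : M.Embedding N) :
    M.FnEmbedding N where
  toFun := h.toFun
  injective := h.injective
  map_fn := h.map_fn

def DBModel.FnEmbedding.comp {sg : Sig} {M N P : DBModel sg} (h : N.FnEmbedding P)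
    (g : M.FnEmbedding N) : M.FnEmbedding P where
  toFun := fun s x => h.toFun s (g.toFun s x)
  injective := fun s => (h.injective s).comp (g.injective s)
  map_fn := fun f x => by rw [g.map_fn, h.map_fn]

def DBModel.Embedding.comp {sg : Sig} {M N P : DBModel sg} (h : N.Embedding P)
    (g : M.Embedding N) : M.Embedding P where
  toFun := fun s x => h.toFun s (g.toFun s x)
  injective := fun s => (h.injective s).comp (g.injective s)
  map_const := fun s k => by rw [g.map_const, h.map_const]
  map_fn := fun f x => by rw [g.map_fn, h.map_fn]

/-- Terms over a family of sorted generators. -/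
inductive GTm (sg : Sig) {G : Type} (srt : G → sg.S) : sg.S → Type
  | gen (g : G) : GTm sg srt (srt g)
  | app (f : sg.F) (t : GTm sg srt (sg.src f)) : GTm sg srt (sg.tgt f)

section Types

variable {sg : Sig} {G : Type} {srt : G → sg.S}

def GTm.eval (M : DBModel sg) (v : (g : G) → M.carrier (srt g)) :
    {s : sg.S} → GTm sg srt s → M.carrier s
  | _, .gen g => v g
  | _, .app f t => M.fn f (t.eval M v)

/-- Two valuations of the generators satisfy the same equations. -/
def SameType {M N : DBModel sg} (v : (g : G) → M.carrier (srt g))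
    (w : (g : G) → N.carrier (srt g)) : Prop :=
  ∀ s (t u : GTm sg srt s), t.eval M v = u.eval M v ↔ t.eval N w = u.eval N w

theorem SameType.symm {M N : DBModel sg} {v : (g : G) → M.carrier (srt g)}
    {w : (g : G) → N.carrier (srt g)} (h : SameType v w) : SameType w v :=
  fun s t u => (h s t u).symm

theorem SameType.trans {M N P : DBModel sg} {v : (g : G) → M.carrier (srt g)}
    {w : (g : G) → N.carrier (srt g)} {z : (g : G) → P.carrier (srt g)}
    (h : SameType v w) (h' : SameType w z) : SameType v z :=
  fun s t u => (h s t u).trans (h' s t u)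

theorem GTm.eval_map {M N : DBModel sg} (θ : M.FnEmbedding N) {v : (g : G) → M.carrier (srt g)}
    {w : (g : G) → N.carrier (srt g)} (h : ∀ g, θ.toFun _ (v g) = w g) {s : sg.S}
    (t : GTm sg srt s) : θ.toFun _ (t.eval M v) = t.eval N w := by
  induction t with
  | gen g => exact h g
  | app f t ih => simp only [GTm.eval, θ.map_fn, ih]

theorem SameType.of_map {M N : DBModel sg} (θ : M.FnEmbedding N)
    {v : (g : G) → M.carrier (srt g)} {w : (g : G) → N.carrier (srt g)}
    (h : ∀ g, θ.toFun _ (v g) = w g) : SameType v w := fun s t u => by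
  rw [← GTm.eval_map θ h, ← GTm.eval_map θ h, (θ.injective s).eq_iff]

open Classical in
/-- The map from `N` to the free amalgam of `M` and `N` over the substructures generated by `v`
and `w`. -/
noncomputable def amalgamMap {M N : DBModel sg} (v : (g : G) → M.carrier (srt g))
    (w : (g : G) → N.carrier (srt g)) (s : sg.S) (y : N.carrier s) :
    M.carrier s ⊕ {y : N.carrier s // ¬ ∃ t : GTm sg srt s, t.eval N w = y} :=
  if h : ∃ t : GTm sg srt s, t.eval N w = y then .inl (h.choose.eval M v) else .inr ⟨y, h⟩

/-- The free amalgam of `M` and `N` over the substructures generated by `v` and `w`. -/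
noncomputable def amalgam {M N : DBModel sg} (v : (g : G) → M.carrier (srt g))
    (w : (g : G) → N.carrier (srt g)) : DBModel sg where
  carrier := fun s => M.carrier s ⊕ {y : N.carrier s // ¬ ∃ t : GTm sg srt s, t.eval N w = y}
  const := fun s k => .inl (M.const s k)
  fn := fun f => Sum.elim (fun x => .inl (M.fn f x)) (fun y => amalgamMap v w _ (N.fn f y.1))

theorem amalgamMap_eval {M N : DBModel sg} {v : (g : G) → M.carrier (srt g)}
    {w : (g : G) → N.carrier (srt g)} (h : SameType v w) {s : sg.S} (t : GTm sg srt s) :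
    amalgamMap v w s (t.eval N w) = .inl (t.eval M v) := by
  have hex : ∃ t' : GTm sg srt s, t'.eval N w = t.eval N w := ⟨t, rfl⟩
  rw [amalgamMap, dif_pos hex]
  exact congrArg _ ((h _ _ _).2 hex.choose_spec)

theorem amalgamMap_of_not {M N : DBModel sg} {v : (g : G) → M.carrier (srt g)}
    {w : (g : G) → N.carrier (srt g)} {s : sg.S} {y : N.carrier s}
    (hy : ¬ ∃ t : GTm sg srt s, t.eval N w = y) :
    amalgamMap v w s y = .inr ⟨y, hy⟩ := by
  rw [amalgamMap, dif_neg hy]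

theorem amalgamMap_injective {M N : DBModel sg} {v : (g : G) → M.carrier (srt g)}
    {w : (g : G) → N.carrier (srt g)} (h : SameType v w) (s : sg.S) :
    Function.Injective (amalgamMap v w s) := by
  intro y z hyz
  by_cases hy : ∃ t : GTm sg srt s, t.eval N w = y <;>
    by_cases hz : ∃ t : GTm sg srt s, t.eval N w = z
  · obtain ⟨t, rfl⟩ := hy
    obtain ⟨u, rfl⟩ := hz
    rw [amalgamMap_eval h, amalgamMap_eval h] at hyz
    exact (h _ _ _).1 (Sum.inl.inj hyz)
  · obtain ⟨t, rfl⟩ := hy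
    rw [amalgamMap_eval h, amalgamMap_of_not hz] at hyz
    cases hyz
  · obtain ⟨u, rfl⟩ := hz
    rw [amalgamMap_eval h, amalgamMap_of_not hy] at hyz
    cases hyz
  · rw [amalgamMap_of_not hy, amalgamMap_of_not hz] at hyz
    exact congrArg Subtype.val (Sum.inr.inj hyz)

/-- Models of `T` amalgamate over substructures whose generators satisfy the same equations. -/
theorem exists_amalgam {M N : DBModel sg} (hM : M.IsModelOfT) (hN : N.IsModelOfT)
    {v : (g : G) → M.carrier (srt g)} {w : (g : G) → N.carrier (srt g)} (h : SameType v w)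
    (hundef : ∀ f : sg.F, ∀ s, s = sg.src f ∨ s = sg.tgt f → ∃ t : GTm sg srt s,
      t.eval M v = M.const _ (sg.undef s) ∧ t.eval N w = N.const _ (sg.undef s)) :
    ∃ (P : DBModel sg) (_ : P.IsModelOfT) (e : M.Embedding P) (θ : N.FnEmbedding P),
      ∀ g, θ.toFun _ (w g) = e.toFun _ (v g) := by
  refine ⟨amalgam v w, ⟨?_, ?_⟩, ⟨fun s => Sum.inl, fun s => Sum.inl_injective, fun _ _ => rfl,
    fun _ _ => rfl⟩, ⟨amalgamMap v w, amalgamMap_injective h, ?_⟩, fun g => ?_⟩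
  · rintro f (x | ⟨y, hy⟩)
    · have := hM.undef_iff f x
      exact ⟨fun hx => congrArg Sum.inl (this.1 (Sum.inl.inj hx)),
        fun hx => congrArg Sum.inl (this.2 (Sum.inl.inj hx))⟩
    · refine ⟨fun hx => (by cases hx), fun hx => ?_⟩
      exfalso
      obtain ⟨t, ht, ht'⟩ := hundef f _ (.inr rfl)
      obtain ⟨u, hu, hu'⟩ := hundef f _ (.inl rfl)
      have hx' : amalgamMap v w _ (N.fn f y) = amalgamMap v w _ (t.eval N w) := by
        rw [amalgamMap_eval h, ht]; exact hx
      have := amalgamMap_injective h _ hx'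
      rw [ht', ← hN.undef_iff f y] at this
      exact hy ⟨u, by rw [hu', this]⟩
  · exact fun s k k' hk => hM.const_injective s (Sum.inl.inj hk)
  · intro f x
    by_cases hx : ∃ t : GTm sg srt _, t.eval N w = x
    · obtain ⟨t, rfl⟩ := hx
      rw [amalgamMap_eval h]
      exact amalgamMap_eval h (t.app f)
    · rw [amalgamMap_of_not hx]
      rfl
  · exact amalgamMap_eval h (.gen g)

/-- Over an acyclic signature there are only finitely many terms. -/
theorem GTm.finite [Finite G] [Finite sg.F]
    (hacyc : ∀ f : sg.F, ¬ Relation.TransGen (fun f g => sg.tgt f = sg.src g) f f) :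
    Finite ((s : sg.S) × GTm sg srt s) := by
  classical
  have wf : WellFounded (Relation.TransGen fun f g : sg.F => sg.tgt f = sg.src g) :=
    haveI : IsTrans sg.F (Relation.TransGen fun f g : sg.F => sg.tgt f = sg.src g) :=
      ⟨fun _ _ _ => Relation.TransGen.trans⟩
    haveI : Std.Irrefl (Relation.TransGen fun f g : sg.F => sg.tgt f = sg.src g) := ⟨hacyc⟩
    Finite.wellFounded_of_trans_of_irrefl _
  let gens : Set ((s : sg.S) × GTm sg srt s) := Set.range fun g => ⟨_, .gen g⟩
  let apps (f : sg.F) : Set ((s : sg.S) × GTm sg srt s) := Set.range fun t => ⟨_, .app f t⟩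
  have happs : ∀ f, (apps f).Finite := by
    intro f
    induction f using wf.induction with
    | h f ih =>
      let B : Set ((s : sg.S) × GTm sg srt s) :=
        gens ∪ ⋃ g ∈ {g : sg.F | sg.tgt g = sg.src f}, apps g
      have hB : B.Finite := (Set.finite_range _).union
        (Set.Finite.biUnion (Set.toFinite _) fun g hg => ih g (.single hg))
      refine (hB.image fun x => if h : x.1 = sg.src f
        then (⟨_, .app f (h ▸ x.2)⟩ : (s : sg.S) × GTm sg srt s) else x).subset ?_
      rintro _ ⟨t, rfl⟩
      refine ⟨⟨_, t⟩, ?_, by simp⟩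
      generalize hs : sg.src f = s at t
      cases t with
      | gen g => exact .inl ⟨g, rfl⟩
      | app g t => exact .inr (Set.mem_biUnion (x := g) hs.symm ⟨t, rfl⟩)
  refine Set.finite_univ_iff.1 (((Set.finite_range _).union
    (Set.finite_iUnion happs)).subset (s := gens ∪ ⋃ f, apps f) ?_)
  rintro ⟨s, t⟩ -
  cases t with
  | gen g => exact .inl ⟨g, rfl⟩
  | app g t => exact .inr (Set.mem_iUnion.2 ⟨g, t, rfl⟩)

end Types

/-! # Pointed configurations and their ordering -/

/-- Configurations together with `n` distinguished indexes of the array `a₀`. -/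
abbrev RAS.Pointed (S : RAS) (a₀ : S.sg.A) (n : ℕ) : Type 1 :=
  (c : S.Config) × (Fin n → c.idx (S.sg.asrc a₀))

/-- The generators of the type of an index of sort `e`: the constants in `K₀`, the elements of `a₀`
at the distinguished indexes, and the arrays with index sort `e`, except `a₀`. -/
abbrev LocalGen (sg : Sig) (a₀ : sg.A) (n : ℕ) (K₀ : Set ((s : sg.S) × sg.K s)) (e : sg.E) : Type :=
  K₀ ⊕ Fin n ⊕ {a : sg.A // sg.asrc a = e ∧ a ≠ a₀}

def LocalGen.srt {sg : Sig} (a₀ : sg.A) (n : ℕ) (K₀ : Set ((s : sg.S) × sg.K s)) (e : sg.E) :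
    LocalGen sg a₀ n K₀ e → sg.S
  | .inl k => k.1.1
  | .inr (.inl _) => sg.atgt a₀
  | .inr (.inr a) => sg.atgt a.1

section Order

variable {S : RAS} {a₀ : S.sg.A} {n : ℕ} {K₀ : Set ((s : S.sg.S) × S.sg.K s)}

variable (K₀) in
/-- The values of the generators at the index `j`. -/
def RAS.Pointed.val (x : S.Pointed a₀ n) (e : S.sg.E) (j : x.1.idx e) :
    (g : LocalGen S.sg a₀ n K₀ e) → x.1.M.carrier (LocalGen.srt a₀ n K₀ e g)
  | .inl k => x.1.M.const _ k.1.2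
  | .inr (.inl i) => x.1.arr a₀ (x.2 i)
  | .inr (.inr a) => x.1.arr a.1 (cast (congrArg x.1.idx a.2.1.symm) j)

variable (K₀) in
/-- `y` has, for each type, at least as many indexes of that type as `x`. -/
structure RAS.Pointed.Le (x y : S.Pointed a₀ n) (h : (e : S.sg.E) → x.1.idx e → y.1.idx e) :
    Prop where
  injective : ∀ e, Function.Injective (h e)
  point : ∀ i, h _ (x.2 i) = y.2 i
  same : ∀ e j, SameType (x.val K₀ e j) (y.val K₀ e (h e j))

/-- The elements of `a₀` at distinguished indexes and the constants in `K₀` are respected. -/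
structure RespectsParams (x y : S.Pointed a₀ n) (K₀ : Set ((s : S.sg.S) × S.sg.K s))
    {P : DBModel S.sg} (θ : x.1.M.FnEmbedding P) (e : y.1.M.FnEmbedding P) : Prop where
  const : ∀ k ∈ K₀, θ.toFun _ (x.1.M.const k.1 k.2) = e.toFun _ (y.1.M.const k.1 k.2)
  point : ∀ i, θ.toFun _ (x.1.arr a₀ (x.2 i)) = e.toFun _ (y.1.arr a₀ (y.2 i))

theorem sameType_of_respects {x y : S.Pointed a₀ n} {P : DBModel S.sg}
    (θ : x.1.M.FnEmbedding P) (e : y.1.M.FnEmbedding P) (hθ : RespectsParams x y K₀ θ e)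
    {s : S.sg.E} {j : x.1.idx s} {j' : y.1.idx s}
    (h : ∀ a (ha : S.sg.asrc a = s), a ≠ a₀ →
      θ.toFun _ (x.1.arr a (cast (congrArg x.1.idx ha.symm) j)) =
        e.toFun _ (y.1.arr a (cast (congrArg y.1.idx ha.symm) j'))) :
    SameType (x.val K₀ s j) (y.val K₀ s j') := by
  refine SameType.trans (N := P) (w := fun g => e.toFun _ (y.val K₀ s j' g))
    (SameType.of_map θ ?_) (SameType.of_map e fun _ => rfl).symm
  rintro (⟨k, hk⟩ | i | ⟨a, ha, ha'⟩)
  · exact hθ.const k hk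
  · exact hθ.point i
  · exact h a ha ha'

/-- The set contains `undef` for the sources and targets of all functions. -/
def UndefClosed (sg : Sig) (K₀ : Set ((s : sg.S) × sg.K s)) : Prop :=
  ∀ f : sg.F, ⟨_, sg.undef (sg.src f)⟩ ∈ K₀ ∧ ⟨_, sg.undef (sg.tgt f)⟩ ∈ K₀

/-- The map `θ` glues the index `j` of `x` to the index `j'` of `y`. -/
structure Glues (x y : S.Pointed a₀ n) (K₀ : Set ((s : S.sg.S) × S.sg.K s))
    {P : DBModel S.sg} (ε : y.1.M.Embedding P) (θ : x.1.M.FnEmbedding P) (s : S.sg.E)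
    (j : x.1.idx s) (j' : y.1.idx s) : Prop extends RespectsParams x y K₀ θ ε.toFn where
  arr : ∀ a (ha : S.sg.asrc a = s), a ≠ a₀ →
    θ.toFun _ (x.1.arr a (cast (congrArg x.1.idx ha.symm) j)) =
      ε.toFun _ (y.1.arr a (cast (congrArg y.1.idx ha.symm) j'))

theorem Glues.comp {x y : S.Pointed a₀ n} {P P' : DBModel S.sg} {ε : y.1.M.Embedding P}
    {θ : x.1.M.FnEmbedding P} {s : S.sg.E} {j : x.1.idx s} {j' : y.1.idx s}
    (h : Glues x y K₀ ε θ s j j') (e : P.Embedding P') :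
    Glues x y K₀ (e.comp ε) (e.toFn.comp θ) s j j' where
  const := fun k hk => congrArg (e.toFun _) (h.const k hk)
  point := fun i => congrArg (e.toFun _) (h.point i)
  arr := fun a ha ha' => congrArg (e.toFun _) (h.arr a ha ha')

/-- Indexes of the same type can be glued in an extension of a given model. -/
theorem exists_glues (hK : UndefClosed S.sg K₀) {x y : S.Pointed a₀ n} {s : S.sg.E}
    {j : x.1.idx s} {j' : y.1.idx s} (h : SameType (x.val K₀ s j) (y.val K₀ s j'))
    {N : DBModel S.sg} (hN : N.IsModelOfT) (ε : y.1.M.Embedding N) :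
    ∃ (P : DBModel S.sg) (_ : P.IsModelOfT) (e : N.Embedding P) (θ : x.1.M.FnEmbedding P),
      Glues x y K₀ (e.comp ε) θ s j j' := by
  have hsame : SameType (M := N) (fun g => ε.toFn.toFun _ (y.val K₀ s j' g)) (x.val K₀ s j) :=
    (h.trans (SameType.of_map ε.toFn fun _ => rfl)).symm
  have hgen : ∀ k ∈ K₀, ∃ t : GTm S.sg (LocalGen.srt a₀ n K₀ s) k.1,
      t.eval N (fun g => ε.toFn.toFun _ (y.val K₀ s j' g)) = N.const _ k.2 ∧
      t.eval _ (x.val K₀ s j) = x.1.M.const _ k.2 := fun k hk =>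
    ⟨GTm.gen (srt := LocalGen.srt a₀ n K₀ s) (Sum.inl ⟨k, hk⟩), ε.map_const _ _, rfl⟩
  obtain ⟨P, hP, e, θ, hθ⟩ := exists_amalgam hN x.1.isModel hsame fun f s' hs' => by
    obtain rfl | rfl := hs'
    · exact hgen _ (hK f).1
    · exact hgen _ (hK f).2
  exact ⟨P, hP, e, θ, ⟨⟨fun k hk => hθ (.inl ⟨k, hk⟩), fun i => hθ (.inr (.inl i))⟩,
    fun a ha ha' => hθ (.inr (.inr ⟨a, ha, ha'⟩))⟩⟩

def DBModel.Embedding.refl {sg : Sig} (M : DBModel sg) : M.Embedding M where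
  toFun := fun _ x => x
  injective := fun _ _ _ h => h
  map_const := fun _ _ => rfl
  map_fn := fun _ _ => rfl

/-- Two pairs of indexes can be glued, independently of each other, in one extension. -/
theorem exists_glues_two (hK : UndefClosed S.sg K₀) {x y : S.Pointed a₀ n}
    {s₁ s₂ : S.sg.E} {j₁ : x.1.idx s₁} {j₁' : y.1.idx s₁} {j₂ : x.1.idx s₂} {j₂' : y.1.idx s₂}
    (h₁ : SameType (x.val K₀ s₁ j₁) (y.val K₀ s₁ j₁'))
    (h₂ : SameType (x.val K₀ s₂ j₂) (y.val K₀ s₂ j₂')) :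
    ∃ (P : DBModel S.sg) (_ : P.IsModelOfT) (ε : y.1.M.Embedding P)
      (θ₁ θ₂ : x.1.M.FnEmbedding P),
      Glues x y K₀ ε θ₁ s₁ j₁ j₁' ∧ Glues x y K₀ ε θ₂ s₂ j₂ j₂' := by
  obtain ⟨N, hN, ε, θ₁, hθ₁⟩ := exists_glues hK h₁ y.1.isModel (.refl _)
  obtain ⟨P, hP, e, θ₂, hθ₂⟩ := exists_glues hK h₂ hN (ε.comp (.refl _))
  exact ⟨P, hP, _, _, θ₂, hθ₁.comp e, hθ₂⟩

/-- An array element is a constant in `K₀` iff the corresponding one is. -/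
theorem RAS.Pointed.Le.arr_eq_const {x y : S.Pointed a₀ n}
    {f : (e : S.sg.E) → x.1.idx e → y.1.idx e} (h : x.Le K₀ y f) {a : S.sg.A} (ha : a ≠ a₀)
    {k : S.sg.K (S.sg.atgt a)} (hk : ⟨_, k⟩ ∈ K₀) (j : x.1.idx (S.sg.asrc a)) :
    x.1.arr a j = x.1.M.const _ k ↔ y.1.arr a (f _ j) = y.1.M.const _ k :=
  h.same _ j _ (GTm.gen (srt := LocalGen.srt a₀ n K₀ (S.sg.asrc a)) (.inr (.inr ⟨a, rfl, ha⟩)))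
    (GTm.gen (srt := LocalGen.srt a₀ n K₀ (S.sg.asrc a)) (.inl ⟨⟨_, k⟩, hk⟩))

variable (K₀) in
/-- The type of an index, and the distinguished indexes that are equal to it. -/
def RAS.Pointed.color (x : S.Pointed a₀ n) (e : S.sg.E) (j : x.1.idx e) :
    Set ((s : S.sg.S) × GTm S.sg (LocalGen.srt a₀ n K₀ e) s ×
      GTm S.sg (LocalGen.srt a₀ n K₀ e) s) × Set (Fin n) :=
  ({p | p.2.1.eval _ (x.val K₀ e j) = p.2.2.eval _ (x.val K₀ e j)},
    {i | (⟨_, x.2 i⟩ : (e : S.sg.E) × x.1.idx e) = ⟨e, j⟩})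

theorem RAS.Pointed.exists_le_of_card {x y : S.Pointed a₀ n}
    (h : ∀ e col, Cardinal.mk {j : x.1.idx e // x.color K₀ e j = col} ≤
      Cardinal.mk {j : y.1.idx e // y.color K₀ e j = col}) : ∃ f, x.Le K₀ y f := by
  have emb : ∀ e col, {j : x.1.idx e // x.color K₀ e j = col} ↪
      {j : y.1.idx e // y.color K₀ e j = col} :=
    fun e col => ((Cardinal.le_def _ _).1 (h e col)).some
  have emb_eq : ∀ e col j (hj : x.color K₀ e j = col),
      (emb e (x.color K₀ e j) ⟨j, rfl⟩).1 = (emb e col ⟨j, hj⟩).1 := by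
    rintro e _ j rfl; rfl
  refine ⟨fun e j => (emb e _ ⟨j, rfl⟩).1, ⟨fun e j₁ j₂ hj => ?_, fun i => ?_, fun e j => ?_⟩⟩
  · have h₁ := (emb e _ ⟨j₁, rfl⟩).2
    have h₂ := (emb e _ ⟨j₂, rfl⟩).2
    have hcol : x.color K₀ e j₂ = x.color K₀ e j₁ := by
      rw [← h₁, ← h₂]; exact congrArg _ hj.symm
    replace hj : (emb e _ ⟨j₁, rfl⟩).1 = (emb e _ ⟨j₂, rfl⟩).1 := hj
    rw [emb_eq e _ j₂ hcol] at hj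
    exact congrArg Subtype.val ((emb e _).injective (Subtype.ext hj))
  · have h₁ := congrArg Prod.snd (emb _ _ ⟨x.2 i, rfl⟩).2
    have h₂ : i ∈ (x.color K₀ _ (x.2 i)).2 := rfl
    rw [← h₁] at h₂
    exact (eq_of_heq (Sigma.mk.inj h₂).2).symm
  · intro s t u
    have h₁ := congrArg Prod.fst (emb e _ ⟨j, rfl⟩).2
    exact (Set.ext_iff.1 h₁ ⟨s, t, u⟩).symm

/-- The ordering is a well-quasi-ordering. -/
theorem RAS.Pointed.wqo [Finite S.sg.E] [Finite S.sg.A] [Finite S.sg.F] (hK : K₀.Finite)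
    (hacyc : ∀ f : S.sg.F, ¬ Relation.TransGen (fun f g => S.sg.tgt f = S.sg.src g) f f)
    (x : ℕ → S.Pointed a₀ n) : ∃ i j, i < j ∧ ∃ f, (x i).Le K₀ (x j) f := by
  have : Finite K₀ := hK
  have hfin : ∀ e, Finite ((s : S.sg.S) × GTm S.sg (LocalGen.srt a₀ n K₀ e) s) :=
    fun e => GTm.finite hacyc
  have hfin' : ∀ e, Finite ((s : S.sg.S) × GTm S.sg (LocalGen.srt a₀ n K₀ e) s ×
      GTm S.sg (LocalGen.srt a₀ n K₀ e) s) := fun e => by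
    have := hfin e
    refine Finite.of_injective (β := ((s : S.sg.S) × GTm S.sg (LocalGen.srt a₀ n K₀ e) s) ×
      ((s : S.sg.S) × GTm S.sg (LocalGen.srt a₀ n K₀ e) s))
      (fun p => (⟨p.1, p.2.1⟩, ⟨p.1, p.2.2⟩)) ?_
    rintro ⟨s, t, u⟩ ⟨s', t', u'⟩ h
    simp only [Prod.mk.injEq, Sigma.mk.injEq] at h
    obtain ⟨⟨rfl, ht⟩, -, hu⟩ := h
    rw [eq_of_heq ht, eq_of_heq hu]
  let count (x : S.Pointed a₀ n) : ((e : S.sg.E) × (Set ((s : S.sg.S) ×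
      GTm S.sg (LocalGen.srt a₀ n K₀ e) s × GTm S.sg (LocalGen.srt a₀ n K₀ e) s) ×
      Set (Fin n))) → Cardinal.{0} :=
    fun p => Cardinal.mk {j : x.1.idx p.1 // x.color K₀ p.1 j = p.2}
  obtain ⟨i, j, hij, h⟩ := wellQuasiOrdered_le fun i => count (x i)
  exact ⟨i, j, hij, exists_le_of_card fun e col => h ⟨e, col⟩⟩

theorem RAS.Pointed.Le.extend {x y : S.Pointed a₀ n} {f : (e : S.sg.E) → x.1.idx e → y.1.idx e}
    (h : x.Le K₀ y f) (N : DBModel S.sg) (hN : N.IsModelOfT) (e : x.1.M.Embedding N) :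
    RAS.Pointed.Le (a₀ := a₀) K₀ ⟨x.1.extend N hN e, x.2⟩ y f where
  injective := h.injective
  point := h.point
  same := fun s j => by
    refine SameType.trans (SameType.of_map e.toFn ?_).symm (h.same s j)
    rintro (k | i | a)
    · exact e.map_const _ _
    · rfl
    · rfl

end Order

/-! # Termination of backward reachability -/

section Termination

variable {S : RAS} {a₀ : S.sg.A} {n : ℕ}

/-- Backward reachability terminates if some iterate of the preimage is covered by the earlier
ones. -/
theorem RAS.exists_loop {φ : ℕ → S.StateSet} (hφ : ∀ k, φ (k + 1) = S.QE (S.Pre (φ k))) {k : ℕ}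
    (hk : ∀ c, φ k c → ∃ i < k, φ i c) : ∃ r, S.Loop (φ 0) (fun _ => False) r := by
  have key : ∀ d m, m + d = k → ∃ r, S.Loop (φ m) (fun c => ∃ i < m, φ i c) r := by
    intro d
    induction d with
    | zero =>
      rintro m rfl
      exact ⟨_, .exit fun ⟨c, h, h'⟩ => h' (hk c h)⟩
    | succ d ih =>
      intro m hm
      by_cases h : S.Sat fun c => φ m c ∧ ¬ ∃ i < m, φ i c
      · by_cases hι : S.Sat fun c => S.initial c ∧ φ m c
        · exact ⟨_, .hit h hι⟩
        · obtain ⟨r, hr⟩ := ih (m + 1) (by omega)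
          refine ⟨r, .step h hι ?_⟩
          rw [← hφ]
          convert hr using 3 with c
          rw [Nat.exists_lt_succ_right, or_comm]
      · exact ⟨_, .exit h⟩
  simpa using key k 0 (Nat.zero_add k)

/-- The configuration after a transition. -/
@[reducible]
noncomputable def RAS.Config.after (c : S.Config) (t : Transition S.sg)
    (μ : (e : S.sg.E) → t.I e → c.idx e) (ρ : (s : S.sg.S) → t.X s → c.M.carrier s)
    (h : ∀ a ∈ S.rigid, Function.Injective (t.result c μ ρ a)) : S.Config :=
  { c with arr := t.result c μ ρ, rigid_injective := h }

/-- The operation `QE ∘ Pre`, keeping the distinguished indexes. -/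
def RAS.pointedPre (ψ : S.Pointed a₀ n → Prop) (x : S.Pointed a₀ n) : Prop :=
  ∃ (N : DBModel S.sg) (hN : N.IsModelOfT) (ε : x.1.M.Embedding N), ∃ t ∈ S.trans,
    ∃ (μ : (e : S.sg.E) → t.I e → x.1.idx e) (ρ : (s : S.sg.S) → t.X s → N.carrier s),
      t.guard.Holds N (x.1.extend N hN ε).arr μ ρ ∧
      ∃ h, ψ ⟨(x.1.extend N hN ε).after t μ ρ h, x.2⟩

/-- A transition of `x` can be simulated in an extension of each larger `y`. -/
def Transition.Monotone (a₀ : S.sg.A) (n : ℕ) (K₀ : Set ((s : S.sg.S) × S.sg.K s))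
    (t : Transition S.sg) : Prop :=
  ∀ (x y : S.Pointed a₀ n) f, x.Le K₀ y f →
    ∀ (μ : (e : S.sg.E) → t.I e → x.1.idx e) (ρ : (s : S.sg.S) → t.X s → x.1.M.carrier s),
      t.guard.Holds x.1.M x.1.arr μ ρ → ∀ hx,
      ∃ (P : DBModel S.sg) (hP : P.IsModelOfT) (ε : y.1.M.Embedding P)
        (μ' : (e : S.sg.E) → t.I e → y.1.idx e) (ρ' : (s : S.sg.S) → t.X s → P.carrier s),
        t.guard.Holds P (y.1.extend P hP ε).arr μ' ρ' ∧
        ∃ hy, RAS.Pointed.Le (a₀ := a₀) K₀ ⟨x.1.after t μ ρ hx, x.2⟩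
          ⟨(y.1.extend P hP ε).after t μ' ρ' hy, y.2⟩ f

/-- Backward reachability terminates on a disjunction, over the choice of the distinguished
indexes, of an upward closed set, if the transitions are monotone. -/
theorem RAS.bReachTerminates_of_monotone [Finite S.sg.E] [Finite S.sg.A] [Finite S.sg.F]
    {K₀ : Set ((s : S.sg.S) × S.sg.K s)} (hK : K₀.Finite)
    (hacyc : ∀ f : S.sg.F, ¬ Relation.TransGen (fun f g => S.sg.tgt f = S.sg.src g) f f)
    (htrans : ∀ t ∈ S.trans, t.Monotone a₀ n K₀) (υ : ExFormula S.sg)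
    (ψ : S.Pointed a₀ n → Prop) (hψ : ∀ c, υ.denote c ↔ ∃ p, ψ ⟨c, p⟩)
    (hmono : ∀ x y f, x.Le K₀ y f → ψ x → ψ y) : S.BReachTerminates υ := by
  let ψs (k : ℕ) : S.Pointed a₀ n → Prop := RAS.pointedPre^[k] ψ
  let φs (k : ℕ) : S.StateSet := (fun φ => S.QE (S.Pre φ))^[k] υ.denote
  have hψs : ∀ k, ψs (k + 1) = RAS.pointedPre (ψs k) :=
    fun k => Function.iterate_succ_apply' _ _ _
  have hφs : ∀ k, φs (k + 1) = S.QE (S.Pre (φs k)) :=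
    fun k => Function.iterate_succ_apply' _ _ _
  have hrel : ∀ k c, φs k c ↔ ∃ p, ψs k ⟨c, p⟩ := by
    intro k
    induction k with
    | zero => exact hψ
    | succ k ih =>
      intro c
      rw [hφs, hψs]
      constructor
      · rintro ⟨N, hN, ε, t, ht, μ, ρ, hg, h, hφ⟩
        obtain ⟨p, hp⟩ := (ih _).1 hφ
        exact ⟨p, N, hN, ε, t, ht, μ, ρ, hg, h, hp⟩
      · rintro ⟨p, N, hN, ε, t, ht, μ, ρ, hg, h, hp⟩
        exact ⟨N, hN, ε, t, ht, μ, ρ, hg, h, (ih _).2 ⟨p, hp⟩⟩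
  have hup : ∀ k x y f, x.Le K₀ y f → ψs k x → ψs k y := by
    intro k
    induction k with
    | zero => exact hmono
    | succ k ih =>
      intro x y f hxy
      rw [hψs]
      rintro ⟨N, hN, ε, t, ht, μ, ρ, hg, h, hp⟩
      obtain ⟨P, hP, ε', μ', ρ', hg', h', hle⟩ :=
        htrans t ht _ _ _ (hxy.extend N hN ε) μ ρ hg h
      exact ⟨P, hP, ε', t, ht, μ', ρ', hg', h', ih _ _ _ hle hp⟩
  obtain ⟨k, hk⟩ : ∃ k, ∀ x, ψs k x → ∃ i < k, ψs i x := by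
    by_contra! hcon
    choose x hx hx' using hcon
    obtain ⟨i, j, hij, f, hle⟩ := RAS.Pointed.wqo hK hacyc x
    exact hx' j i hij (hup i _ _ _ hle (hx i))
  refine RAS.exists_loop hφs (k := k) fun c hc => ?_
  obtain ⟨p, hp⟩ := (hrel k c).1 hc
  obtain ⟨i, hi, hp'⟩ := hk _ hp
  exact ⟨i, hi, (hrel i c).2 ⟨p, hp'⟩⟩

end Termination

/-! # Preservation of quantifier-free formulae -/

section Constants

variable {sg : Sig} {J : sg.E → Type} {X : sg.S → Type}

def Tm.consts : {s : sg.S} → Tm sg J X s → Set ((s : sg.S) × sg.K s)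
  | s, .const k => {⟨s, k⟩}
  | _, .dvar _ => ∅
  | _, .app _ t => t.consts
  | _, .read _ _ => ∅

def QF.consts : QF sg J X → Set ((s : sg.S) × sg.K s)
  | .tru => ∅
  | .eq t u => t.consts ∪ u.consts
  | .idxEq _ _ => ∅
  | .not φ => φ.consts
  | .and φ ψ => φ.consts ∪ ψ.consts

def CaseTm.consts {s : sg.S} : CaseTm sg J X s → Set ((s : sg.S) × sg.K s)
  | .leaf t => t.consts
  | .ite κ t u => κ.consts ∪ t.consts ∪ u.consts

def Transition.consts (t : Transition sg) : Set ((s : sg.S) × sg.K s) :=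
  t.guard.consts ∪ ⋃ a, (t.update a).consts

theorem Tm.consts_finite {s : sg.S} (t : Tm sg J X s) : t.consts.Finite := by
  induction t with
  | const k => exact Set.finite_singleton _
  | dvar x => exact Set.finite_empty
  | app f t ih => exact ih
  | read a j => exact Set.finite_empty

theorem QF.consts_finite (φ : QF sg J X) : φ.consts.Finite := by
  induction φ with
  | tru => exact Set.finite_empty
  | eq t u => exact t.consts_finite.union u.consts_finite
  | idxEq i j => exact Set.finite_empty
  | not φ ih => exact ih
  | and φ ψ ih ih' => exact ih.union ih'

theorem CaseTm.consts_finite {s : sg.S} (t : CaseTm sg J X s) : t.consts.Finite := by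
  induction t with
  | leaf t => exact t.consts_finite
  | ite κ t u ih ih' => exact (κ.consts_finite.union ih).union ih'

theorem Transition.consts_finite [Finite sg.A] (t : Transition sg) : t.consts.Finite :=
  t.guard.consts_finite.union (Set.finite_iUnion fun a => (t.update a).consts_finite)

theorem QF.consts_conj_subset {l : List (QF sg J X)} {K₀ : Set ((s : sg.S) × sg.K s)} :
    (QF.conj l).consts ⊆ K₀ ↔ ∀ φ ∈ l, φ.consts ⊆ K₀ := by
  induction l with
  | nil => simp [QF.conj, QF.consts]
  | cons φ l ih => simp [QF.conj, QF.consts, ih]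

theorem QF.consts_disj_subset {l : List (QF sg J X)} {K₀ : Set ((s : sg.S) × sg.K s)} :
    (QF.disj l).consts ⊆ K₀ ↔ ∀ φ ∈ l, φ.consts ⊆ K₀ := by
  induction l with
  | nil => simp [QF.disj, QF.consts]
  | cons φ l ih => simp [QF.disj, QF.consts, ih]

variable {M : DBModel sg} {idx : sg.E → Type}
  {arr : (a : sg.A) → idx (sg.asrc a) → M.carrier (sg.atgt a)}
  {μ : (e : sg.E) → J e → idx e} {ρ : (s : sg.S) → X s → M.carrier s}

theorem QF.holds_conj {l : List (QF sg J X)} :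
    (QF.conj l).Holds M arr μ ρ ↔ ∀ φ ∈ l, φ.Holds M arr μ ρ := by
  induction l with
  | nil => simp [QF.conj, QF.Holds]
  | cons φ l ih => simp [QF.conj, QF.Holds, ih]

theorem QF.holds_disj {l : List (QF sg J X)} :
    (QF.disj l).Holds M arr μ ρ ↔ ∃ φ ∈ l, φ.Holds M arr μ ρ := by
  induction l with
  | nil => simp [QF.disj, QF.Holds]
  | cons φ l ih => simp only [QF.disj, QF.Holds, ih, List.mem_cons, exists_eq_or_imp, not_and_or, not_not]

end Constants

section Agree

variable {sg : Sig} {J : sg.E → Type} {X : sg.S → Type} {M M' : DBModel sg}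
  (θ : M.FnEmbedding M') {idx idx' : sg.E → Type}
  (arr : (a : sg.A) → idx (sg.asrc a) → M.carrier (sg.atgt a))
  (arr' : (a : sg.A) → idx' (sg.asrc a) → M'.carrier (sg.atgt a))
  (μ : (e : sg.E) → J e → idx e) (μ' : (e : sg.E) → J e → idx' e)
  (ρ : (s : sg.S) → X s → M.carrier s) (ρ' : (s : sg.S) → X s → M'.carrier s)

/-- The map `θ` respects the data variables and array accesses in the term. -/
def Tm.Agree : {s : sg.S} → Tm sg J X s → Prop
  | _, .const _ => True
  | s, .dvar x => θ.toFun s (ρ s x) = ρ' s x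
  | _, .app _ t => t.Agree
  | _, .read a j => θ.toFun _ (arr a (μ _ j)) = arr' a (μ' _ j)

def QF.Agree : QF sg J X → Prop
  | .tru => True
  | .eq t u => t.Agree θ arr arr' μ μ' ρ ρ' ∧ u.Agree θ arr arr' μ μ' ρ ρ'
  | .idxEq i j => μ _ i = μ _ j ↔ μ' _ i = μ' _ j
  | .not φ => φ.Agree
  | .and φ ψ => φ.Agree ∧ ψ.Agree

def CaseTm.Agree {s : sg.S} : CaseTm sg J X s → Prop
  | .leaf t => t.Agree θ arr arr' μ μ' ρ ρ'
  | .ite κ t u => κ.Agree θ arr arr' μ μ' ρ ρ' ∧ t.Agree ∧ u.Agree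

variable {θ arr arr' μ μ' ρ ρ'} {K₀ : Set ((s : sg.S) × sg.K s)}

theorem Tm.Agree.eval_eq (hK : ∀ k ∈ K₀, θ.toFun _ (M.const k.1 k.2) = M'.const k.1 k.2)
    {s : sg.S} {t : Tm sg J X s} (ht : t.consts ⊆ K₀) (h : t.Agree θ arr arr' μ μ' ρ ρ') :
    θ.toFun _ (t.eval M arr μ ρ) = t.eval M' arr' μ' ρ' := by
  induction t with
  | const k => exact hK ⟨_, k⟩ (ht rfl)
  | dvar x => exact h
  | app f t ih => simp only [Tm.eval, θ.map_fn]; rw [ih ht h]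
  | read a j => exact h

theorem QF.Agree.holds_iff (hK : ∀ k ∈ K₀, θ.toFun _ (M.const k.1 k.2) = M'.const k.1 k.2)
    {φ : QF sg J X} (hφ : φ.consts ⊆ K₀) (h : φ.Agree θ arr arr' μ μ' ρ ρ') :
    φ.Holds M arr μ ρ ↔ φ.Holds M' arr' μ' ρ' := by
  induction φ with
  | tru => exact Iff.rfl
  | eq t u =>
    have hφ := Set.union_subset_iff.1 hφ
    simp only [QF.Holds]
    rw [← h.1.eval_eq hK hφ.1, ← h.2.eval_eq hK hφ.2, (θ.injective _).eq_iff]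
  | idxEq i j => exact h
  | not φ ih => exact not_congr (ih hφ h)
  | and φ ψ ih ih' =>
    have hφ := Set.union_subset_iff.1 hφ
    exact and_congr (ih hφ.1 h.1) (ih' hφ.2 h.2)

theorem CaseTm.Agree.eval_eq (hK : ∀ k ∈ K₀, θ.toFun _ (M.const k.1 k.2) = M'.const k.1 k.2)
    {s : sg.S} {t : CaseTm sg J X s} (ht : t.consts ⊆ K₀) (h : t.Agree θ arr arr' μ μ' ρ ρ') :
    θ.toFun _ (t.eval M arr μ ρ) = t.eval M' arr' μ' ρ' := by
  induction t with
  | leaf t => exact Tm.Agree.eval_eq hK ht h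
  | ite κ t u ih ih' =>
    simp only [CaseTm.consts, Set.union_subset_iff] at ht
    simp only [CaseTm.eval]
    rw [← ih ht.1.2 h.2.1, ← ih' ht.2 h.2.2]
    by_cases hκ : κ.Holds M arr μ ρ
    · rw [if_pos hκ, if_pos ((h.1.holds_iff hK ht.1.1).1 hκ)]
    · rw [if_neg hκ, if_neg (mt (h.1.holds_iff hK ht.1.1).2 hκ)]

theorem Tm.Agree.of_forall (hr : ∀ a j, θ.toFun _ (arr a (μ _ j)) = arr' a (μ' _ j))
    (hd : ∀ s x, θ.toFun s (ρ s x) = ρ' s x) {s : sg.S} (t : Tm sg J X s) :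
    t.Agree θ arr arr' μ μ' ρ ρ' := by
  induction t with
  | const k => trivial
  | dvar x => exact hd _ x
  | app f t ih => exact ih
  | read a j => exact hr a j

theorem QF.Agree.of_forall (hr : ∀ a j, θ.toFun _ (arr a (μ _ j)) = arr' a (μ' _ j))
    (hd : ∀ s x, θ.toFun s (ρ s x) = ρ' s x) (hi : ∀ e i j, μ e i = μ e j ↔ μ' e i = μ' e j)
    (φ : QF sg J X) : φ.Agree θ arr arr' μ μ' ρ ρ' := by
  induction φ with
  | tru => trivial
  | eq t u => exact ⟨.of_forall hr hd t, .of_forall hr hd u⟩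
  | idxEq i j => exact hi _ i j
  | not φ ih => exact ih
  | and φ ψ ih ih' => exact ⟨ih, ih'⟩

theorem CaseTm.Agree.of_forall (hr : ∀ a j, θ.toFun _ (arr a (μ _ j)) = arr' a (μ' _ j))
    (hd : ∀ s x, θ.toFun s (ρ s x) = ρ' s x) (hi : ∀ e i j, μ e i = μ e j ↔ μ' e i = μ' e j)
    {s : sg.S} (t : CaseTm sg J X s) : t.Agree θ arr arr' μ μ' ρ ρ' := by
  induction t with
  | leaf t => exact Tm.Agree.of_forall hr hd t
  | ite κ t u ih ih' => exact ⟨.of_forall hr hd hi κ, ih, ih'⟩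

theorem QF.Agree.conj {l : List (QF sg J X)} (h : ∀ φ ∈ l, φ.Agree θ arr arr' μ μ' ρ ρ') :
    (QF.conj l).Agree θ arr arr' μ μ' ρ ρ' := by
  induction l with
  | nil => trivial
  | cons φ l ih =>
    rw [List.forall_mem_cons] at h
    exact ⟨h.1, ih h.2⟩

theorem QF.Agree.disj {l : List (QF sg J X)} (h : ∀ φ ∈ l, φ.Agree θ arr arr' μ μ' ρ ρ') :
    (QF.disj l).Agree θ arr arr' μ μ' ρ ρ' := by
  induction l with
  | nil => trivial
  | cons φ l ih =>
    rw [List.forall_mem_cons] at h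
    exact ⟨h.1, ih h.2⟩

theorem QF.Agree.signed {φ : QF sg J X} (b : Bool) (h : φ.Agree θ arr arr' μ μ' ρ ρ') :
    (QF.signed b φ).Agree θ arr arr' μ μ' ρ ρ' := by
  cases b <;> exact h

end Agree

/-! # Translated queries -/

section Queries

variable {D : DataSchema} {C C' : Type} {V : D.Ty → Type}
  {J : Option D.Repo → Type} {X : Option D.Ty → Type} {M M' : DBModel (sig D C)}
  {θ : M.FnEmbedding M'} {idx idx' : Option D.Repo → Type}
  {arr : (a : Comp D C) → idx ((sig D C).asrc a) → M.carrier ((sig D C).atgt a)}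
  {arr' : (a : Comp D C) → idx' ((sig D C).asrc a) → M'.carrier ((sig D C).atgt a)}
  {μ : (e : Option D.Repo) → J e → idx e} {μ' : (e : Option D.Repo) → J e → idx' e}
  {ρ : (s : Option D.Ty) → X s → M.carrier s} {ρ' : (s : Option D.Ty) → X s → M'.carrier s}
  {ι : C' → C} {i : J none} {e : (R : D.Repo) → J (some R)}
  {σ : (s : D.Ty) → V s → Tm (sig D C) J X (some s)}

theorem Term.tr_agree {s : Option D.Ty} {t : Term D C' V s}
    (hv : ∀ v ∈ t.vars, (σ v.1 v.2).Agree θ arr arr' μ μ' ρ ρ')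
    (hc : ∀ x, .inl x ∈ t.caseVars →
      θ.toFun _ (arr (.case x) (μ none i)) = arr' (.case x) (μ' none i))
    (hl : ∀ c, .inr c ∈ t.caseVars →
      θ.toFun _ (arr (.ctrl (ι c)) (μ none i)) = arr' (.ctrl (ι c)) (μ' none i)) :
    (t.tr ι i σ).Agree θ arr arr' μ μ' ρ ρ' := by
  cases t with
  | const d => trivial
  | var v => exact hv ⟨_, v⟩ rfl
  | cvar x => exact hc x rfl
  | life l => trivial
  | ctrl c => exact hl c rfl

theorem Literal.tr_agree {l : Literal D C' V} (hrepo : ¬ l.IsRepo)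
    (hv : ∀ v ∈ l.vars, (σ v.1 v.2).Agree θ arr arr' μ μ' ρ ρ')
    (hc : ∀ x, .inl x ∈ l.caseVars →
      θ.toFun _ (arr (.case x) (μ none i)) = arr' (.case x) (μ' none i))
    (hl : ∀ c, .inr c ∈ l.caseVars →
      θ.toFun _ (arr (.ctrl (ι c)) (μ none i)) = arr' (.ctrl (ι c)) (μ' none i)) :
    (l.tr ι i e σ).Agree θ arr arr' μ μ' ρ ρ' := by
  have key : ∀ t ∈ l.terms, (t.2.tr ι i σ).Agree θ arr arr' μ μ' ρ ρ' := fun t ht =>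
    Term.tr_agree (fun v hv' => hv v ⟨t, ht, hv'⟩) (fun x hx => hc x ⟨t, ht, hx⟩)
      (fun c hx => hl c ⟨t, ht, hx⟩)
  cases l with
  | eq pos t u => exact QF.Agree.signed _ ⟨key ⟨_, t⟩ (.inl rfl), key ⟨_, u⟩ (.inr rfl)⟩
  | cat pos R t u =>
    have ht := key ⟨_, t⟩ (.inl rfl)
    refine QF.Agree.signed _ ⟨⟨ht, trivial⟩, QF.Agree.conj fun φ hφ => ?_⟩
    obtain ⟨k, rfl⟩ := List.mem_ofFn.1 hφ
    exact ⟨key ⟨_, u k⟩ (.inr ⟨k, rfl⟩), ht⟩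
  | repo pos R u => exact (hrepo trivial).elim

theorem CQ.holds_tr {em : ℕ → (R : D.Repo) → J (some R)} {Q : CQ D C' V} :
    (CQ.tr ι i em σ Q).Holds M arr μ ρ ↔
      ∀ l m, (l, m) ∈ Q.zipIdx → (l.tr ι i (em m) σ).Holds M arr μ ρ := by
  simp only [CQ.tr, QF.holds_conj, List.forall_mem_map, Prod.forall]

theorem CQ.consts_tr_subset {em : ℕ → (R : D.Repo) → J (some R)} {Q : CQ D C' V}
    {K₀ : Set ((s : (sig D C).S) × (sig D C).K s)} :
    (CQ.tr ι i em σ Q).consts ⊆ K₀ ↔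
      ∀ l m, (l, m) ∈ Q.zipIdx → (l.tr ι i (em m) σ).consts ⊆ K₀ := by
  refine QF.consts_conj_subset.trans ?_
  rw [List.forall_mem_map, Prod.forall]

theorem Literal.holds_repo {R : D.Repo}
    {u : (k : Fin (D.repoArity R)) → Term D C' V (some (D.repoAttr R k))} :
    (Literal.tr ι i e σ (.repo true R u)).Holds M arr μ ρ ↔
      ∀ k, arr (.repo R k) (μ _ (e R)) = ((u k).tr ι i σ).eval M arr μ ρ := by
  simp only [Literal.tr, QF.signed, QF.holds_conj, List.forall_mem_ofFn_iff, QF.Holds, Tm.eval]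

theorem Literal.consts_repo_subset {R : D.Repo}
    {u : (k : Fin (D.repoArity R)) → Term D C' V (some (D.repoAttr R k))}
    {K₀ : Set ((s : (sig D C).S) × (sig D C).K s)} :
    (Literal.tr (X := X) ι i e σ (.repo true R u)).consts ⊆ K₀ ↔
      ∀ k, ((u k).tr ι i σ).consts ⊆ K₀ := by
  refine QF.consts_conj_subset.trans ?_
  rw [List.forall_mem_ofFn_iff]
  exact forall_congr' fun k => by simp only [QF.consts, Tm.consts, Set.empty_union]

theorem Cond.tr_agree {φ : Cond D}
    (hc : ∀ x, .inl x ∈ φ.caseVars →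
      θ.toFun _ (arr (.case x) (μ none i)) = arr' (.case x) (μ' none i)) :
    (φ.tr i).Agree θ arr arr' μ μ' ρ ρ' := by
  induction φ with
  | eq t u =>
    exact ⟨Term.tr_agree (fun v _ => v.2.elim) (fun x hx => hc x (.inl hx)) fun c => c.elim,
      Term.tr_agree (fun v _ => v.2.elim) (fun x hx => hc x (.inr hx)) fun c => c.elim⟩
  | not φ ih => exact ih hc
  | and φ ψ ih ih' =>
    exact ⟨ih fun x hx => hc x (.inl hx), ih' fun x hx => hc x (.inr hx)⟩

end Queries

/-! # The transitions of rules -/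

/-- Relational artifact systems over the signature of a data schema, with rigid array `self`. -/
abbrev schemaRAS (D : DataSchema) (C : Type) (init : (a : Comp D C) → (sig D C).K ((sig D C).atgt a))
    (trans : List (Transition (sig D C))) : RAS :=
  ⟨sig D C, {.case D.self}, init, trans⟩

section Result

variable {D : DataSchema} {C : Type} {init : (a : Comp D C) → (sig D C).K ((sig D C).atgt a)}
  {trans : List (Transition (sig D C))} {sem : InsertionSemantics} (r : Rule D C)
  (c : (schemaRAS D C init trans).Config) (μ : (e : Option D.Repo) → RIdx → c.idx e)
  (ρ : (s : Option D.Ty) → ℕ → c.M.carrier s)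

/-- The value of an expression of an effect. -/
def Val.den {D : DataSchema} {C : Type} (M : DBModel (sig D C))
    (ρ : (s : Option D.Ty) → ℕ → M.carrier s) {s : D.Ty} : Val D s → M.carrier (some s)
  | .const d => M.const (some s) d
  | .var n => ρ (some s) n

theorem Val.tr_eval {D : DataSchema} {C : Type} {M : DBModel (sig D C)} {idx : Option D.Repo → Type}
    {arr : (a : Comp D C) → idx ((sig D C).asrc a) → M.carrier ((sig D C).atgt a)}
    {J : Option D.Repo → Type} {μ : (e : Option D.Repo) → J e → idx e}
    {ρ : (s : Option D.Ty) → ℕ → M.carrier s} {s : D.Ty} (v : Val D s) :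
    v.tr.eval M arr μ ρ = v.den M ρ := by
  cases v <;> rfl

theorem result_case_none {z : D.CVar} (h : r.eff.setPart z = none) (j : c.idx none) :
    (r.toTransition sem).result c μ ρ (.case z) j = c.arr (.case z) j := by
  simp only [Transition.result, Rule.toTransition]
  rw [h]
  rfl

theorem result_case_of_ne (z : D.CVar) {j : c.idx none} (hj : j ≠ μ none .case) :
    (r.toTransition sem).result c μ ρ (.case z) j = c.arr (.case z) j := by
  simp only [Transition.result, Rule.toTransition]
  cases r.eff.setPart z with
  | none => rfl
  | some v => exact if_neg hj

theorem result_case_some {z : D.CVar} {v : Val D (D.cvarTy z)} (h : r.eff.setPart z = some v) :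
    (r.toTransition sem).result c μ ρ (.case z) (μ none .case) = v.den c.M ρ := by
  simp only [Transition.result, Rule.toTransition]
  rw [h]
  exact (if_pos rfl).trans (Val.tr_eval v)

theorem result_ctrl_none {z : C} (h : r.upd z = none) (j : c.idx none) :
    (r.toTransition sem).result c μ ρ (.ctrl z) j = c.arr (.ctrl z) j := by
  simp only [Transition.result, Rule.toTransition]
  rw [h]
  rfl

theorem result_ctrl_of_ne (z : C) {j : c.idx none} (hj : j ≠ μ none .case) :
    (r.toTransition sem).result c μ ρ (.ctrl z) j = c.arr (.ctrl z) j := by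
  simp only [Transition.result, Rule.toTransition]
  cases r.upd z with
  | none => rfl
  | some v => exact if_neg hj

theorem result_ctrl_some {z : C} {l : Lifecycle} (h : r.upd z = some l) :
    (r.toTransition sem).result c μ ρ (.ctrl z) (μ none .case) = c.M.const none l := by
  simp only [Transition.result, Rule.toTransition]
  rw [h]
  exact if_pos rfl

theorem result_repo_set {sp : SetPart D} (h : r.eff = .set sp) (R : D.Repo)
    (k : Fin (D.repoArity R)) (j : c.idx (some R)) :
    (r.toTransition sem).result c μ ρ (.repo R k) j = c.arr (.repo R k) j := by
  simp only [Transition.result, Rule.toTransition, h]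
  rfl

theorem result_repo_insert_keep {R₀ : D.Repo} {u} {sp : SetPart D} (h : r.eff = .insertSet R₀ u sp)
    {R : D.Repo} (k : Fin (D.repoArity R)) {j : c.idx (some R)}
    (hj : R₀ = R → j ≠ μ (some R) .main) :
    (r.toTransition .multiset).result c μ ρ (.repo R k) j = c.arr (.repo R k) j := by
  simp only [Transition.result, Rule.toTransition, h, Effect.repoUpdate]
  by_cases hR : R₀ = R
  · rw [dif_pos hR]
    exact if_neg (hj hR)
  · rw [dif_neg hR]
    rfl

theorem result_repo_insert {R : D.Repo} {u} {sp : SetPart D} (h : r.eff = .insertSet R u sp)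
    (k : Fin (D.repoArity R)) :
    (r.toTransition .multiset).result c μ ρ (.repo R k) (μ (some R) .main) =
      (u k).den c.M ρ := by
  simp only [Transition.result, Rule.toTransition, h, Effect.repoUpdate]
  rw [dif_pos trivial]
  exact (if_pos rfl).trans (Val.tr_eval (u k))

theorem result_repo_delete_keep {R₀ : D.Repo} {u} {sp : SetPart D} (h : r.eff = .deleteSet R₀ u sp)
    {R : D.Repo} (k : Fin (D.repoArity R)) {j : c.idx (some R)}
    (hj : R₀ = R → j ≠ μ (some R) .main) :
    (r.toTransition sem).result c μ ρ (.repo R k) j = c.arr (.repo R k) j := by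
  simp only [Transition.result, Rule.toTransition, h, Effect.repoUpdate]
  by_cases hR : R₀ = R
  · rw [if_pos hR]
    exact if_neg (hj hR)
  · rw [if_neg hR]
    rfl

theorem result_repo_delete {R : D.Repo} {u} {sp : SetPart D} (h : r.eff = .deleteSet R u sp)
    (k : Fin (D.repoArity R)) :
    (r.toTransition sem).result c μ ρ (.repo R k) (μ (some R) .main) =
      c.M.const (some (D.repoAttr R k)) (D.undef (D.repoAttr R k)) := by
  simp only [Transition.result, Rule.toTransition, h, Effect.repoUpdate]
  rw [if_pos trivial]
  exact if_pos rfl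

theorem result_repo_cond_keep {R₀ : D.Repo} {ψ η₁ η₂} (h : r.eff = .condUpdate R₀ ψ η₁ η₂)
    {R : D.Repo} (hR : R₀ ≠ R) (k : Fin (D.repoArity R)) (j : c.idx (some R)) :
    (r.toTransition sem).result c μ ρ (.repo R k) j = c.arr (.repo R k) j := by
  simp only [Transition.result, Rule.toTransition, h, Effect.repoUpdate]
  rw [dif_neg hR]
  rfl

theorem result_repo_cond {R : D.Repo} {ψ η₁ η₂} (h : r.eff = .condUpdate R ψ η₁ η₂)
    (k : Fin (D.repoArity R)) (j : c.idx (some R)) :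
    (r.toTransition sem).result c μ ρ (.repo R k) j =
      ((Branch.ite ψ η₁ η₂).tr k).eval c.M c.arr (ITm.eval μ j) ρ := by
  simp only [Transition.result, Rule.toTransition, h, Effect.repoUpdate]
  rw [dif_pos trivial]

end Result

section Effects

variable {D : DataSchema} {C : Type} {K₀ : Set ((s : (sig D C).S) × (sig D C).K s)}

theorem Val.den_map {M M' : DBModel (sig D C)} {θ : M.FnEmbedding M'}
    {ρ : (s : Option D.Ty) → ℕ → M.carrier s} {ρ' : (s : Option D.Ty) → ℕ → M'.carrier s}
    {s : D.Ty} {v : Val D s}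
    (hc : ∀ d, v = .const d → θ.toFun (some s) (M.const (some s) d) = M'.const (some s) d)
    (hv : ∀ w ∈ v.vars, θ.toFun (some w.1) (ρ (some w.1) w.2) = ρ' (some w.1) w.2) :
    θ.toFun (some s) (v.den M ρ) = v.den M' ρ' := by
  cases v with
  | const d => exact hc d rfl
  | var n => exact hv ⟨s, n⟩ rfl

variable {r : Rule D C}

theorem Rule.setPart_const_mem {sem : InsertionSemantics} {z : D.CVar} {d : D.Dom (D.cvarTy z)}
    (h : r.eff.setPart z = some (.const d)) :
    ⟨some (D.cvarTy z), d⟩ ∈ (r.toTransition (C := C) sem).consts := by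
  refine .inr (Set.mem_iUnion.2 ⟨.case z, ?_⟩)
  simp only [Rule.toTransition]
  rw [h]
  exact .inl (.inr rfl)

theorem Rule.upd_const_mem {sem : InsertionSemantics} {z : C} {l : Lifecycle}
    (h : r.upd z = some l) : ⟨none, l⟩ ∈ (r.toTransition sem).consts := by
  refine .inr (Set.mem_iUnion.2 ⟨.ctrl z, ?_⟩)
  simp only [Rule.toTransition]
  rw [h]
  exact .inl (.inr rfl)

theorem Rule.insert_const_mem {R : D.Repo} {u} {sp : SetPart D} (h : r.eff = .insertSet R u sp)
    {k : Fin (D.repoArity R)} {d} (hk : u k = .const d) :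
    ⟨some (D.repoAttr R k), d⟩ ∈ (r.toTransition (C := C) .multiset).consts := by
  refine .inr (Set.mem_iUnion.2 ⟨.repo R k, ?_⟩)
  simp only [Rule.toTransition, h, Effect.repoUpdate]
  rw [dif_pos trivial, hk]
  exact .inl (.inr rfl)

theorem Rule.delete_undef_mem {sem : InsertionSemantics} {R : D.Repo} {u} {sp : SetPart D}
    (h : r.eff = .deleteSet R u sp) (k : Fin (D.repoArity R)) :
    ⟨some (D.repoAttr R k), D.undef (D.repoAttr R k)⟩ ∈
      (r.toTransition (C := C) sem).consts := by
  refine .inr (Set.mem_iUnion.2 ⟨.repo R k, ?_⟩)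
  simp only [Rule.toTransition, h, Effect.repoUpdate]
  rw [if_pos trivial]
  exact .inl (.inr rfl)

theorem Rule.guardPart_consts {sem : InsertionSemantics}
    (hK : (r.toTransition (C := C) sem).consts ⊆ K₀) :
    (r.eff.guardPart (C := C)).consts ⊆ K₀ := by
  have h := QF.consts_conj_subset.1 (Set.union_subset_iff.1 hK).1
  exact h _ (.tail _ (.tail _ (.tail _ (.head _))))

theorem Rule.insert_undef_mem {sem : InsertionSemantics}
    (hK : (r.toTransition (C := C) sem).consts ⊆ K₀) {R : D.Repo} {u} {sp : SetPart D}
    (h : r.eff = .insertSet R u sp) (k : Fin (D.repoArity R)) :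
    ⟨some (D.repoAttr R k), D.undef (D.repoAttr R k)⟩ ∈ K₀ := by
  have hg := Rule.guardPart_consts hK
  rw [h] at hg
  exact QF.consts_conj_subset.1 hg _ (List.mem_ofFn.2 ⟨k, rfl⟩) (.inr rfl)

theorem Rule.delete_const_mem {sem : InsertionSemantics}
    (hK : (r.toTransition (C := C) sem).consts ⊆ K₀) {R : D.Repo} {u} {sp : SetPart D}
    (h : r.eff = .deleteSet R u sp) {k : Fin (D.repoArity R)} {d} (hk : u k = .const d) :
    ⟨some (D.repoAttr R k), d⟩ ∈ K₀ := by
  have hg := Rule.guardPart_consts hK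
  rw [h] at hg
  refine QF.consts_conj_subset.1 hg _ (List.mem_ofFn.2 ⟨k, rfl⟩) (.inr ?_)
  rw [hk]
  rfl

end Effects

section Branches

variable {D : DataSchema} {C : Type} {M M' : DBModel (sig D C)}
  {θ : M.FnEmbedding M'} {idx idx' : Option D.Repo → Type}
  {arr : (a : Comp D C) → idx ((sig D C).asrc a) → M.carrier ((sig D C).atgt a)}
  {arr' : (a : Comp D C) → idx' ((sig D C).asrc a) → M'.carrier ((sig D C).atgt a)}
  {μ : (e : Option D.Repo) → RIdx → idx e} {μ' : (e : Option D.Repo) → RIdx → idx' e}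
  {ρ : (s : Option D.Ty) → ℕ → M.carrier s} {ρ' : (s : Option D.Ty) → ℕ → M'.carrier s}
  {R : D.Repo} {j : idx (some R)} {j' : idx' (some R)}

theorem FVar.tr_agree (hread : ∀ k, θ.toFun _ (arr (.repo R k) j) = arr' (.repo R k) j')
    {s : D.Ty} {v : FVar D R s} (hv : v.ansVars = ∅) :
    (v.tr (C := C) (J := ITm (RI D) (some R)) .lam).Agree θ arr arr'
      (ITm.eval μ j) (ITm.eval μ' j') ρ ρ' := by
  cases v with
  | ans n => exact absurd hv (Set.singleton_ne_empty _)
  | new k => exact hread k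

theorem Filt.tr_agree (hread : ∀ k, θ.toFun _ (arr (.repo R k) j) = arr' (.repo R k) j')
    {ψ : Filt D R} (hrepo : Filt.RepoFree ψ) (hans : Filt.ansVars ψ = ∅)
    (hcase : Filt.caseVars ψ = ∅) :
    (Filt.tr (C := C) ψ).Agree θ arr arr' (ITm.eval μ j) (ITm.eval μ' j') ρ ρ' := by
  refine QF.Agree.disj ?_
  rw [List.forall_mem_map]
  intro Q hQ
  refine QF.Agree.conj ?_
  rw [List.forall_mem_map]
  rintro ⟨l, m⟩ hl
  have hl := (List.mem_zipIdx_iff_getElem?.1 hl : _)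
  have hl := List.mem_of_getElem? hl
  refine Literal.tr_agree (hrepo Q hQ l hl) (fun v hv => ?_) (fun z hz => ?_) (fun c => c.elim)
  · refine FVar.tr_agree hread (Set.eq_empty_iff_forall_notMem.2 fun w hw => ?_)
    exact (Set.eq_empty_iff_forall_notMem.1 hans w) ⟨Q, hQ, v, ⟨l, hl, hv⟩, hw⟩
  · exact (Set.eq_empty_iff_forall_notMem.1 hcase _ ⟨Q, hQ, l, hl, hz⟩).elim

theorem Branch.tr_agree (hread : ∀ k, θ.toFun _ (arr (.repo R k) j) = arr' (.repo R k) j')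
    {η : Branch D R} (hrepo : η.RepoFree) (hans : η.ansVars = ∅) (hcase : η.caseVars = ∅)
    (k : Fin (D.repoArity R)) :
    (η.tr (C := C) k).Agree θ arr arr' (ITm.eval μ j) (ITm.eval μ' j') ρ ρ' := by
  induction η with
  | tuple u =>
    simp only [Branch.tr, CaseTm.Agree]
    cases huk : u k with
    | inl d => trivial
    | inr v =>
      refine FVar.tr_agree hread (Set.eq_empty_iff_forall_notMem.2 fun w hw => ?_)
      exact Set.eq_empty_iff_forall_notMem.1 hans w ⟨k, v, huk, hw⟩
  | ite ψ η₁ η₂ ih₁ ih₂ =>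
    simp only [Branch.ansVars, Branch.caseVars, Set.union_empty_iff] at hans hcase
    exact ⟨Filt.tr_agree hread hrepo.1 hans.1.1 hcase.1.1,
      ih₁ hrepo.2.1 hans.1.2 hcase.1.2, ih₂ hrepo.2.2 hans.2 hcase.2⟩

end Branches

/-- The map that is `θ₁` on lifecycle states and `θ₂` on data. -/
def DBModel.FnEmbedding.merge {D : DataSchema} {C : Type} {M N : DBModel (sig D C)}
    (θ₁ θ₂ : M.FnEmbedding N) : M.FnEmbedding N where
  toFun := fun
    | none => θ₁.toFun none
    | some s => θ₂.toFun (some s)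
  injective := fun
    | none => θ₁.injective none
    | some s => θ₂.injective (some s)
  map_fn := θ₂.map_fn

section Step

variable {D : DataSchema} {C : Type} {init : (a : Comp D C) → (sig D C).K ((sig D C).atgt a)}
  {trans : List (Transition (sig D C))} {n : ℕ}
  {K₀ : Set ((s : (sig D C).S) × (sig D C).K s)}

/-- The order is preserved by a rule, fired in both configurations with the same case index and
main index, such that the data used by the effect are respected by `θ₂`. -/
theorem Rule.le_after {x y : (schemaRAS D C init trans).Pointed (.case D.self) n}
    {f : (e : Option D.Repo) → x.1.idx e → y.1.idx e} (hle : x.Le K₀ y f)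
    (hKu : UndefClosed (sig D C) K₀) (r : Rule D C)
    (hK : (r.toTransition (C := C) .multiset).consts ⊆ K₀) (hself : r.eff.setPart D.self = none)
    {P : DBModel (sig D C)} (hP : P.IsModelOfT) (ε : y.1.M.Embedding P)
    {θ₁ θ₂ : x.1.M.FnEmbedding P}
    {μ : (e : Option D.Repo) → RIdx → x.1.idx e} {ρ : (s : Option D.Ty) → ℕ → x.1.M.carrier s}
    {μ' : (e : Option D.Repo) → RIdx → y.1.idx e} {ρ' : (s : Option D.Ty) → ℕ → P.carrier s}
    (h₁ : Glues x y K₀ ε θ₁ none (μ none .case) (f none (μ none .case)))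
    (h₂ : RespectsParams x y K₀ θ₂ ε.toFn)
    (hμ : μ' none .case = f none (μ none .case))
    (hμm : ∀ R, μ' (some R) .main = f (some R) (μ (some R) .main))
    (heff : ∀ v ∈ r.eff.vars, θ₂.toFun (some v.1) (ρ (some v.1) v.2) = ρ' (some v.1) v.2)
    (hkeep : ∀ z, z ≠ D.self → r.eff.setPart z = none →
      θ₂.toFun _ (x.1.arr (.case z) (μ none .case)) =
        ε.toFun _ (y.1.arr (.case z) (f none (μ none .case))))
    (hcond : r.eff.IsCondUpdate →
      r.eff.FiltersRepoFree ∧ r.eff.vars = ∅ ∧ r.eff.caseVars = ∅)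
    (hx : ∀ a ∈ (schemaRAS D C init trans).rigid,
      Function.Injective ((r.toTransition .multiset).result x.1 μ ρ a)) :
    ∃ hy, RAS.Pointed.Le (S := schemaRAS D C init trans) (a₀ := .case D.self) K₀
      ⟨x.1.after (r.toTransition .multiset) μ ρ hx, x.2⟩
      ⟨(y.1.extend P hP ε).after (r.toTransition .multiset) μ' ρ' hy, y.2⟩ f := by
  have hy : ∀ a ∈ (schemaRAS D C init trans).rigid,
      Function.Injective ((r.toTransition .multiset).result (y.1.extend P hP ε) μ' ρ' a) := by
    rintro a rfl j j' h
    rw [result_case_none r (y.1.extend P hP ε) μ' ρ' hself,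
      result_case_none r (y.1.extend P hP ε) μ' ρ' hself] at h
    exact (y.1.extend P hP ε).rigid_injective _ rfl h
  refine ⟨hy, hle.injective, hle.point, ?_⟩
  have hPx : ∀ j, (r.toTransition .multiset).result x.1 μ ρ (.case D.self) j =
      x.1.arr (.case D.self) j := fun j => result_case_none r x.1 μ ρ hself j
  have hPy : ∀ j, (r.toTransition .multiset).result (y.1.extend P hP ε) μ' ρ' (.case D.self) j =
      ε.toFun _ (y.1.arr (.case D.self) j) :=
    fun j => result_case_none r (y.1.extend P hP ε) μ' ρ' hself j
  have unchanged : ∀ (s : Option D.Repo) (j : x.1.idx s),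
      (∀ a (ha : (sig D C).asrc a = s), a ≠ .case D.self →
        (r.toTransition .multiset).result x.1 μ ρ a (cast (congrArg x.1.idx ha.symm) j) =
          x.1.arr a (cast (congrArg x.1.idx ha.symm) j)) →
      (∀ a (ha : (sig D C).asrc a = s), a ≠ .case D.self →
        (r.toTransition .multiset).result (y.1.extend P hP ε) μ' ρ' a
          (cast (congrArg y.1.idx ha.symm) (f s j)) =
          ε.toFun _ (y.1.arr a (cast (congrArg y.1.idx ha.symm) (f s j)))) →
      SameType (RAS.Pointed.val (S := schemaRAS D C init trans) (a₀ := .case D.self) K₀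
          ⟨x.1.after (r.toTransition .multiset) μ ρ hx, x.2⟩ s j)
        (RAS.Pointed.val (S := schemaRAS D C init trans) (a₀ := .case D.self) K₀
          ⟨(y.1.extend P hP ε).after (r.toTransition .multiset) μ' ρ' hy, y.2⟩ s (f s j)) := by
    intro s j h h'
    refine SameType.trans (w := x.val K₀ s j)
      (SameType.of_map (DBModel.Embedding.refl x.1.M).toFn ?_)
      ((hle.same s j).trans (SameType.of_map ε.toFn ?_))
    · rintro (k | i | ⟨a, ha, ha'⟩)
      · rfl
      · exact hPx _
      · exact h a ha ha'
    · rintro (k | i | ⟨a, ha, ha'⟩)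
      · exact ε.map_const _ _
      · exact (hPy _).symm
      · exact (h' a ha ha').symm
  have changed : ∀ (s : Option D.Repo) (j : x.1.idx s) (P' : DBModel (sig D C))
      (e : P.Embedding P') (θ : x.1.M.FnEmbedding P'),
      RespectsParams x y K₀ θ (e.comp ε).toFn →
      (∀ a (ha : (sig D C).asrc a = s), a ≠ .case D.self →
        θ.toFun _ ((r.toTransition .multiset).result x.1 μ ρ a
          (cast (congrArg x.1.idx ha.symm) j)) =
        e.toFun _ ((r.toTransition .multiset).result (y.1.extend P hP ε) μ' ρ' a
          (cast (congrArg y.1.idx ha.symm) (f s j)))) →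
      SameType (RAS.Pointed.val (S := schemaRAS D C init trans) (a₀ := .case D.self) K₀
          ⟨x.1.after (r.toTransition .multiset) μ ρ hx, x.2⟩ s j)
        (RAS.Pointed.val (S := schemaRAS D C init trans) (a₀ := .case D.self) K₀
          ⟨(y.1.extend P hP ε).after (r.toTransition .multiset) μ' ρ' hy, y.2⟩ s (f s j)) := by
    intro s j P' e θ hθ h
    refine sameType_of_respects (S := schemaRAS D C init trans) (a₀ := .case D.self)
      (x := ⟨x.1.after (r.toTransition .multiset) μ ρ hx, x.2⟩)
      (y := ⟨(y.1.extend P hP ε).after (r.toTransition .multiset) μ' ρ' hy, y.2⟩) θ e.toFn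
      ⟨fun k hk => ?_, fun i => ?_⟩ h
    · refine (hθ.const k hk).trans ?_
      exact congrArg (e.toFun _) (ε.map_const _ _)
    · refine (congrArg (θ.toFun _) (hPx _)).trans ((hθ.point i).trans ?_)
      exact congrArg (e.toFun _) (hPy _).symm
  have hconst : ∀ k ∈ K₀, θ₂.toFun _ (x.1.M.const k.1 k.2) = P.const k.1 k.2 := fun k hk =>
    (h₂.const k hk).trans (ε.map_const _ _)
  rintro (_ | R) j
  · by_cases hj : j = μ none .case
    · subst hj
      refine changed none _ P (.refl P) (θ₁.merge θ₂) ⟨?_, h₂.point⟩ ?_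
      · rintro ⟨_ | s, k⟩ hk
        · exact h₁.const _ hk
        · exact h₂.const _ hk
      · rintro (z | z | ⟨R, k⟩) ha hne
        · have hz : z ≠ D.self := fun h => hne (congrArg _ h)
          show θ₂.toFun _ ((r.toTransition .multiset).result x.1 μ ρ (.case z) (μ none .case)) =
            (r.toTransition .multiset).result (y.1.extend P hP ε) μ' ρ' (.case z)
              (f none (μ none .case))
          cases hset : r.eff.setPart z with
          | none =>
            exact (congrArg (θ₂.toFun _) (result_case_none r x.1 μ ρ hset _)).trans
              ((hkeep z hz hset).trans
                (result_case_none r (y.1.extend P hP ε) μ' ρ' hset _).symm)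
          | some v =>
            rw [← hμ]
            refine (congrArg (θ₂.toFun _) (result_case_some r x.1 μ ρ hset)).trans
              (Eq.trans ?_ (result_case_some r (y.1.extend P hP ε) μ' ρ' hset).symm)
            refine Val.den_map (fun d hd => hconst ⟨some (D.cvarTy z), d⟩ (hK ?_)) fun w hw =>
              heff w (.inl ⟨z, v, hset, hw⟩)
            subst hd
            exact Rule.setPart_const_mem hset
        · show θ₁.toFun _ ((r.toTransition .multiset).result x.1 μ ρ (.ctrl z) (μ none .case)) =
            (r.toTransition .multiset).result (y.1.extend P hP ε) μ' ρ' (.ctrl z)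
              (f none (μ none .case))
          cases hset : r.upd z with
          | none =>
            exact (congrArg (θ₁.toFun _) (result_ctrl_none r x.1 μ ρ hset _)).trans
              ((h₁.arr (.ctrl z) rfl hne).trans
                (result_ctrl_none r (y.1.extend P hP ε) μ' ρ' hset _).symm)
          | some l =>
            rw [← hμ]
            refine (congrArg (θ₁.toFun _) (result_ctrl_some r x.1 μ ρ hset)).trans
              (Eq.trans ?_ (result_ctrl_some r (y.1.extend P hP ε) μ' ρ' hset).symm)
            exact (h₁.const ⟨none, l⟩ (hK (Rule.upd_const_mem hset))).trans (ε.map_const _ _)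
        · cases ha
    · have hj' : f none j ≠ μ' none .case := fun h => hj (hle.injective _ (h.trans hμ))
      refine unchanged none j ?_ ?_
      · rintro (z | z | ⟨R, k⟩) ha hne
        · exact result_case_of_ne r x.1 μ ρ z hj
        · exact result_ctrl_of_ne r x.1 μ ρ z hj
        · cases ha
      · rintro (z | z | ⟨R, k⟩) ha hne
        · exact result_case_of_ne r (y.1.extend P hP ε) μ' ρ' z hj'
        · exact result_ctrl_of_ne r (y.1.extend P hP ε) μ' ρ' z hj'
        · cases ha
  · have unchanged' : (∀ k, (r.toTransition .multiset).result x.1 μ ρ (.repo R k) j =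
          x.1.arr (.repo R k) j) →
        (∀ k, (r.toTransition .multiset).result (y.1.extend P hP ε) μ' ρ' (.repo R k)
          (f (some R) j) = ε.toFun _ (y.1.arr (.repo R k) (f (some R) j))) → _ := fun h h' =>
      unchanged (some R) j
        (by
          rintro (z | z | ⟨R', k⟩) ha hne
          · cases ha
          · cases ha
          · cases ha
            exact h k)
        (by
          rintro (z | z | ⟨R', k⟩) ha hne
          · cases ha
          · cases ha
          · cases ha
            exact h' k)
    have changed' : ∀ (P' : DBModel (sig D C))
        (e : P.Embedding P') (θ : x.1.M.FnEmbedding P'),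
        RespectsParams x y K₀ θ (e.comp ε).toFn →
        (∀ k, θ.toFun _ ((r.toTransition .multiset).result x.1 μ ρ (.repo R k) j) =
          e.toFun _ ((r.toTransition .multiset).result (y.1.extend P hP ε) μ' ρ' (.repo R k)
            (f (some R) j))) → _ := fun P' e θ hθ h =>
      changed (some R) j P' e θ hθ (by
          rintro (z | z | ⟨R', k⟩) ha hne
          · cases ha
          · cases ha
          · cases ha
            exact h k)
    cases heq : r.eff with
    | set sp =>
      exact unchanged' (fun k => result_repo_set r x.1 μ ρ heq R k j)
        (fun k => result_repo_set r (y.1.extend P hP ε) μ' ρ' heq R k _)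
    | insertSet R₀ u sp =>
      by_cases hj : R₀ = R ∧ j = μ (some R) .main
      · obtain ⟨rfl, rfl⟩ := hj
        refine changed' P (.refl P) θ₂ h₂ fun k => ?_
        rw [← hμm]
        refine (congrArg (θ₂.toFun _) (result_repo_insert r x.1 μ ρ heq k)).trans
          (Eq.trans ?_ (result_repo_insert r (y.1.extend P hP ε) μ' ρ' heq k).symm)
        refine Val.den_map (fun d hd => hconst ⟨some (D.repoAttr R₀ k), d⟩
          (hK (Rule.insert_const_mem heq hd))) fun w hw => heff w ?_
        rw [heq]
        exact .inr ⟨k, hw⟩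
      · refine unchanged' (fun k => result_repo_insert_keep r x.1 μ ρ heq k fun h h' => hj ⟨h, h'⟩)
          (fun k => result_repo_insert_keep r (y.1.extend P hP ε) μ' ρ' heq k fun h h' => hj ⟨h, ?_⟩)
        exact hle.injective _ (h'.trans (hμm R))
    | deleteSet R₀ u sp =>
      by_cases hj : R₀ = R ∧ j = μ (some R) .main
      · obtain ⟨rfl, rfl⟩ := hj
        refine changed' P (.refl P) θ₂ h₂ fun k => ?_
        rw [← hμm]
        refine (congrArg (θ₂.toFun _) (result_repo_delete r x.1 μ ρ heq k)).trans
          (Eq.trans ?_ (result_repo_delete r (y.1.extend P hP ε) μ' ρ' heq k).symm)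
        exact hconst ⟨some (D.repoAttr R₀ k), _⟩ (hK (Rule.delete_undef_mem heq k))
      · refine unchanged' (fun k => result_repo_delete_keep r x.1 μ ρ heq k fun h h' => hj ⟨h, h'⟩)
          (fun k => result_repo_delete_keep r (y.1.extend P hP ε) μ' ρ' heq k fun h h' => hj ⟨h, ?_⟩)
        exact hle.injective _ (h'.trans (hμm R))
    | condUpdate R₀ ψ η₁ η₂ =>
      by_cases hR : R₀ = R
      · subst hR
        obtain ⟨hrepo, hans, hcase⟩ := hcond (by rw [heq]; trivial)
        rw [heq] at hrepo hans hcase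
        replace hans := (Set.union_empty_iff.1 hans).2
        replace hcase := (Set.union_empty_iff.1 hcase).2
        obtain ⟨P', hP', e, θ, hθ⟩ := exists_glues hKu (hle.same (some R₀) j) hP ε
        refine changed' P' e θ hθ.toRespectsParams fun k => ?_
        have hcs : ((Branch.ite ψ η₁ η₂).tr (C := C) k).consts ⊆ K₀ := by
          refine Set.Subset.trans ?_ hK
          refine fun c hc => .inr (Set.mem_iUnion.2 ⟨.repo R₀ k, ?_⟩)
          simp only [Rule.toTransition, heq, Effect.repoUpdate]
          rw [dif_pos trivial]
          exact hc
        refine (congrArg (θ.toFun _) (result_repo_cond r x.1 μ ρ heq k _)).trans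
          (Eq.trans ?_ (congrArg (e.toFun _)
            (result_repo_cond r (y.1.extend P hP ε) μ' ρ' heq k _).symm))
        have e₁ := (Branch.tr_agree (C := C) (θ := θ) (arr := x.1.arr)
          (arr' := fun a i => (e.comp ε).toFun _ (y.1.arr a i)) (μ := μ) (μ' := μ') (ρ := ρ)
          (ρ' := fun s i => e.toFun s (ρ' s i)) (j := j) (j' := f (some R₀) j)
          (fun k => hθ.arr (.repo R₀ k) rfl (by simp)) hrepo hans hcase k).eval_eq (K₀ := K₀)
          (fun k hk => (hθ.const k hk).trans ((e.comp ε).map_const _ _)) hcs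
        have e₂ := (CaseTm.Agree.of_forall (θ := e.toFn) (arr := (y.1.extend P hP ε).arr)
          (arr' := fun a i => (e.comp ε).toFun _ (y.1.arr a i)) (μ := ITm.eval μ' (f (some R₀) j))
          (μ' := ITm.eval μ' (f (some R₀) j)) (ρ := ρ')
          (ρ' := fun s i => e.toFun s (ρ' s i)) (fun _ _ => rfl) (fun _ _ => rfl)
          (fun _ _ _ => Iff.rfl) ((Branch.ite ψ η₁ η₂).tr (C := C) k)).eval_eq (K₀ := K₀)
          (fun k hk => e.map_const _ _) hcs
        exact e₁.trans e₂.symm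
      · exact unchanged' (fun k => result_repo_cond_keep r x.1 μ ρ heq hR k j)
          (fun k => result_repo_cond_keep r (y.1.extend P hP ε) μ' ρ' heq hR k _)

end Step

/-- The rules whose preconditions and effects do not join the data of different indexes. -/
structure Rule.Tame {D : DataSchema} {C : Type} (r : Rule D C) : Prop where
  self_not_set : r.eff.setPart D.self = none
  cond_self : ∀ φ ∈ r.cond, .inl D.self ∉ φ.caseVars
  pre_self : .inl D.self ∉ CQ.caseVars r.pre
  condUpdate : r.eff.IsCondUpdate →
    r.eff.FiltersRepoFree ∧ r.eff.vars = ∅ ∧ r.eff.caseVars = ∅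
  joins : (CQ.RepoFree r.pre ∧ ¬ r.eff.IsDelete) ∨
    ∃ χ p ξ, SepSplit r.pre χ p ξ ∧ Disjoint r.eff.vars (CQ.vars χ) ∧
      ((∀ z, r.eff.setPart z = none) ∧ r.eff.vars = ∅ ∨
        ∀ z, z ≠ D.self → (r.eff.setPart z).isSome) ∧
      ∀ R w sp, r.eff = .deleteSet R w sp → (∀ k, (w k).vars = ∅) ∨ p = none ∨
        p = some ⟨R, fun k => (w k).toTerm Empty⟩

section Monotone

variable {D : DataSchema} {C : Type} {init : (a : Comp D C) → (sig D C).K ((sig D C).atgt a)}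
  {trans : List (Transition (sig D C))} {n : ℕ}
  {K₀ : Set ((s : (sig D C).S) × (sig D C).K s)}
  {x y : (schemaRAS D C init trans).Pointed (.case D.self) n}
  {f : (e : Option D.Repo) → x.1.idx e → y.1.idx e}
  {P : DBModel (sig D C)} {hP : P.IsModelOfT} {ε : y.1.M.Embedding P}
  {θ₁ θ₂ : x.1.M.FnEmbedding P}
  {μ : (e : Option D.Repo) → RIdx → x.1.idx e} {ρ : (s : Option D.Ty) → ℕ → x.1.M.carrier s}
  {μ' : (e : Option D.Repo) → RIdx → y.1.idx e} {ρ' : (s : Option D.Ty) → ℕ → P.carrier s}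

theorem RespectsParams.map_const (h : RespectsParams x y K₀ θ₁ ε.toFn) :
    ∀ k ∈ K₀, θ₁.toFun _ (x.1.M.const k.1 k.2) = P.const k.1 k.2 :=
  fun k hk => (h.const k hk).trans (ε.map_const _ _)

theorem Glues.case {j : x.1.idx none} {j' : y.1.idx none} (h : Glues x y K₀ ε θ₁ none j j')
    {z : D.CVar} (hz : z ≠ D.self) :
    θ₁.toFun _ (x.1.arr (.case z) j) = ε.toFun _ (y.1.arr (.case z) j') :=
  h.arr (.case z) rfl (by simpa using hz)

theorem Glues.ctrl {j : x.1.idx none} {j' : y.1.idx none} (h : Glues x y K₀ ε θ₁ none j j')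
    (z : C) : θ₁.toFun _ (x.1.arr (.ctrl z) j) = ε.toFun _ (y.1.arr (.ctrl z) j') :=
  h.arr (.ctrl z) rfl (by simp)

theorem Glues.repo {R : D.Repo} {j : x.1.idx (some R)} {j' : y.1.idx (some R)}
    (h : Glues x y K₀ ε θ₁ (some R) j j') (k : Fin (D.repoArity R)) :
    θ₁.toFun _ (x.1.arr (.repo R k) j) = ε.toFun _ (y.1.arr (.repo R k) j') :=
  h.arr (.repo R k) rfl (by simp)

/-- The lifecycle conditions, the choice conditions and the rest of a guard. -/
theorem Rule.guard_transfer {r : Rule D C} (hr : r.Tame)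
    (hK : (r.toTransition (C := C) .multiset).consts ⊆ K₀)
    (h₁ : Glues x y K₀ ε θ₁ none (μ none .case) (f none (μ none .case)))
    (hμ : μ' none .case = f none (μ none .case))
    (hx : (r.toTransition .multiset).guard.Holds x.1.M x.1.arr μ ρ)
    (hpre : (CQ.tr (J := RI D) Empty.elim RIdx.case (fun m _ => RIdx.lit m)
      (fun s n => .dvar (sg := sig D C) (s := some s) n) r.pre).Holds P (y.1.extend P hP ε).arr
      μ' ρ')
    (hgp : (r.eff.guardPart (C := C)).Holds P (y.1.extend P hP ε).arr μ' ρ') :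
    (r.toTransition .multiset).guard.Holds P (y.1.extend P hP ε).arr μ' ρ' := by
  obtain ⟨hlife, hcond, -⟩ := hx
  have hKg := QF.consts_conj_subset.1 (Set.union_subset_iff.1 hK).1
  refine ⟨?_, ?_, hpre, hgp, trivial⟩
  · refine (QF.Agree.holds_iff (θ := θ₁) (K₀ := K₀) h₁.map_const (hKg _ (.head _)) ?_).1 hlife
    refine QF.Agree.conj (List.forall_mem_map.2 ?_)
    refine fun p hp => ⟨(h₁.ctrl p.1).trans ?_, trivial⟩
    rw [← hμ]
    rfl
  · refine (QF.Agree.holds_iff (θ := θ₁) (K₀ := K₀) h₁.map_const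
      (hKg _ (.tail _ (.head _))) ?_).1 hcond
    refine QF.Agree.conj (List.forall_mem_map.2 ?_)
    refine fun φ hφ => Cond.tr_agree fun z hz => (h₁.case ?_).trans ?_
    · rintro rfl
      exact hr.cond_self φ hφ hz
    · rw [← hμ]
      rfl

/-- The conjunct added by the effect. -/
theorem Effect.guardPart_transfer {r : Rule D C} (hle : x.Le K₀ y f)
    (hK : (r.toTransition (C := C) .multiset).consts ⊆ K₀)
    (hμm : ∀ R, μ' (some R) .main = f (some R) (μ (some R) .main))
    (hdel : ∀ R w sp, r.eff = .deleteSet R w sp → (∀ k, (w k).vars = ∅) ∨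
      (Glues x y K₀ ε θ₂ (some R) (μ (some R) .main) (f (some R) (μ (some R) .main)) ∧
        ∀ v ∈ r.eff.vars, θ₂.toFun (some v.1) (ρ (some v.1) v.2) = ρ' (some v.1) v.2))
    (hx : (r.eff.guardPart (C := C)).Holds x.1.M x.1.arr μ ρ) :
    (r.eff.guardPart (C := C)).Holds P (y.1.extend P hP ε).arr μ' ρ' := by
  have hfix : ∀ R (k : Fin (D.repoArity R)) d, ⟨some (D.repoAttr R k), d⟩ ∈ K₀ →
      x.1.arr (.repo R k) (μ (some R) .main) = x.1.M.const (some (D.repoAttr R k)) d →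
      ε.toFun _ (y.1.arr (.repo R k) (μ' (some R) .main)) =
        P.const (some (D.repoAttr R k)) d := by
    intro R k d hd h
    rw [hμm]
    refine (congrArg (ε.toFun _) ((hle.arr_eq_const (a := .repo R k) (by simp) hd _).1 h)).trans ?_
    exact ε.map_const _ _
  cases heq : r.eff with
  | set sp => trivial
  | condUpdate R ψ η₁ η₂ => trivial
  | insertSet R u sp =>
    rw [heq] at hx
    refine QF.holds_conj.2 (List.forall_mem_ofFn_iff.2 fun k => ?_)
    exact hfix R k _ (Rule.insert_undef_mem hK heq k)
      (List.forall_mem_ofFn_iff.1 (QF.holds_conj.1 hx) k)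
  | deleteSet R w sp =>
    rw [heq] at hx
    refine QF.holds_conj.2 (List.forall_mem_ofFn_iff.2 fun k => ?_)
    have hxk := List.forall_mem_ofFn_iff.1 (QF.holds_conj.1 hx) k
    obtain hw | ⟨hglue, hρ⟩ := hdel R w sp heq
    · cases hwk : w k with
      | var m =>
        have := hw k
        rw [hwk] at this
        exact absurd this (Set.singleton_ne_empty _)
      | const d =>
        rw [hwk] at hxk
        exact hfix R k d (Rule.delete_const_mem hK heq hwk) hxk
    · have h₁ : θ₂.toFun _ ((w k).den x.1.M ρ) = (w k).den P ρ' :=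
        Val.den_map (fun d hd => hglue.map_const ⟨some (D.repoAttr R k), d⟩
          (Rule.delete_const_mem hK heq hd)) fun v hv => hρ v (by rw [heq]; exact .inr ⟨k, hv⟩)
      have h₂ : x.1.arr (.repo R k) (μ (some R) .main) = (w k).den x.1.M ρ :=
        Eq.trans hxk (Val.tr_eval _)
      have h₃ : ε.toFun _ (y.1.arr (.repo R k) (μ' (some R) .main)) = (w k).den P ρ' := by
        rw [hμm]
        exact (hglue.repo k).symm.trans ((congrArg (θ₂.toFun _) h₂).trans h₁)
      exact Eq.trans h₃ (Val.tr_eval _).symm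

/-- The precondition: the case part is transferred by `θ₁`, the rest by `θ₂`. -/
theorem CQ.transfer {Q χ ξ : CQ D Empty (GVar D)} {p} (hs : SepSplit Q χ p ξ)
    (hself : .inl D.self ∉ CQ.caseVars Q)
    (hK : (CQ.tr (J := RI D) (X := RX D) Empty.elim RIdx.case (fun m _ => RIdx.lit m)
      (fun s n => .dvar (sg := sig D C) (s := some s) n) Q).consts ⊆ K₀)
    (hx : (CQ.tr (J := RI D) Empty.elim RIdx.case (fun m _ => RIdx.lit m)
      (fun s n => .dvar (sg := sig D C) (s := some s) n) Q).Holds x.1.M x.1.arr μ ρ)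
    (h₁ : Glues x y K₀ ε θ₁ none (μ none .case) (f none (μ none .case)))
    (h₂ : RespectsParams x y K₀ θ₂ ε.toFn)
    (hμ : μ' none .case = f none (μ none .case))
    (hρ₁ : ∀ v ∈ χ.vars, θ₁.toFun (some v.1) (ρ (some v.1) v.2) = ρ' (some v.1) v.2)
    (hρ₂ : ∀ v ∉ χ.vars, θ₂.toFun (some v.1) (ρ (some v.1) v.2) = ρ' (some v.1) v.2)
    (α : RIdx)
    (hglue : ∀ q ∈ p, Glues x y K₀ ε θ₂ (some q.1) (μ (some q.1) α) (f (some q.1) (μ (some q.1) α)))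
    (hrepo : ∀ q ∈ p, ∀ k, x.1.arr (.repo q.1 k) (μ (some q.1) α) =
      ((q.2 k).tr (J := RI D) Empty.elim RIdx.case
        (fun s n => .dvar (sg := sig D C) (s := some s) n)).eval x.1.M x.1.arr μ ρ)
    (hlit : ∀ q ∈ p, ∀ m, μ' (some q.1) (.lit m) = f (some q.1) (μ (some q.1) α)) :
    (CQ.tr (J := RI D) Empty.elim RIdx.case (fun m _ => RIdx.lit m)
      (fun s n => .dvar (sg := sig D C) (s := some s) n) Q).Holds P (y.1.extend P hP ε).arr μ' ρ' := by
  refine CQ.holds_tr.2 fun l m hl => ?_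
  have hxl := CQ.holds_tr.1 hx l m hl
  have hKl := CQ.consts_tr_subset.1 hK l m hl
  have hlQ : l ∈ Q := List.mem_of_getElem? (List.mem_zipIdx_iff_getElem?.1 hl)
  have hl' := hs.perm.mem_iff.1 hlQ
  rw [List.mem_append, List.mem_append] at hl'
  obtain (hl' | hl') | hl' := hl'
  · refine (QF.Agree.holds_iff (θ := θ₁) (K₀ := K₀) h₁.map_const hKl ?_).1 hxl
    refine Literal.tr_agree (hs.chi_catalog l hl') (fun v hv => hρ₁ v ⟨l, hl', hv⟩)
      (fun z hz => (h₁.case ?_).trans ?_) fun c => c.elim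
    · rintro rfl
      exact hself ⟨l, hlQ, hz⟩
    · rw [← hμ]
      rfl
  · obtain ⟨q, hq, rfl⟩ := List.mem_map.1 hl'
    replace hq : q ∈ p := Option.mem_toList.1 hq
    refine Literal.holds_repo.2 fun k => ?_
    have hKk := Literal.consts_repo_subset.1 hKl k
    have hag := Tm.Agree.eval_eq (θ := θ₂) (K₀ := K₀) (arr := x.1.arr) (μ := μ) (ρ := ρ)
      (arr' := (y.1.extend P hP ε).arr) (μ' := μ') (ρ' := ρ') h₂.map_const hKk (Term.tr_agree
        (fun v hv => hρ₂ v fun hv' => (hs.chi_tuple q hq k).le_bot ⟨hv', hv⟩)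
        (fun z hz => by rw [hs.tuple_noCase q hq k] at hz; exact hz.elim) fun c => c.elim)
    refine Eq.trans ?_ hag
    rw [← hrepo q hq k]
    refine Eq.trans ?_ ((hglue q hq).repo k).symm
    rw [← hlit q hq m]
    rfl
  · refine (QF.Agree.holds_iff (θ := θ₂) (K₀ := K₀) h₂.map_const hKl ?_).1 hxl
    refine Literal.tr_agree (hs.xi_catalog l hl')
      (fun v hv => hρ₂ v fun hv' => hs.chi_xi.le_bot ⟨hv', l, hl', hv⟩)
      (fun z hz => ?_) fun c => c.elim
    have : Sum.inl z ∈ ξ.caseVars := ⟨l, hl', hz⟩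
    rw [hs.xi_noCase] at this
    exact this.elim

theorem SepSplit.of_repoFree {D : DataSchema} {C : Type} {V : D.Ty → Type} {Q : CQ D C V}
    (h : Q.RepoFree) : SepSplit Q Q none [] where
  perm := by simp
  chi_catalog := h
  xi_catalog := fun _ h => by cases h
  tuple_noCase := fun _ h => by cases h
  chi_tuple := fun _ h => by cases h
  xi_noCase := Set.eq_empty_iff_forall_notMem.2 fun _ ⟨_, h, _⟩ => by cases h
  chi_xi := Set.disjoint_left.2 fun _ _ ⟨_, h, _⟩ => by cases h

open Classical in
/-- Tame rules are monotone. -/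
theorem Rule.Tame.monotone {r : Rule D C} (hr : r.Tame) (hKu : UndefClosed (sig D C) K₀)
    (hK : (r.toTransition (C := C) .multiset).consts ⊆ K₀) :
    Transition.Monotone (S := schemaRAS D C init trans) (.case D.self) n K₀
      (r.toTransition .multiset) := by
  intro x y f hle μ ρ hg hx
  change (e : Option D.Repo) → RIdx → x.1.idx e at μ
  change (s : Option D.Ty) → ℕ → x.1.M.carrier s at ρ
  have hpre := hg.2.2.1
  have hgp := hg.2.2.2.1
  have hKpre := QF.consts_conj_subset.1 (Set.union_subset_iff.1 hK).1 _ (.tail _ (.tail _ (.head _)))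
  have hsame := hle.same none (μ none .case)
  obtain ⟨hfree, hdel⟩ | ⟨χ, p, ξ, hs, hdisj, hset, hjoin⟩ := hr.joins
  · obtain ⟨P, hP, e, θ, hθ⟩ := exists_glues hKu hsame y.1.isModel (.refl _)
    let ρ' : (s : Option D.Ty) → ℕ → P.carrier s := fun s m => θ.toFun s (ρ s m)
    refine ⟨P, hP, _, fun e i => f e (μ e i), ρ', ?_,
      Rule.le_after hle hKu r hK hr.self_not_set hP _ hθ hθ.toRespectsParams rfl (fun _ => rfl)
        (fun _ _ => rfl) (fun z hz _ => hθ.case hz) hr.condUpdate hx⟩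
    refine Rule.guard_transfer hr hK hθ rfl hg ?_ ?_
    · exact CQ.transfer (SepSplit.of_repoFree hfree) hr.pre_self hKpre hpre hθ
        hθ.toRespectsParams rfl (fun _ _ => rfl) (fun _ _ => rfl) .case (fun _ h => by cases h)
        (fun _ h => by cases h) (fun _ h => by cases h)
    · exact Effect.guardPart_transfer (θ₂ := θ) hle hK (fun _ => rfl)
        (fun R w sp h => (hdel (by rw [h]; trivial)).elim) hgp
  · obtain ⟨s, α, hanchor, hmain⟩ : ∃ (s : Option D.Repo) (α : RIdx),
        (∀ q ∈ p, s = some q.1 ∧ ∀ k, x.1.arr (.repo q.1 k) (μ (some q.1) α) =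
          ((q.2 k).tr (J := RI D) Empty.elim RIdx.case
            (fun s n => .dvar (sg := sig D C) (s := some s) n)).eval x.1.M x.1.arr μ ρ) ∧
        ∀ R w sp, r.eff = .deleteSet R w sp → (∀ k, (w k).vars = ∅) ∨ (s = some R ∧ α = .main) := by
      by_cases hw : ∃ R w sp, r.eff = .deleteSet R w sp ∧ ¬ ∀ k, (w k).vars = ∅
      · obtain ⟨R, w, sp, heq, hw⟩ := hw
        refine ⟨some R, .main, fun q hq => ?_, fun R' w' sp' h => ?_⟩
        · obtain h | rfl | rfl := hjoin R w sp heq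
          · exact (hw h).elim
          · cases hq
          · cases hq
            refine ⟨rfl, fun k => ?_⟩
            rw [heq] at hgp
            refine (List.forall_mem_ofFn_iff.1 (QF.holds_conj.1 hgp) k).trans ?_
            simp only
            cases w k <;> rfl
        · rw [heq] at h
          cases h
          exact .inr ⟨rfl, rfl⟩
      · push Not at hw
        cases p with
        | none => exact ⟨none, .case, fun _ h => (by cases h), fun R w sp h => .inl (hw R w sp h)⟩
        | some q =>
          have hmem : Literal.repo true q.1 q.2 ∈ r.pre := hs.perm.mem_iff.2 (by simp)
          obtain ⟨m, hm⟩ := List.mem_iff_getElem?.1 hmem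
          refine ⟨some q.1, .lit m, fun q' hq' => ?_, fun R w sp h => .inl (hw R w sp h)⟩
          cases hq'
          exact ⟨rfl, Literal.holds_repo.1
            (CQ.holds_tr.1 hpre _ m (List.mem_zipIdx_iff_getElem?.2 hm))⟩
    obtain ⟨P, hP, ε, θ₁, θ₂, h₁, h₂⟩ := exists_glues_two hKu hsame (hle.same s (μ s α))
    let ρ' : (s : Option D.Ty) → ℕ → P.carrier s := fun
      | none => fun m => θ₁.toFun none (ρ none m)
      | some s => fun m =>
        if ⟨s, m⟩ ∈ χ.vars then θ₁.toFun (some s) (ρ (some s) m) else θ₂.toFun (some s) (ρ (some s) m)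
    let μ' : (e : Option D.Repo) → RIdx → y.1.idx e := fun e i => match i with
      | .case => f e (μ e .case)
      | .main => f e (μ e .main)
      | .lit _ => f e (μ e α)
    have hρ₁ : ∀ v ∈ χ.vars, θ₁.toFun (some v.1) (ρ (some v.1) v.2) = ρ' (some v.1) v.2 :=
      fun v hv => (if_pos hv).symm
    have hρ₂ : ∀ v ∉ χ.vars, θ₂.toFun (some v.1) (ρ (some v.1) v.2) = ρ' (some v.1) v.2 :=
      fun v hv => (if_neg hv).symm
    have heff : ∀ v ∈ r.eff.vars, θ₂.toFun (some v.1) (ρ (some v.1) v.2) = ρ' (some v.1) v.2 :=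
      fun v hv => hρ₂ v fun hv' => hdisj.le_bot ⟨hv, hv'⟩
    refine ⟨P, hP, ε, μ', ρ', ?_, ?_⟩
    · refine Rule.guard_transfer hr hK h₁ rfl hg ?_ ?_
      · refine CQ.transfer hs hr.pre_self hKpre hpre h₁ h₂.toRespectsParams rfl hρ₁ hρ₂ α
          (fun q hq => ?_) (fun q hq => (hanchor q hq).2) fun _ _ _ => rfl
        obtain ⟨rfl, -⟩ := hanchor q hq
        exact h₂
      · refine Effect.guardPart_transfer (θ₂ := θ₂) hle hK (fun _ => rfl)
          (fun R w sp h => (hmain R w sp h).imp_right ?_) hgp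
        rintro ⟨rfl, rfl⟩
        exact ⟨h₂, heff⟩
    · obtain ⟨hset, hvars⟩ | hset := hset
      · exact Rule.le_after hle hKu r hK hr.self_not_set hP _ h₁ h₁.toRespectsParams rfl
          (fun _ => rfl) (fun v hv => by rw [hvars] at hv; exact hv.elim)
          (fun z hz _ => h₁.case hz) hr.condUpdate hx
      · exact Rule.le_after hle hKu r hK hr.self_not_set hP _ h₁ h₂.toRespectsParams rfl
          (fun _ => rfl) heff (fun z hz h => by have := hset z hz; rw [h] at this; cases this)
          hr.condUpdate hx

end Monotone

/-! # The rules of a process are tame -/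

/-- The restrictions on update specifications. -/
structure UpdateSpec.Restricted {D : DataSchema} (u : UpdateSpec D) : Prop where
  agnostic : ¬ u.MentionsSelf
  insert : u.eff.IsInsert → u.pre.RepoFree
  set : u.eff.IsSet → u.pre.RepoFree ∨ (u.pre.Separated ∧ u.SetsAll ∧ u.JoinFree)
  delete : u.eff.IsDelete → u.pre.Separated ∧ u.SetsAll ∧ u.JoinFree
  condUpdate : u.eff.IsCondUpdate → u.pre.RepoFree ∧ u.pre.Boolean ∧ u.OnlyNewVars

section Tame

variable {D : DataSchema} {C : Type}

theorem Effect.vars_set_none : (Effect.set (D := D) fun _ => none).vars = ∅ := by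
  refine Set.eq_empty_iff_forall_notMem.2 ?_
  rintro v (⟨z, w, h, -⟩ | h)
  · cases h
  · exact h

theorem ctrlRule_tame {life new : List (C × Lifecycle)} {cond : List (Cond D)} {H : Set C}
    (hcond : ∀ φ ∈ cond, .inl D.self ∉ φ.caseVars) : (ctrlRule life new cond H).Tame where
  self_not_set := rfl
  cond_self := hcond
  pre_self := fun ⟨_, h, _⟩ => by cases h
  condUpdate := fun h => h.elim
  joins := .inl ⟨fun _ h => (by cases h), fun h => h.elim⟩

theorem ctrlRule_tame_nil {life new : List (C × Lifecycle)} {H : Set C} :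
    (ctrlRule (D := D) life new [] H).Tame :=
  ctrlRule_tame fun _ h => by cases h

theorem interruptRules_tame (a : C) (H : Set C) :
    ∀ r ∈ interruptRules (D := D) a H, r.Tame := by
  intro r hr
  obtain ⟨l, -, rfl⟩ := List.mem_map.1 hr
  exact ctrlRule_tame_nil

theorem UpdateSpec.Restricted.pre_self {u : UpdateSpec D} (hu : u.Restricted)
    {Q : CQ D Empty (GVar D)} (hQ : Q ∈ u.pre.body) : .inl D.self ∉ CQ.caseVars Q :=
  fun h => hu.agnostic (.inl ⟨Q, hQ, h⟩)

theorem specRules_tame {u : UpdateSpec D} (hu : u.Restricted) (life new : List (C × Lifecycle)) :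
    ∀ r ∈ specRules u life new, r.Tame := by
  intro r hr
  obtain ⟨Q, hQ, rfl⟩ := List.mem_map.1 hr
  refine ⟨u.self_not_set, fun _ h => (by cases h), hu.pre_self hQ,
    fun h => ⟨u.filters, (hu.condUpdate h).2.2⟩, ?_⟩
  by_cases hfree : CQ.RepoFree Q ∧ ¬ u.eff.IsDelete
  · exact .inl hfree
  obtain ⟨hset, hjoin⟩ : u.SetsAll ∧ u.JoinFree := by
    cases heq : u.eff with
    | insertSet R w sp =>
      exact (hfree ⟨hu.insert (by rw [heq]; trivial) Q hQ, by rw [heq]; exact id⟩).elim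
    | condUpdate R ψ η₁ η₂ =>
      exact (hfree ⟨(hu.condUpdate (by rw [heq]; trivial)).1 Q hQ, by rw [heq]; exact id⟩).elim
    | set sp =>
      obtain h | ⟨-, hset, hjoin⟩ := hu.set (by rw [heq]; trivial)
      · exact (hfree ⟨h Q hQ, by rw [heq]; exact id⟩).elim
      · exact ⟨hset, hjoin⟩
    | deleteSet R w sp =>
      obtain ⟨-, hset, hjoin⟩ := hu.delete (by rw [heq]; trivial)
      exact ⟨hset, hjoin⟩
  obtain ⟨χ, p, ξ, hs, hdisj, hdel⟩ := hjoin Q hQ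
  refine Or.inr ⟨χ, p, ξ, hs, hdisj, .inr hset, fun R w sp h => ?_⟩
  replace h : u.eff = .deleteSet R w sp := h
  rw [h] at hdel
  exact hdel

/-- The first rule of a nonatomic task. -/
theorem startRule_tame {u : UpdateSpec D} (hu : u.Restricted) (hset : u.eff.IsSet)
    {Q : CQ D Empty (GVar D)} (hQ : Q ∈ u.pre.body) (life : List (C × Lifecycle))
    (upd : C → Option Lifecycle) :
    Rule.Tame { life := life, pre := Q, upd := upd } := by
  refine ⟨rfl, fun _ h => (by cases h), hu.pre_self hQ, fun h => h.elim, ?_⟩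
  obtain h | ⟨h, -, -⟩ := hu.set hset
  · exact .inl ⟨h Q hQ, fun h => h.elim⟩
  · obtain ⟨χ, p, ξ, hs⟩ := h.2 Q hQ
    refine .inr ⟨χ, p, ξ, hs, ?_, .inl ⟨fun _ => rfl, Effect.vars_set_none⟩,
      fun _ _ _ h => (by cases h)⟩
    simp only [Effect.vars_set_none, Set.empty_disjoint]

/-- The second rule of a nonatomic task. -/
theorem finishRule_tame {u : UpdateSpec D} (hset : u.eff.IsSet) (life : List (C × Lifecycle))
    (upd : C → Option Lifecycle) : Rule.Tame { life := life, eff := u.eff, upd := upd } := by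
  refine ⟨u.self_not_set, fun _ h => (by cases h), fun ⟨_, h, _⟩ => (by cases h), fun h => ?_,
    .inl ⟨fun _ h => (by cases h), fun h => ?_⟩⟩
  all_goals
    cases heq : u.eff <;> simp_all [Effect.IsSet, Effect.IsCondUpdate, Effect.IsDelete]

theorem Block.rules_tame (b : Block D) (hwf : b.WellFormed) (hspec : ∀ u ∈ b.specs, u.Restricted)
    (hcond : ∀ φ ∈ b.conds, .inl D.self ∉ φ.caseVars) (κ : Option b.Sub → C) (env : Env C) :
    ∀ r ∈ b.rules κ env, r.Tame := by
  induction b generalizing env with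
  | empty => simpa only [Block.rules, List.forall_mem_singleton] using ctrlRule_tame_nil
  | task atomic u =>
    have hu := hspec u (.head _)
    cases atomic with
    | true => exact specRules_tame hu _ _
    | false =>
      refine List.forall_mem_append.2 ⟨List.forall_mem_map.2 fun Q hQ => ?_,
        List.forall_mem_singleton.2 ?_⟩
      · exact startRule_tame hu (hwf rfl) hQ _ _
      · exact finishRule_tame (hwf rfl) _ _
  | catchEvent e u => exact specRules_tame (hspec u (.head _)) _ _
  | process es us et ut b ih =>
    simp only [Block.specs, List.forall_mem_cons] at hspec
    exact List.forall_mem_append.2 ⟨List.forall_mem_append.2 ⟨specRules_tame hspec.1 _ _,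
      specRules_tame hspec.2.1 _ _⟩, ih hwf hspec.2.2 hcond _ _⟩
  | subprocess p ih =>
    simp only [Block.rules, List.forall_mem_append, List.forall_mem_cons, List.not_mem_nil,
      IsEmpty.forall_iff, implies_true]
    exact ⟨⟨ctrlRule_tame_nil, ctrlRule_tame_nil, trivial⟩, ih hwf.2 hspec hcond _ _⟩
  | possibleCompletion φ₁ φ₂ e b ih =>
    simp only [Block.conds, List.forall_mem_cons] at hcond
    obtain ⟨h₁, h₂, hcond⟩ := hcond
    simp only [Block.rules, List.forall_mem_append, List.forall_mem_cons, List.not_mem_nil,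
      IsEmpty.forall_iff, implies_true]
    refine ⟨⟨⟨ctrlRule_tame_nil, ctrlRule_tame (by simpa using h₁), trivial⟩, ?_⟩,
      ih hwf hspec hcond _ _⟩
    cases e <;> exact List.forall_mem_map.2 fun _ _ => ctrlRule_tame (by simpa using h₂)
  | seq b₁ b₂ ih₁ ih₂ | deferredChoice b₁ b₂ ih₁ ih₂ | parallel b₁ b₂ ih₁ ih₂ =>
    simp only [Block.specs, Block.conds, List.forall_mem_append] at hspec hcond
    simp only [Block.rules, List.forall_mem_append, List.forall_mem_cons, List.not_mem_nil,
      IsEmpty.forall_iff, implies_true]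
    refine ⟨⟨?_, ih₁ hwf.1 hspec.1 hcond.1 _ _⟩, ih₂ hwf.2 hspec.2 hcond.2 _ _⟩
    simp only [ctrlRule_tame_nil, and_self]
  | exclusiveChoice φ₁ φ₂ b₁ b₂ ih₁ ih₂ | inclusiveChoice φ₁ φ₂ b₁ b₂ ih₁ ih₂
  | loop φ₁ φ₂ b₁ b₂ ih₁ ih₂ =>
    simp only [Block.specs, Block.conds, List.forall_mem_append, List.forall_mem_cons]
      at hspec hcond
    obtain ⟨h₁, h₂, hcond⟩ := hcond
    simp only [Block.rules, List.forall_mem_append, List.forall_mem_cons, List.not_mem_nil,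
      IsEmpty.forall_iff, implies_true]
    refine ⟨⟨?_, ih₁ hwf.1 hspec.1 hcond.1 _ _⟩, ih₂ hwf.2 hspec.2 hcond.2 _ _⟩
    simp only [ctrlRule_tame_nil, true_and, and_true]
    repeat' apply And.intro
    all_goals exact ctrlRule_tame (by simp [Cond.caseVars, h₁, h₂])
  | eventChoice e₁ u₁ e₂ u₂ b₁ b₂ ih₁ ih₂ =>
    simp only [Block.specs, Block.conds, List.forall_mem_append, List.forall_mem_cons]
      at hspec hcond
    simp only [Block.rules, List.forall_mem_append, List.forall_mem_cons, List.not_mem_nil,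
      IsEmpty.forall_iff, implies_true]
    refine ⟨⟨⟨⟨⟨⟨ctrlRule_tame_nil, trivial⟩, specRules_tame hspec.1 _ _⟩,
      specRules_tame hspec.2.1 _ _⟩, ?_⟩, ih₁ hwf.1 hspec.2.2.1 hcond.1 _ _⟩,
      ih₂ hwf.2 hspec.2.2.2 hcond.2 _ _⟩
    simp only [ctrlRule_tame_nil, and_self]
  | backwardException e a b ih₁ ih₂ =>
    simp only [Block.specs, Block.conds, List.forall_mem_append] at hspec hcond
    simp only [Block.rules, List.forall_mem_append, List.forall_mem_cons, List.not_mem_nil,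
      IsEmpty.forall_iff, implies_true]
    refine ⟨⟨⟨?_, interruptRules_tame _ _⟩, ih₁ hwf.2.1 hspec.1 hcond.1 _ _⟩,
      ih₂ hwf.2.2 hspec.2 hcond.2 _ _⟩
    simp only [ctrlRule_tame_nil, and_self]
  | forwardException e a b₁ b₂ ih ih₁ ih₂ =>
    simp only [Block.specs, Block.conds, List.forall_mem_append] at hspec hcond
    simp only [Block.rules, List.forall_mem_append, List.forall_mem_cons, List.not_mem_nil,
      IsEmpty.forall_iff, implies_true]
    refine ⟨⟨⟨⟨?_, interruptRules_tame _ _⟩, ih hwf.2.1 hspec.1.1 hcond.1.1 _ _⟩,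
      ih₁ hwf.2.2.1 hspec.1.2 hcond.1.2 _ _⟩, ih₂ hwf.2.2.2 hspec.2 hcond.2 _ _⟩
    simp only [ctrlRule_tame_nil, and_self]
  | nonInterrupting e a b₁ b₂ ih ih₁ ih₂ =>
    simp only [Block.specs, Block.conds, List.forall_mem_append] at hspec hcond
    simp only [Block.rules, List.forall_mem_append, List.forall_mem_cons, List.not_mem_nil,
      IsEmpty.forall_iff, implies_true]
    refine ⟨⟨⟨⟨?_, List.forall_mem_map.2 fun _ _ => ctrlRule_tame_nil⟩,
      ih hwf.2.1 hspec.1.1 hcond.1.1 _ _⟩,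
      ih₁ hwf.2.2.1 hspec.1.2 hcond.1.2 _ _⟩, ih₂ hwf.2.2.2 hspec.2 hcond.2 _ _⟩
    simp only [ctrlRule_tame_nil, and_self]

theorem Block.finite_sub (b : Block D) : Finite b.Sub := by
  induction b <;> simp only [Block.Sub] <;> infer_instance

theorem Comp.finite [Finite C] : Finite (Comp D C) := by
  have := D.cvar_finite
  have := D.repo_finite
  refine Finite.of_injective (β := D.CVar ⊕ C ⊕ ((R : D.Repo) × Fin (D.repoArity R)))
    (fun
      | .case z => .inl z
      | .ctrl c => .inr (.inl c)
      | .repo R k => .inr (.inr ⟨R, k⟩)) ?_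
  rintro (z | z | ⟨R, k⟩) (z' | z' | ⟨R', k'⟩) h <;> simp_all

theorem DataSchema.Acyclic.sig (h : D.Acyclic) (f : (sig D C).F) :
    ¬ Relation.TransGen (fun f g => (sig D C).tgt f = (sig D C).src g) f f := by
  have key : ∀ f g, Relation.TransGen (fun f g => (Dab.sig D C).tgt f = (Dab.sig D C).src g) f g →
      Relation.TransGen D.Edge ⟨f.1, some f.2⟩ ⟨g.1, some g.2⟩ := by
    have step : ∀ f g, (Dab.sig D C).tgt f = (Dab.sig D C).src g →
        Relation.TransGen D.Edge ⟨f.1, some f.2⟩ ⟨g.1, some g.2⟩ := fun f g hfg =>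
      (Relation.TransGen.single (.foreign f.1 g.1 f.2 (Option.some.inj hfg))).tail (.key g.1 g.2)
    intro f g hfg
    induction hfg with
    | single h => exact step _ _ h
    | tail _ h ih => exact ih.trans (step _ _ h)
  exact fun hf => h _ (key f f hf)

end Tame

/-! # Separated properties are upward closed -/

section Properties

variable {M : DABModel}

theorem Property.vars_mem_tuple {υ : Property M} {i : Fin υ.n} (hυ : (υ.guards i).Separated)
    {Q χ ξ : CQ M.D M.Ctrl (GVar M.D)} {p} (hQ : Q ∈ (υ.guards i).body) (hs : SepSplit Q χ p ξ)
    {v : (_ : M.D.Ty) × ℕ} (hv : v ∈ CQ.vars Q) : ∃ q ∈ p, ∃ k, v ∈ (q.2 k).vars := by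
  obtain ⟨Q', hQ', l, hl, hrepo, hvl⟩ := υ.inRepo i v ⟨Q, hQ, hv⟩
  obtain rfl : Q' = Q := by
    by_contra hne
    have : Std.Symm fun Q Q' : CQ M.D M.Ctrl (GVar M.D) => Disjoint (CQ.vars Q) (CQ.vars Q') :=
      ⟨fun _ _ h => Disjoint.symm h⟩
    have hd := hυ.1.forall hQ' hQ hne
    exact hd.le_bot ⟨⟨l, hl, hvl⟩, hv⟩
  have hl' := hs.perm.mem_iff.1 hl
  rw [List.mem_append, List.mem_append] at hl'
  obtain (hl' | hl') | hl' := hl'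
  · exact (hs.chi_catalog l hl' hrepo).elim
  · obtain ⟨q, hq, rfl⟩ := List.mem_map.1 hl'
    obtain ⟨t, ⟨k, rfl⟩, ht⟩ := hvl
    exact ⟨q, Option.mem_toList.1 hq, k, ht⟩
  · exact (hs.xi_catalog l hl' hrepo).elim

theorem Term.eq_var_of_mem_vars {D : DataSchema} {C : Type} {V : D.Ty → Type} {s : D.Ty}
    {t : Term D C V (some s)} {v : (s : D.Ty) × V s} (h : v ∈ t.vars) :
    ∃ w : V s, t = .var w ∧ v = ⟨s, w⟩ := by
  cases t with
  | const d => exact h.elim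
  | var w => exact ⟨w, rfl, h⟩
  | cvar x => exact h.elim

variable {init : (a : Comp M.D M.Ctrl) → (sig M.D M.Ctrl).K ((sig M.D M.Ctrl).atgt a)}
  {trans : List (Transition (sig M.D M.Ctrl))}
  {K₀ : Set ((s : (sig M.D M.Ctrl).S) × (sig M.D M.Ctrl).K s)}

/-- A disjunct of a separated property that holds in `x` also holds in each larger `y`. -/
theorem Property.disjunct_transfer {υ : Property M} {i : Fin υ.n}
    (hυ : (υ.guards i).Separated) {Q : CQ M.D M.Ctrl (GVar M.D)} (hQ : Q ∈ (υ.guards i).body)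
    {x y : (schemaRAS M.D M.Ctrl init trans).Pointed (.case M.D.self) υ.n}
    {f : (e : Option M.D.Repo) → x.1.idx e → y.1.idx e} (hle : x.Le K₀ y f)
    (hKu : UndefClosed (sig M.D M.Ctrl) K₀)
    {μ : (e : Option M.D.Repo) → PIdx υ.n → x.1.idx e}
    {ρ : (s : Option M.D.Ty) → Fin υ.n × ℕ → x.1.M.carrier s} (hμ : μ none (.case i) = x.2 i)
    (d : ℕ)
    (hK : (CQ.tr (J := fun _ => PIdx υ.n) (X := fun _ => Fin υ.n × ℕ) id (PIdx.case i)
      (fun m _ => PIdx.lit i d m)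
      (fun s v => .dvar (sg := sig M.D M.Ctrl) (s := some s) (i, v)) Q).consts ⊆ K₀)
    (hx : (CQ.tr (J := fun _ => PIdx υ.n) id (PIdx.case i) (fun m _ => PIdx.lit i d m)
      (fun s v => .dvar (sg := sig M.D M.Ctrl) (s := some s) (i, v)) Q).Holds
        x.1.M x.1.arr μ ρ) :
    ∃ (L : (e : Option M.D.Repo) → y.1.idx e) (ρi : (s : Option M.D.Ty) → ℕ → y.1.M.carrier s),
      ∀ (μ' : (e : Option M.D.Repo) → PIdx υ.n → y.1.idx e)
        (ρ' : (s : Option M.D.Ty) → Fin υ.n × ℕ → y.1.M.carrier s),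
        μ' none (.case i) = y.2 i → (∀ e m, μ' e (.lit i d m) = L e) →
        (∀ s m, ρ' s (i, m) = ρi s m) →
        (CQ.tr (J := fun _ => PIdx υ.n) id (PIdx.case i) (fun m _ => PIdx.lit i d m)
          (fun s v => .dvar (sg := sig M.D M.Ctrl) (s := some s) (i, v)) Q).Holds
            y.1.M y.1.arr μ' ρ' := by
  obtain ⟨χ, p, ξ, hs⟩ := hυ.2 Q hQ
  obtain ⟨s, α, hanchor⟩ : ∃ (s : Option M.D.Repo) (α : PIdx υ.n), ∀ q ∈ p, s = some q.1 ∧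
      ∀ k, x.1.arr (.repo q.1 k) (μ (some q.1) α) =
        ((q.2 k).tr (J := fun _ => PIdx υ.n) id (PIdx.case i)
          (fun s v => .dvar (sg := sig M.D M.Ctrl) (s := some s) (i, v))).eval
            x.1.M x.1.arr μ ρ := by
    cases p with
    | none => exact ⟨none, .case i, fun _ h => by cases h⟩
    | some q =>
      have hmem : Literal.repo true q.1 q.2 ∈ Q := hs.perm.mem_iff.2 (by simp)
      obtain ⟨m, hm⟩ := List.mem_iff_getElem?.1 hmem
      refine ⟨some q.1, .lit i d m, fun q' hq' => ?_⟩
      cases hq'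
      exact ⟨rfl, Literal.holds_repo.1
        (CQ.holds_tr.1 hx _ m (List.mem_zipIdx_iff_getElem?.2 hm))⟩
  have hsame := hle.same none (x.2 i)
  rw [show f none (x.2 i) = y.2 i from hle.point i] at hsame
  obtain ⟨P, hP, ε, θ₁, θ₂, h₁, h₂⟩ := exists_glues_two hKu hsame (hle.same s (μ s α))
  have hglue : ∀ q ∈ p,
      Glues x y K₀ ε θ₂ (some q.1) (μ (some q.1) α) (f (some q.1) (μ (some q.1) α)) := by
    intro q hq
    obtain ⟨rfl, -⟩ := hanchor q hq
    exact h₂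
  have hval : ∀ (s : M.D.Ty) (m : ℕ), ∃ z, (⟨s, m⟩ : (_ : M.D.Ty) × ℕ) ∈ CQ.vars Q →
      θ₂.toFun (some s) (ρ (some s) (i, m)) = ε.toFun (some s) z := by
    intro s m
    by_cases hv : (⟨s, m⟩ : (_ : M.D.Ty) × ℕ) ∈ CQ.vars Q
    · obtain ⟨q, hq, k, hk⟩ := Property.vars_mem_tuple hυ hQ hs hv
      obtain ⟨w, hw, hsw⟩ := Term.eq_var_of_mem_vars hk
      cases hsw
      refine ⟨y.1.arr (.repo q.1 k) (f (some q.1) (μ (some q.1) α)), fun _ => ?_⟩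
      have h := (hanchor q hq).2 k
      rw [hw] at h
      exact (congrArg (θ₂.toFun _) h).symm.trans ((hglue q hq).repo k)
    · exact ⟨y.1.M.const (some s) (M.D.undef s), fun h => (hv h).elim⟩
  choose ρi hρi using hval
  refine ⟨fun e => f e (μ e α), fun
    | none => fun _ => y.1.M.const none Lifecycle.undef
    | some s => ρi s, fun μ' ρ' hμ' hlit hρ' => ?_⟩
  have hρ : ∀ v ∈ CQ.vars Q,
      θ₂.toFun (some v.1) (ρ (some v.1) (i, v.2)) = ε.toFun (some v.1) (ρ' (some v.1) (i, v.2)) :=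
    fun v hv => (hρi v.1 v.2 hv).trans (congrArg _ (hρ' (some v.1) v.2).symm)
  refine (QF.Agree.holds_iff (K₀ := Set.univ) (θ := ε.toFn) (arr := y.1.arr)
    (arr' := (y.1.extend P hP ε).arr) (μ := μ') (μ' := μ') (ρ := ρ')
    (ρ' := fun s v => ε.toFun s (ρ' s v)) (fun k _ => ε.map_const _ _) (Set.subset_univ _)
    (QF.Agree.of_forall (fun _ _ => rfl) (fun _ _ => rfl) (fun _ _ _ => Iff.rfl) _)).2 ?_
  refine CQ.holds_tr.2 fun l m hl => ?_
  have hxl := CQ.holds_tr.1 hx l m hl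
  have hKl := CQ.consts_tr_subset.1 hK l m hl
  have hlQ : l ∈ Q := List.mem_of_getElem? (List.mem_zipIdx_iff_getElem?.1 hl)
  have hl' := hs.perm.mem_iff.1 hlQ
  rw [List.mem_append, List.mem_append] at hl'
  obtain (hl' | hl') | hl' := hl'
  · refine (QF.Agree.holds_iff (θ := θ₁) (K₀ := K₀) h₁.map_const hKl ?_).1 hxl
    refine Literal.tr_agree (hs.chi_catalog l hl') (fun v hv => ?_) (fun z _ => ?_) fun c _ => ?_
    · obtain ⟨q, hq, k, hk⟩ := Property.vars_mem_tuple hυ hQ hs ⟨l, hlQ, hv⟩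
      exact ((hs.chi_tuple q hq k).le_bot ⟨⟨l, hl', hv⟩, hk⟩).elim
    · show θ₁.toFun _ (x.1.arr (.case z) (μ none (.case i))) =
        ε.toFun _ (y.1.arr (.case z) (μ' none (.case i)))
      rw [hμ, hμ']
      by_cases hz : z = M.D.self
      · subst hz
        exact h₁.point i
      · exact h₁.case hz
    · show θ₁.toFun _ (x.1.arr (.ctrl c) (μ none (.case i))) =
        ε.toFun _ (y.1.arr (.ctrl c) (μ' none (.case i)))
      rw [hμ, hμ']
      exact h₁.ctrl c
  · obtain ⟨q, hq, rfl⟩ := List.mem_map.1 hl'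
    replace hq : q ∈ p := Option.mem_toList.1 hq
    refine Literal.holds_repo.2 fun k => ?_
    have hKk := Literal.consts_repo_subset.1 hKl k
    have hag := Tm.Agree.eval_eq (θ := θ₂) (K₀ := K₀) (arr := x.1.arr) (μ := μ) (ρ := ρ)
      (arr' := (y.1.extend P hP ε).arr) (μ' := μ') (ρ' := fun s v => ε.toFun s (ρ' s v))
      h₂.map_const hKk (Term.tr_agree
        (fun v hv => hρ v ⟨_, hlQ, ⟨_, q.2 k⟩, ⟨k, rfl⟩, hv⟩)
        (fun z hz => by rw [hs.tuple_noCase q hq k] at hz; exact hz.elim)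
        (fun z hz => by rw [hs.tuple_noCase q hq k] at hz; exact hz.elim))
    refine Eq.trans ?_ hag
    rw [← (hanchor q hq).2 k]
    refine Eq.trans ?_ ((hglue q hq).repo k).symm
    exact congrArg (fun j => ε.toFun _ (y.1.arr (.repo q.1 k) j)) (hlit (some q.1) m)
  · refine (QF.Agree.holds_iff (θ := θ₂) (K₀ := K₀) h₂.map_const hKl ?_).1 hxl
    have hno : ∀ z, z ∉ l.caseVars := fun z hz => by
      have : z ∈ ξ.caseVars := ⟨l, hl', hz⟩
      rw [hs.xi_noCase] at this
      exact this
    exact Literal.tr_agree (hs.xi_catalog l hl') (fun v hv => hρ v ⟨l, hlQ, hv⟩)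
      (fun z hz => (hno _ hz).elim) (fun z hz => (hno _ hz).elim)

variable (init trans) in
/-- The property holds for the distinguished cases. -/
def Property.HoldsAt (υ : Property M)
    (x : (schemaRAS M.D M.Ctrl init trans).Pointed (.case M.D.self) υ.n) : Prop :=
  ∃ (μ : (e : Option M.D.Repo) → PIdx υ.n → x.1.idx e)
    (ρ : (s : Option M.D.Ty) → Fin υ.n × ℕ → x.1.M.carrier s),
    (∀ i, μ none (.case i) = x.2 i) ∧ υ.toFormula.matrix.Holds x.1.M x.1.arr μ ρ

theorem Property.HoldsAt.mono {υ : Property M} (hυ : υ.Separated)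
    (hKu : UndefClosed (sig M.D M.Ctrl) K₀) (hK : υ.toFormula.matrix.consts ⊆ K₀)
    {x y : (schemaRAS M.D M.Ctrl init trans).Pointed (.case M.D.self) υ.n}
    {f : (e : Option M.D.Repo) → x.1.idx e → y.1.idx e} (hle : x.Le K₀ y f)
    (hx : υ.HoldsAt init trans x) : υ.HoldsAt init trans y := by
  obtain ⟨μ, ρ, hμ, hdist, hguards⟩ := hx
  have hK' := QF.consts_conj_subset.1 (Set.union_subset_iff.1 hK).2
  have key : ∀ i, ∃ p ∈ (υ.guards i).body.zipIdx, ∃ (L : (e : Option M.D.Repo) → y.1.idx e)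
      (ρi : (s : Option M.D.Ty) → ℕ → y.1.M.carrier s),
      ∀ (μ' : (e : Option M.D.Repo) → PIdx υ.n → y.1.idx e)
        (ρ' : (s : Option M.D.Ty) → Fin υ.n × ℕ → y.1.M.carrier s),
        μ' none (.case i) = y.2 i → (∀ e m, μ' e (.lit i p.2 m) = L e) →
        (∀ s m, ρ' s (i, m) = ρi s m) →
        (CQ.tr (J := fun _ => PIdx υ.n) id (PIdx.case i) (fun m _ => PIdx.lit i p.2 m)
          (fun s v => .dvar (sg := sig M.D M.Ctrl) (s := some s) (i, v)) p.1).Holds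
            y.1.M y.1.arr μ' ρ' := by
    intro i
    obtain ⟨φ, hφ, hφx⟩ := QF.holds_disj.1 (List.forall_mem_ofFn_iff.1 (QF.holds_conj.1 hguards) i)
    obtain ⟨p, hp, rfl⟩ := List.mem_map.1 hφ
    have hKi := QF.consts_disj_subset.1 (List.forall_mem_ofFn_iff.1 hK' i) _ hφ
    exact ⟨p, hp, Property.disjunct_transfer (hυ i)
      (List.mem_of_getElem? (List.mem_zipIdx_iff_getElem?.1 hp)) hle hKu (hμ i) p.2 hKi hφx⟩
  choose p hp L ρi hρi using key
  let μ' : (e : Option M.D.Repo) → PIdx υ.n → y.1.idx e := fun e i => match i with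
    | .case i => f e (μ e (.case i))
    | .lit i _ _ => L i e
  have hμ' : ∀ i, μ' none (.case i) = y.2 i := fun i =>
    (congrArg (f none) (hμ i)).trans (hle.point i)
  refine ⟨μ', fun s v => ρi v.1 s v.2, hμ', ?_, ?_⟩
  · refine QF.holds_conj.2 (List.forall_mem_ofFn_iff.2 fun i =>
      QF.holds_conj.2 (List.forall_mem_ofFn_iff.2 fun j => ?_))
    have h := List.forall_mem_ofFn_iff.1 (QF.holds_conj.1
      (List.forall_mem_ofFn_iff.1 (QF.holds_conj.1 hdist) i)) j
    by_cases hij : i = j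
    · rw [if_pos hij]
      trivial
    · rw [if_neg hij] at h ⊢
      exact fun h' => h (hle.injective none h')
  · refine QF.holds_conj.2 (List.forall_mem_ofFn_iff.2 fun i => QF.holds_disj.2 ?_)
    exact ⟨_, List.mem_map.2 ⟨p i, hp i, rfl⟩,
      hρi i μ' _ (hμ' i) (fun _ _ => rfl) fun _ _ => rfl⟩

end Properties

/-- Backward reachability terminates on separated properties of processes with tame rules and an
acyclic catalog. -/
theorem backReachTerminates_of_tame {M : DABModel} (hacyclic : M.Acyclic)
    (htame : ∀ r ∈ M.rules, r.Tame) (υ : Property M) (hυ : υ.Separated) :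
    BackReachTerminates .multiset M υ := by
  have := M.D.repo_finite
  have := M.D.cat_finite
  have := M.P.finite_sub
  have : Finite (sig M.D M.Ctrl).E := inferInstanceAs (Finite (Option M.D.Repo))
  have : Finite (sig M.D M.Ctrl).A := Comp.finite
  have : Finite (sig M.D M.Ctrl).F :=
    inferInstanceAs (Finite ((R : M.D.Cat) × Fin (M.D.catArity R)))
  let K₀ : Set ((s : (sig M.D M.Ctrl).S) × (sig M.D M.Ctrl).K s) :=
    (⋃ t ∈ {t | t ∈ M.rules.map (Rule.toTransition .multiset)}, t.consts) ∪
      υ.toFormula.matrix.consts ∪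
      ⋃ f : (sig M.D M.Ctrl).F,
        {⟨_, (sig M.D M.Ctrl).undef ((sig M.D M.Ctrl).src f)⟩,
          ⟨_, (sig M.D M.Ctrl).undef ((sig M.D M.Ctrl).tgt f)⟩}
  have hKfin : K₀.Finite :=
    (((List.finite_toSet _).biUnion fun t _ => t.consts_finite).union
      (QF.consts_finite _)).union (Set.finite_iUnion fun f => Set.toFinite _)
  have hKu : UndefClosed (sig M.D M.Ctrl) K₀ := fun f =>
    ⟨.inr (Set.mem_iUnion.2 ⟨f, .inl rfl⟩), .inr (Set.mem_iUnion.2 ⟨f, .inr rfl⟩)⟩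
  have hKt : ∀ t ∈ M.rules.map (Rule.toTransition .multiset), t.consts ⊆ K₀ := fun t ht k hk =>
    .inl (.inl (Set.mem_biUnion (x := t) ht hk))
  refine RAS.bReachTerminates_of_monotone (S := schemaRAS M.D M.Ctrl _ _) (a₀ := .case M.D.self)
    (n := υ.n) hKfin hacyclic.sig (fun t ht => ?_) υ.toFormula (υ.HoldsAt _ _) (fun c => ?_)
    fun x y f hle => Property.HoldsAt.mono hυ hKu (fun k hk => .inl (.inr hk)) hle
  · obtain ⟨r, hr, rfl⟩ := List.mem_map.1 ht
    exact (htame r hr).monotone hKu (hKt _ ht)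
  · constructor
    · rintro ⟨μ, ρ, h⟩
      exact ⟨fun i => μ none (.case i), μ, ρ, fun _ => rfl, h⟩
    · rintro ⟨_, μ, ρ, -, h⟩
      exact ⟨μ, ρ, h⟩

end Dab

theorem backReach_terminates_case_unbounded_restricted
    (M : Dab.DABModel)
    (hself : M.CaseIdentifierAgnostic)
    (hacyclic : M.Acyclic)
    (hinsert : ∀ u ∈ M.P.specs, u.eff.IsInsert → u.pre.RepoFree)
    (hset : ∀ u ∈ M.P.specs, u.eff.IsSet →
      u.pre.RepoFree ∨ (u.pre.Separated ∧ u.SetsAll ∧ u.JoinFree))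
    (hdelete : ∀ u ∈ M.P.specs, u.eff.IsDelete →
      u.pre.Separated ∧ u.SetsAll ∧ u.JoinFree)
    (hcond : ∀ u ∈ M.P.specs, u.eff.IsCondUpdate →
      u.pre.RepoFree ∧ u.pre.Boolean ∧ u.OnlyNewVars)
    (υ : Dab.Property M) (hυ : υ.Separated) :
    Dab.BackReachTerminates .multiset M υ := by
  refine Dab.backReachTerminates_of_tame hacyclic
    (List.forall_mem_cons.2 ⟨Dab.ctrlRule_tame_nil, ?_⟩) υ hυ
  exact M.P.rules_tame M.wellFormed
    (fun u hu => ⟨hself.1 u hu, hinsert u hu, hset u hu, hdelete u hu, hcond u hu⟩) hself.2 _ _
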